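/- arXiv:1510.06519 — 2 statements merged into one kernel-verified Lean document; each statement's English description precedes it below -/
import Mathlib

section
/- For every integer n ≥ 2, the set {ζ_A(n)} ∪ {ζ_A(s_1, s_2) : s_1, s_2 ≥ 1, s_1 + s_2 = n, (q−1) ∤ s_2} ⊂ k_∞ is linearly independent over k. -/
open Polynomial FunctionField

/-- The inclusion of `k = 𝔽_q(θ)` into its completion `k_∞ = 𝔽_q((1/θ))` at the
infinite place. -/
noncomputable def toKinfty (Fq : Type) [Field Fq] [DecidableEq (RatFunc Fq)] :
    RatFunc Fq →+* RatFunc.CompletionAtInfty Fq :=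
  letI := RatFunc.inftyValued Fq
  UniformSpace.Completion.coeRingHom

/-- The Carlitz zeta value `ζ_A(s) = Σ_{a monic} a^{-s} ∈ k_∞`. -/
noncomputable def carlitzZeta (Fq : Type) [Field Fq] [Fintype Fq]
    [DecidableEq (RatFunc Fq)] (s : ℕ) : RatFunc.CompletionAtInfty Fq :=
  ∑' a : {f : Polynomial Fq // f.Monic},
    toKinfty Fq ((algebraMap (Polynomial Fq) (RatFunc Fq) a.1) ^ s)⁻¹

/-- The double zeta value `ζ_A(s₁, s₂) = Σ_{deg a₁ > deg a₂, both monic}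
a₁^{-s₁} a₂^{-s₂} ∈ k_∞`. -/
noncomputable def doubleZeta (Fq : Type) [Field Fq] [Fintype Fq]
    [DecidableEq (RatFunc Fq)] (s₁ s₂ : ℕ) : RatFunc.CompletionAtInfty Fq :=
  ∑' a : {g : Polynomial Fq × Polynomial Fq //
      g.1.Monic ∧ g.2.Monic ∧ g.2.degree < g.1.degree},
    toKinfty Fq
      (((algebraMap (Polynomial Fq) (RatFunc Fq) a.1.1) ^ s₁)⁻¹ *
        ((algebraMap (Polynomial Fq) (RatFunc Fq) a.1.2) ^ s₂)⁻¹)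

namespace CarlitzZeta

section Frobenius

variable (Fq : Type*) [Field Fq] [Fintype Fq]

/-- The `q ^ d`-power Frobenius of an `𝔽_q`-algebra. -/
noncomputable def frob (R : Type*) [CommRing R] [Algebra Fq R] (d : ℕ) : R →+* R :=
  ((FiniteField.frobeniusAlgHom Fq R) ^ d : R →ₐ[Fq] R).toRingHom

variable {Fq} {R : Type*} [CommRing R] [Algebra Fq R]

@[simp]
theorem frob_apply (d : ℕ) (x : R) : frob Fq R d x = x ^ Fintype.card Fq ^ d := by
  induction d generalizing x with
  | zero => simp [frob]
  | succ d ih =>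
    have h : frob Fq R (d + 1) x = frob Fq R d (x ^ Fintype.card Fq) := by
      simp only [frob, pow_succ]
      rfl
    rw [h, ih, ← pow_mul, ← pow_succ']

theorem sub_pow_card_pow (d : ℕ) (x y : R) :
    (x - y) ^ Fintype.card Fq ^ d = x ^ Fintype.card Fq ^ d - y ^ Fintype.card Fq ^ d := by
  simpa using map_sub (frob Fq R d) x y

theorem sum_pow_card_pow {ι : Type*} (d : ℕ) (s : Finset ι) (f : ι → R) :
    (∑ i ∈ s, f i) ^ Fintype.card Fq ^ d = ∑ i ∈ s, f i ^ Fintype.card Fq ^ d := by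
  simpa only [frob_apply] using map_sum (frob Fq R d) f s

theorem aeval_pow_card_pow (d : ℕ) (a : Fq[X]) (x : R) :
    aeval x a ^ Fintype.card Fq ^ d = aeval (x ^ Fintype.card Fq ^ d) a := by
  have h := Polynomial.aeval_algHom_apply ((FiniteField.frobeniusAlgHom Fq R) ^ d) x a
  have e : ∀ y : R, ((FiniteField.frobeniusAlgHom Fq R) ^ d) y = y ^ Fintype.card Fq ^ d :=
    fun y => frob_apply d y
  rw [e, e] at h
  exact h.symm

end Frobenius

theorem two_le_card (Fq : Type*) [Field Fq] [Fintype Fq] : 2 ≤ Fintype.card Fq :=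
  Fintype.one_lt_card

section Norm

variable {Fq : Type*} [Field Fq] [Fintype Fq]
variable {K : Type*} [NormedField K]

theorem norm_eq_one_of_pow_card {x : K} (hx : x ≠ 0) (h : x ^ Fintype.card Fq = x) :
    ‖x‖ = 1 := by
  have hq := two_le_card Fq
  have h1 : x ^ (Fintype.card Fq - 1) = 1 := by
    apply mul_right_cancel₀ hx
    rw [← pow_succ, Nat.sub_add_cancel (by omega), h, one_mul]
  have h2 : ‖x‖ ^ (Fintype.card Fq - 1) = 1 := by rw [← norm_pow, h1, norm_one]
  exact (pow_eq_one_iff_of_nonneg (norm_nonneg _) (by omega)).1 h2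

theorem pow_injective_of_one_lt_norm {θ : K} (hθ : 1 < ‖θ‖) {m n : ℕ} (h : θ ^ m = θ ^ n) :
    m = n := by
  have := congrArg norm h
  rw [norm_pow, norm_pow] at this
  exact pow_right_injective₀ (by linarith) hθ.ne' this

variable [Algebra Fq K]

theorem norm_algebraMap_fq {x : Fq} (hx : x ≠ 0) : ‖algebraMap Fq K x‖ = 1 := by
  apply norm_eq_one_of_pow_card (Fq := Fq)
  · simpa using hx
  · rw [← map_pow, FiniteField.pow_card]

variable [IsUltrametricDist K]

/-- A polynomial with coefficients of norm one has the norm of its leading term at `θ`. -/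
theorem norm_eval_of_norm_coeff {θ : K} (hθ : 1 < ‖θ‖) {p : K[X]}
    (hp : ∀ i, p.coeff i ≠ 0 → ‖p.coeff i‖ = 1) (h0 : p ≠ 0) :
    ‖p.eval θ‖ = ‖θ‖ ^ p.natDegree := by
  have hθ0 : 0 < ‖θ‖ := by linarith
  rw [eval_eq_sum_range, Finset.sum_range_succ]
  have hl : ‖p.coeff p.natDegree * θ ^ p.natDegree‖ = ‖θ‖ ^ p.natDegree := by
    rw [norm_mul, norm_pow, hp _ (by simpa using h0), one_mul]
  have hs : ‖∑ i ∈ Finset.range p.natDegree, p.coeff i * θ ^ i‖ < ‖θ‖ ^ p.natDegree := by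
    rcases Nat.eq_zero_or_pos p.natDegree with h | h
    · simp [h]
    · refine lt_of_le_of_lt (b := ‖θ‖ ^ (p.natDegree - 1)) ?_
        (pow_lt_pow_right₀ hθ (by omega))
      apply IsUltrametricDist.norm_sum_le_of_forall_le_of_nonneg (by positivity)
      intro i hi
      rw [Finset.mem_range] at hi
      by_cases hc : p.coeff i = 0
      · rw [hc, zero_mul, norm_zero]; positivity
      · rw [norm_mul, norm_pow, hp _ hc, one_mul]
        exact pow_le_pow_right₀ hθ.le (by omega)
  rw [← hl] at hs ⊢
  rw [IsUltrametricDist.norm_add_eq_max_of_norm_ne_norm hs.ne, max_eq_right hs.le]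

theorem norm_aeval {θ : K} (hθ : 1 < ‖θ‖) {a : Fq[X]} (ha : a ≠ 0) :
    ‖aeval θ a‖ = ‖θ‖ ^ a.natDegree := by
  have h := norm_eval_of_norm_coeff hθ (p := a.map (algebraMap Fq K)) ?_ ?_
  · rw [natDegree_map] at h
    rw [← h, eval_map_algebraMap]
  · intro i hi
    rw [coeff_map] at hi ⊢
    exact norm_algebraMap_fq (by rintro h; simp [h] at hi)
  · rwa [Ne, Polynomial.map_eq_zero]

theorem norm_aeval_le {θ : K} (hθ : 1 < ‖θ‖) {a : Fq[X]} {d : ℕ} (ha : a.natDegree ≤ d) :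
    ‖aeval θ a‖ ≤ ‖θ‖ ^ d := by
  by_cases h : a = 0
  · simp [h]
  · rw [norm_aeval hθ h]
    exact pow_le_pow_right₀ hθ.le ha

theorem one_le_norm_aeval {θ : K} (hθ : 1 < ‖θ‖) {a : Fq[X]} (ha : a ≠ 0) :
    1 ≤ ‖aeval θ a‖ := by
  rw [norm_aeval hθ ha]
  exact one_le_pow₀ hθ.le

theorem aeval_ne_zero {θ : K} (hθ : 1 < ‖θ‖) {a : Fq[X]} (ha : a ≠ 0) : aeval θ a ≠ 0 := by
  intro h
  have := one_le_norm_aeval hθ ha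
  rw [h, norm_zero] at this
  linarith

end Norm

section PowerSums

variable (Fq : Type*) [Field Fq] [Fintype Fq]

/-- The monic polynomials of degree `d`. -/
noncomputable def monics (d : ℕ) : Finset Fq[X] :=
  (Finset.univ : Finset (Fin d → Fq)).map
    (((degreeLTEquiv Fq d).toEquiv.symm.trans (monicEquivDegreeLT d).symm).toEmbedding.trans
      (Function.Embedding.subtype _))

variable {Fq}

@[simp]
theorem mem_monics {d : ℕ} {a : Fq[X]} : a ∈ monics Fq d ↔ a.Monic ∧ a.natDegree = d := by
  simp only [monics, Finset.mem_map, Finset.mem_univ, true_and, Function.Embedding.trans_apply,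
    Equiv.coe_toEmbedding, Function.Embedding.subtype_apply]
  constructor
  · rintro ⟨v, rfl⟩
    exact ((monicEquivDegreeLT d).symm ((degreeLTEquiv Fq d).symm v)).property
  · intro h
    exact ⟨((degreeLTEquiv Fq d).toEquiv.symm.trans (monicEquivDegreeLT d).symm).symm ⟨a, h⟩,
      by rw [Equiv.apply_symm_apply]⟩

theorem card_monics (d : ℕ) : (monics Fq d).card = Fintype.card Fq ^ d := by
  simp [monics]

variable {K : Type*} [NormedField K]

variable (Fq) in
theorem node_injective {θ : K} (hθ : 1 < ‖θ‖) :
    Function.Injective fun i : ℕ => θ ^ Fintype.card Fq ^ i := fun _ _ h =>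
  Nat.pow_right_injective (two_le_card Fq) (pow_injective_of_one_lt_norm hθ h)

variable [Algebra Fq K]

variable (Fq) in
/-- The power sum `S_d(s) = ∑ a⁻ˢ` over the monic polynomials `a` of degree `d`. -/
noncomputable def powSum (θ : K) (d s : ℕ) : K :=
  ∑ a ∈ monics Fq d, ((aeval θ a) ^ s)⁻¹

variable (Fq) in
/-- The Lagrange weights of the nodes `θ, θ ^ q, …, θ ^ q ^ d`. -/
noncomputable def weight (θ : K) (d i : ℕ) : K :=
  (∏ j ∈ (Finset.range (d + 1)).erase i,
    (θ ^ Fintype.card Fq ^ i - θ ^ Fintype.card Fq ^ j))⁻¹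

theorem sum_weight_mul_aeval {θ : K} (hθ : 1 < ‖θ‖) {d : ℕ} {a : Fq[X]} (ha : a.natDegree ≤ d) :
    ∑ i ∈ Finset.range (d + 1), weight Fq θ d i * aeval θ a ^ Fintype.card Fq ^ i =
      algebraMap Fq K (a.coeff d) := by
  have h := Lagrange.coeff_eq_sum (s := Finset.range (d + 1))
    (v := fun i : ℕ => θ ^ Fintype.card Fq ^ i) (node_injective Fq hθ).injOn
    (P := a.map (algebraMap Fq K)) (by
      rw [Finset.card_range]
      refine lt_of_le_of_lt degree_le_natDegree ?_
      rw [natDegree_map]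
      exact_mod_cast Nat.lt_succ_of_le ha)
  rw [Finset.card_range, Nat.add_sub_cancel, coeff_map] at h
  rw [h]
  refine Finset.sum_congr rfl fun i _ => ?_
  rw [eval_map_algebraMap, aeval_pow_card_pow, weight, div_eq_mul_inv, mul_comm]

variable (Fq) in
/-- The polynomial whose roots are the values at `θ` of the monic polynomials of degree `d`,
normalized to have constant term one. -/
noncomputable def monicRootPoly (θ : K) (d : ℕ) : K[X] :=
  1 - ∑ i ∈ Finset.range (d + 1), C (weight Fq θ d i) * X ^ Fintype.card Fq ^ i

theorem aeval_injective [IsUltrametricDist K] {θ : K} (hθ : 1 < ‖θ‖) :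
    Function.Injective (aeval θ : Fq[X] → K) := by
  intro a b h
  by_contra hne
  exact aeval_ne_zero hθ (sub_ne_zero.2 hne) (by rw [map_sub, h, sub_self])

theorem derivative_monicRootPoly (θ : K) (d : ℕ) :
    derivative (monicRootPoly Fq θ d) = -C (weight Fq θ d 0) := by
  have hcast : ((Fintype.card Fq : ℕ) : K) = 0 := by
    have := congrArg (algebraMap Fq K) (FiniteField.cast_card_eq_zero Fq)
    rwa [map_natCast, map_zero] at this
  rw [monicRootPoly, Finset.sum_range_succ']
  simp only [derivative_sub, derivative_one, derivative_add, derivative_sum, derivative_C_mul,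
    derivative_X_pow, zero_sub]
  simp [pow_succ, hcast]

variable [IsUltrametricDist K]

theorem monicRootPoly_eq_prod {θ : K} (hθ : 1 < ‖θ‖) (d : ℕ) :
    monicRootPoly Fq θ d = ∏ a ∈ monics Fq d, (1 - C (aeval θ a)⁻¹ * X) := by
  classical
  have hq := two_le_card Fq
  have hne : ∀ a ∈ monics Fq d, aeval θ a ≠ 0 := fun a ha =>
    aeval_ne_zero hθ (mem_monics.1 ha).1.ne_zero
  have hinj := aeval_injective (Fq := Fq) hθ
  rw [← sub_eq_zero]
  have h0 : (0 : K) ∉ (monics Fq d).image (aeval θ) := by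
    simp only [Finset.mem_image, not_exists, not_and]
    exact fun a ha => hne a ha
  refine eq_zero_of_natDegree_lt_card_of_eval_eq_zero' _
    (insert 0 ((monics Fq d).image (aeval θ))) ?_ ?_
  · intro x hx
    rw [Finset.mem_insert, Finset.mem_image] at hx
    rcases hx with rfl | ⟨a, ha, rfl⟩
    · simp [monicRootPoly, eval_finsetSum, eval_prod, Fintype.card_ne_zero]
    · rw [eval_sub, eval_prod, Finset.prod_eq_zero ha (by simp [hne a ha]), sub_zero,
        monicRootPoly, eval_sub, eval_finsetSum]
      simp only [eval_mul, eval_C, eval_pow, eval_X, eval_one]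
      obtain ⟨hm, hd⟩ := mem_monics.1 ha
      rw [sum_weight_mul_aeval hθ hd.le, ← hd, hm.coeff_natDegree, map_one, sub_self]
  · rw [Finset.card_insert_of_notMem h0, Finset.card_image_of_injective _ hinj, card_monics]
    refine Nat.lt_succ_of_le ((natDegree_sub_le _ _).trans (max_le ?_ ?_))
    · refine (natDegree_sub_le _ _).trans (max_le (by simp) ?_)
      refine natDegree_sum_le_of_forall_le _ _ fun i hi => ?_
      refine (natDegree_C_mul_X_pow_le _ _).trans ?_
      exact Nat.pow_le_pow_right (by omega) (by simpa [Nat.lt_succ_iff] using hi)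
    · refine (natDegree_prod_le _ _).trans ?_
      rw [← card_monics (Fq := Fq) d, Finset.card_eq_sum_ones]
      refine Finset.sum_le_sum fun a _ => ?_
      refine (natDegree_sub_le _ _).trans (max_le (by simp) ?_)
      exact natDegree_C_mul_le _ _ |>.trans natDegree_X_le

theorem powSum_eq_add_sum {θ : K} (hθ : 1 < ‖θ‖) (d m : ℕ) :
    powSum Fq θ d (m + 1) = (if m = 0 then weight Fq θ d 0 else 0) +
      ∑ i ∈ Finset.range (d + 1), weight Fq θ d i *
        (if Fintype.card Fq ^ i ≤ m then powSum Fq θ d (m + 1 - Fintype.card Fq ^ i) else 0) := by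
  classical
  set G : PowerSeries K := PowerSeries.mk fun m => powSum Fq θ d (m + 1) with hG
  have hne : ∀ a ∈ monics Fq d, aeval θ a ≠ 0 := fun a ha =>
    aeval_ne_zero hθ (mem_monics.1 ha).1.ne_zero
  let v : Fq[X] → PowerSeries K := fun a => PowerSeries.mk fun m => ((aeval θ a) ^ (m + 1))⁻¹
  have hGv : G = ∑ a ∈ monics Fq d, v a := by
    ext m
    simp [hG, v, powSum]
  have hv : ∀ a ∈ monics Fq d,
      ((1 - C (aeval θ a)⁻¹ * X : K[X]) : PowerSeries K) * v a =
        PowerSeries.C (aeval θ a)⁻¹ := by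
    intro a ha
    have h0 := hne a ha
    ext m
    rw [Polynomial.coe_sub, Polynomial.coe_mul, Polynomial.coe_C, Polynomial.coe_X,
      Polynomial.coe_one, sub_mul, one_mul, mul_assoc, map_sub, PowerSeries.coeff_C_mul]
    cases m with
    | zero => simp [v]
    | succ m =>
      rw [PowerSeries.coeff_succ_X_mul, PowerSeries.coeff_C, if_neg (by omega)]
      simp only [v, PowerSeries.coeff_mk]
      field_simp
      ring
  have key : (monicRootPoly Fq θ d : PowerSeries K) * G = PowerSeries.C (weight Fq θ d 0) := by
    have hd := derivative_monicRootPoly (Fq := Fq) θ d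
    rw [monicRootPoly_eq_prod hθ, derivative_prod_finset] at hd
    have hd' := congrArg (fun p : K[X] => (p : PowerSeries K)) hd
    simp only [Polynomial.coe_neg, Polynomial.coe_C] at hd'
    rw [← neg_inj, ← hd', hGv, monicRootPoly_eq_prod hθ, Finset.mul_sum, ← Finset.sum_neg_distrib,
      ← Polynomial.coeToPowerSeries.ringHom_apply, ← Polynomial.coeToPowerSeries.ringHom_apply,
      map_sum]
    refine Finset.sum_congr rfl fun a ha => ?_
    rw [← Finset.mul_prod_erase _ _ ha]
    simp only [map_mul, Polynomial.coeToPowerSeries.ringHom_apply] at *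
    have : derivative (1 - C (aeval θ a)⁻¹ * X : K[X]) = -C (aeval θ a)⁻¹ := by simp
    rw [this, Polynomial.coe_neg, Polynomial.coe_C, ← hv a ha]
    ring
  have hcoeff := congrArg (PowerSeries.coeff m) key
  rw [PowerSeries.coeff_C, monicRootPoly, Polynomial.coe_sub, Polynomial.coe_one, sub_mul, one_mul,
    map_sub, ← Polynomial.coeToPowerSeries.ringHom_apply, map_sum, Finset.sum_mul, map_sum,
    sub_eq_iff_eq_add] at hcoeff
  rw [hG, PowerSeries.coeff_mk] at hcoeff
  rw [hcoeff]
  congr 1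
  refine Finset.sum_congr rfl fun i _ => ?_
  rw [Polynomial.coeToPowerSeries.ringHom_apply, Polynomial.coe_mul, Polynomial.coe_C,
    Polynomial.coe_pow, Polynomial.coe_X, mul_assoc, PowerSeries.coeff_C_mul,
    PowerSeries.coeff_X_pow_mul']
  congr 1
  split_ifs with h
  · rw [PowerSeries.coeff_mk, Nat.sub_add_comm h]
  · rfl

end PowerSums

section Bivariate

variable {Fq : Type*} [Field Fq]

/-- The coefficients of `p ∈ 𝔽_q[θ][T]` have degree at most `e` in `θ`. -/
def CoeffDegLE (p : Fq[X][X]) (e : ℕ) : Prop := ∀ k, (p.coeff k).natDegree ≤ e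

theorem CoeffDegLE.mono {p : Fq[X][X]} {e e' : ℕ} (h : CoeffDegLE p e) (he : e ≤ e') :
    CoeffDegLE p e' := fun k => (h k).trans he

theorem coeffDegLE_zero (e : ℕ) : CoeffDegLE (0 : Fq[X][X]) e := fun k => by simp

theorem CoeffDegLE.add {p p' : Fq[X][X]} {e : ℕ} (h : CoeffDegLE p e) (h' : CoeffDegLE p' e) :
    CoeffDegLE (p + p') e := fun k => by
  rw [coeff_add]
  exact (natDegree_add_le _ _).trans (max_le (h k) (h' k))

theorem CoeffDegLE.neg {p : Fq[X][X]} {e : ℕ} (h : CoeffDegLE p e) :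
    CoeffDegLE (-p) e := fun k => by
  rw [coeff_neg, natDegree_neg]
  exact h k

theorem CoeffDegLE.sub {p p' : Fq[X][X]} {e : ℕ} (h : CoeffDegLE p e) (h' : CoeffDegLE p' e) :
    CoeffDegLE (p - p') e := by
  rw [sub_eq_add_neg]
  exact h.add h'.neg

theorem CoeffDegLE.sum {ι : Type*} {s : Finset ι} {p : ι → Fq[X][X]} {e : ℕ}
    (h : ∀ i ∈ s, CoeffDegLE (p i) e) : CoeffDegLE (∑ i ∈ s, p i) e := fun k => by
  rw [finsetSum_coeff]
  exact natDegree_sum_le_of_forall_le _ _ fun i hi => h i hi k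

theorem CoeffDegLE.mul {p p' : Fq[X][X]} {e e' : ℕ} (h : CoeffDegLE p e)
    (h' : CoeffDegLE p' e') : CoeffDegLE (p * p') (e + e') := fun k => by
  rw [coeff_mul]
  exact natDegree_sum_le_of_forall_le _ _ fun i _ => natDegree_mul_le_of_le (h _) (h' _)

theorem coeffDegLE_one : CoeffDegLE (1 : Fq[X][X]) 0 := fun k => by
  rw [coeff_one]
  split_ifs <;> simp

theorem CoeffDegLE.prod {ι : Type*} {s : Finset ι} {p : ι → Fq[X][X]} {e : ι → ℕ}
    (h : ∀ i ∈ s, CoeffDegLE (p i) (e i)) : CoeffDegLE (∏ i ∈ s, p i) (∑ i ∈ s, e i) := by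
  classical
  induction s using Finset.induction_on with
  | empty => simpa using coeffDegLE_one
  | insert a s ha ih =>
    rw [Finset.prod_insert ha, Finset.sum_insert ha]
    exact (h a (Finset.mem_insert_self _ _)).mul
      (ih fun i hi => h i (Finset.mem_insert_of_mem hi))

theorem coeffDegLE_C (a : Fq[X]) : CoeffDegLE (C a) a.natDegree := fun k => by
  rw [coeff_C]
  split_ifs <;> simp

/-- A polynomial in `T` with constant coefficients has degree zero in `θ`. -/
theorem coeffDegLE_map_C (a : Fq[X]) : CoeffDegLE (a.map C) 0 := fun k => by
  simp

theorem coeffDegLE_X_pow (n : ℕ) : CoeffDegLE (X ^ n : Fq[X][X]) 0 := fun k => by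
  rw [coeff_X_pow]
  split_ifs <;> simp

theorem exists_coeffDegLE (p : Fq[X][X]) : ∃ e, CoeffDegLE p e :=
  ⟨p.support.sup fun k => (p.coeff k).natDegree, fun k => by
    by_cases hk : k ∈ p.support
    · exact Finset.le_sup (f := fun k => (p.coeff k).natDegree) hk
    · rw [notMem_support_iff.1 hk]; simp⟩

variable [Fintype Fq]

theorem CoeffDegLE.map_frob {p : Fq[X][X]} {e : ℕ} (h : CoeffDegLE p e) (d : ℕ) :
    CoeffDegLE (p.map (frob Fq Fq[X] d)) (Fintype.card Fq ^ d * e) := fun k => by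
  rw [coeff_map, frob_apply]
  exact natDegree_pow_le_of_le _ (h k)

variable (Fq) in
/-- The value at `T = θ ^ r` of the `d`-fold Frobenius twist of `p ∈ 𝔽_q[θ][T]`. -/
noncomputable def twEval (d r : ℕ) : Fq[X][X] →+* Fq[X] :=
  eval₂RingHom (frob Fq Fq[X] d) (X ^ r)

theorem twEval_C (d r : ℕ) (a : Fq[X]) : twEval Fq d r (C a) = a ^ Fintype.card Fq ^ d := by
  simp [twEval]

theorem twEval_X (d r : ℕ) : twEval Fq d r X = X ^ r := by
  simp [twEval]

theorem twEval_map_C (d r : ℕ) (a : Fq[X]) : twEval Fq d r (a.map C) = a.comp (X ^ r) := by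
  simp only [twEval, coe_eval₂RingHom, eval₂_map, comp]
  congr 1
  ext x
  simp [← map_pow, FiniteField.pow_card_pow]

theorem CoeffDegLE.natDegree_twEval_le {p : Fq[X][X]} {e : ℕ} (h : CoeffDegLE p e) (d r : ℕ) :
    (twEval Fq d r p).natDegree ≤ Fintype.card Fq ^ d * e + p.natDegree * r := by
  simp only [twEval, coe_eval₂RingHom, eval₂_eq_sum_range]
  refine natDegree_sum_le_of_forall_le _ _ fun i hi => ?_
  rw [Finset.mem_range, Nat.lt_succ_iff] at hi
  refine natDegree_mul_le_of_le ?_ ?_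
  · rw [frob_apply]
    exact natDegree_pow_le_of_le _ (h i)
  · rw [← pow_mul, natDegree_X_pow, mul_comm]
    exact Nat.mul_le_mul_right _ hi

end Bivariate

section AndersonThakur

variable {Fq : Type*} [Field Fq] [Fintype Fq]
variable {K : Type*} [NormedField K]

theorem prod_range_erase (f : ℕ → K) (i e : ℕ) :
    ∏ j ∈ (Finset.range (i + e + 1)).erase i, f j =
      (∏ j ∈ Finset.range i, f j) * ∏ j ∈ Finset.range e, f (i + 1 + j) := by
  have hI : (Finset.range (i + e + 1)).erase i =
      (Finset.range i).disjUnion (Finset.Ico (i + 1) (i + e + 1)) (by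
        rw [Finset.disjoint_left]
        intro a
        simp only [Finset.mem_range, Finset.mem_Ico]
        omega) := by
    ext a
    simp only [Finset.mem_erase, Finset.mem_range, Finset.mem_disjUnion, Finset.mem_Ico]
    omega
  rw [hI, Finset.prod_disjUnion, Finset.prod_Ico_eq_prod_range]
  congr 3
  omega

variable (Fq) in
/-- `L_d = ∏ (θ - θ ^ q ^ i)`, the product over `1 ≤ i ≤ d`. -/
noncomputable def ell (θ : K) (d : ℕ) : K :=
  ∏ i ∈ Finset.range d, (θ - θ ^ Fintype.card Fq ^ (i + 1))

theorem ell_ne_zero {θ : K} (hθ : 1 < ‖θ‖) (d : ℕ) : ell Fq θ d ≠ 0 :=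
  Finset.prod_ne_zero_iff.2 fun i _ h => by
    have h1 := pow_injective_of_one_lt_norm hθ ((pow_one θ).trans (sub_eq_zero.1 h))
    have h2 := Nat.one_lt_pow (show i + 1 ≠ 0 by omega) (two_le_card Fq)
    omega

variable (Fq) in
/-- `D_i = ∏ (θ ^ q ^ i - θ ^ q ^ l)`, the product over `l < i`. -/
noncomputable def carlitzD (i : ℕ) : Fq[X] :=
  ∏ l ∈ Finset.range i, (X ^ Fintype.card Fq ^ i - X ^ Fintype.card Fq ^ l)

theorem carlitzD_ne_zero (i : ℕ) : carlitzD Fq i ≠ 0 := by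
  rw [carlitzD, Finset.prod_ne_zero_iff]
  intro l hl h
  rw [Finset.mem_range] at hl
  have := congrArg natDegree (sub_eq_zero.1 h)
  rw [natDegree_X_pow, natDegree_X_pow] at this
  exact hl.ne' (Nat.pow_right_injective (two_le_card Fq) this)

variable (Fq) in
/-- `∏ (T ^ q ^ i - θ ^ q ^ m)`, the product over `1 ≤ m ≤ i`. -/
noncomputable def thakurG (i : ℕ) : Fq[X][X] :=
  ∏ m ∈ Finset.range i, (X ^ Fintype.card Fq ^ i - C (X ^ Fintype.card Fq ^ (m + 1)))

theorem coeffDegLE_thakurG (i : ℕ) :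
    CoeffDegLE (thakurG Fq i) (∑ m ∈ Finset.range i, Fintype.card Fq ^ (m + 1)) := by
  refine CoeffDegLE.prod fun m _ => ((coeffDegLE_X_pow _).mono (Nat.zero_le _)).sub ?_
  simpa using coeffDegLE_C (X ^ Fintype.card Fq ^ (m + 1) : Fq[X])

theorem card_sub_one_mul_sum_pow (q i : ℕ) (hq : 1 ≤ q) :
    (q - 1) * ∑ m ∈ Finset.range i, q ^ (m + 1) = q * (q ^ i - 1) := by
  obtain ⟨p, rfl⟩ := Nat.exists_eq_add_of_le hq
  have h1 : 1 ≤ (1 + p) ^ i := Nat.one_le_pow _ _ (by omega)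
  rw [Nat.add_sub_cancel_left]
  zify [h1]
  simp only [pow_succ']
  rw [← Finset.mul_sum, ← geom_sum_mul]
  ring

variable [Algebra Fq K]

theorem aeval_twEval_thakurG (θ : K) (d i : ℕ) :
    aeval θ (twEval Fq d 1 (thakurG Fq i)) =
      ∏ m ∈ Finset.range i, (θ ^ Fintype.card Fq ^ i - θ ^ Fintype.card Fq ^ (m + 1 + d)) := by
  simp only [thakurG, map_prod, map_sub, map_pow, twEval_X, twEval_C, pow_one, aeval_X]
  refine Finset.prod_congr rfl fun m _ => ?_
  rw [← pow_mul, ← pow_add, add_comm d]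

theorem aeval_twEval_thakurG_of_lt (θ : K) {d i : ℕ} (h : d < i) :
    aeval θ (twEval Fq d 1 (thakurG Fq i)) = 0 := by
  rw [aeval_twEval_thakurG]
  refine Finset.prod_eq_zero (i := i - d - 1) (Finset.mem_range.2 (by omega)) ?_
  rw [show i - d - 1 + 1 + d = i by omega, sub_self]

theorem weight_mul_ell_pow {θ : K} (hθ : 1 < ‖θ‖) {d i : ℕ} (h : i ≤ d) :
    aeval θ (carlitzD Fq i) * (weight Fq θ d i * ell Fq θ d ^ Fintype.card Fq ^ i) =
      aeval θ (twEval Fq d 1 (thakurG Fq i)) := by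
  obtain ⟨e, rfl⟩ := Nat.exists_eq_add_of_le h
  have hl : ell Fq θ (i + e) ^ Fintype.card Fq ^ i =
      (∏ j ∈ Finset.range e, (θ ^ Fintype.card Fq ^ i - θ ^ Fintype.card Fq ^ (i + 1 + j))) *
      ∏ m ∈ Finset.range i,
        (θ ^ Fintype.card Fq ^ i - θ ^ Fintype.card Fq ^ (m + 1 + (i + e))) := by
    rw [ell, ← Finset.prod_pow, add_comm i e, Finset.prod_range_add]
    congr 1
    · refine Finset.prod_congr rfl fun j _ => ?_
      rw [sub_pow_card_pow, ← pow_mul, ← pow_add, show j + 1 + i = i + 1 + j by omega]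
    · refine Finset.prod_congr rfl fun j _ => ?_
      rw [sub_pow_card_pow, ← pow_mul, ← pow_add, show e + j + 1 + i = j + 1 + (e + i) by omega]
  have hne : ∀ j, j ≠ i → θ ^ Fintype.card Fq ^ i - θ ^ Fintype.card Fq ^ j ≠ 0 := fun j hj h =>
    hj (node_injective Fq hθ (sub_eq_zero.1 h)).symm
  have h1 : ∏ j ∈ Finset.range i, (θ ^ Fintype.card Fq ^ i - θ ^ Fintype.card Fq ^ j) ≠ 0 :=
    Finset.prod_ne_zero_iff.2 fun j hj => hne j (by rw [Finset.mem_range] at hj; omega)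
  have h2 : ∏ j ∈ Finset.range e,
      (θ ^ Fintype.card Fq ^ i - θ ^ Fintype.card Fq ^ (i + 1 + j)) ≠ 0 :=
    Finset.prod_ne_zero_iff.2 fun j _ => hne _ (by omega)
  have hD : aeval θ (carlitzD Fq i) =
      ∏ j ∈ Finset.range i, (θ ^ Fintype.card Fq ^ i - θ ^ Fintype.card Fq ^ j) := by
    simp [carlitzD, map_prod]
  rw [aeval_twEval_thakurG, hl, weight, prod_range_erase, hD]
  field_simp

theorem weight_zero_mul_ell {θ : K} (hθ : 1 < ‖θ‖) (d : ℕ) :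
    weight Fq θ d 0 * ell Fq θ d = 1 := by
  have := weight_mul_ell_pow (Fq := Fq) hθ (Nat.zero_le d)
  simpa [carlitzD, thakurG] using this

variable [IsUltrametricDist K]

/-- Anderson–Thakur: up to a common factor, the power sums `S_d(s)` are the values at `T = θ`
of the Frobenius twists of polynomials divided by `L_d ^ s`. -/
theorem exists_andersonThakur {θ : K} (hθ : 1 < ‖θ‖) (n : ℕ) :
    ∃ Γ : Fq[X], Γ ≠ 0 ∧ ∀ s, 1 ≤ s → s ≤ n → ∃ h : Fq[X][X],
      (∃ e, CoeffDegLE h e ∧ (Fintype.card Fq - 1) * e ≤ Fintype.card Fq * (s - 1)) ∧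
      ∀ d, aeval θ Γ * (powSum Fq θ d s * ell Fq θ d ^ s) = aeval θ (twEval Fq d 1 h) := by
  classical
  have hq := two_le_card Fq
  induction n with
  | zero => exact ⟨1, one_ne_zero, fun s h1 h2 => by omega⟩
  | succ n ih =>
    obtain ⟨Γ, hΓ, ih⟩ := ih
    choose! H hH1 hH2 using ih
    set Δ : Fq[X] := ∏ i ∈ Finset.range (n + 1), carlitzD Fq i with hΔ
    have hΔ0 : Δ ≠ 0 := Finset.prod_ne_zero_iff.2 fun i _ => carlitzD_ne_zero i
    refine ⟨Γ * Δ, mul_ne_zero hΓ hΔ0, fun s h1 h2 => ?_⟩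
    rcases Nat.lt_or_ge s (n + 1) with hs | hs
    · obtain ⟨e, he, hqe⟩ := hH1 s h1 (by omega)
      refine ⟨H s * Δ.map C, ⟨e, by simpa using he.mul (coeffDegLE_map_C Δ), hqe⟩, fun d => ?_⟩
      rw [map_mul, map_mul, map_mul, ← hH2 s h1 (by omega), twEval_map_C, pow_one, comp_X]
      ring
    · obtain rfl : s = n + 1 := le_antisymm h2 hs
      let Δi : ℕ → Fq[X] := fun i => ∏ j ∈ (Finset.range (n + 1)).erase i, carlitzD Fq j
      have hlt : ∀ i, Fintype.card Fq ^ i ≤ n → i ∈ Finset.range (n + 1) := fun i hi => by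
        rw [Finset.mem_range]
        exact (Nat.lt_pow_self (by omega)).trans_le (hi.trans n.le_succ)
      have hΔi : ∀ i, Fintype.card Fq ^ i ≤ n → carlitzD Fq i * Δi i = Δ := fun i hi =>
        Finset.mul_prod_erase _ _ (hlt i hi)
      let term : ℕ → Fq[X][X] := fun i => if Fintype.card Fq ^ i ≤ n then
        (Δi i).map C * (thakurG Fq i * H (n + 1 - Fintype.card Fq ^ i)) else 0
      refine ⟨(if n = 0 then (Γ * Δ).map C else 0) + ∑ i ∈ Finset.range (n + 1), term i, ?_, ?_⟩
      · refine ⟨Fintype.card Fq * n / (Fintype.card Fq - 1), CoeffDegLE.add ?_ ?_,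
          Nat.mul_div_le _ _⟩
        · split_ifs
          · exact (coeffDegLE_map_C _).mono (Nat.zero_le _)
          · exact coeffDegLE_zero _
        · refine CoeffDegLE.sum fun i _ => ?_
          simp only [term]
          split_ifs with hi
          · have hpos : 1 ≤ Fintype.card Fq ^ i := Nat.one_le_pow _ _ (by omega)
            obtain ⟨e, he, hqe⟩ := hH1 (n + 1 - Fintype.card Fq ^ i) (by omega) (by omega)
            refine ((coeffDegLE_map_C _).mul ((coeffDegLE_thakurG i).mul he)).mono ?_
            rw [Nat.le_div_iff_mul_le (by omega), zero_add, mul_comm, mul_add,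
              card_sub_one_mul_sum_pow _ _ (by omega)]
            calc _ ≤ Fintype.card Fq * (Fintype.card Fq ^ i - 1) +
                  Fintype.card Fq * (n + 1 - Fintype.card Fq ^ i - 1) := by gcongr
              _ = Fintype.card Fq *
                  ((Fintype.card Fq ^ i - 1) + (n + 1 - Fintype.card Fq ^ i - 1)) := by ring
              _ ≤ Fintype.card Fq * n := Nat.mul_le_mul_left _ (by omega)
          · exact coeffDegLE_zero _
      · intro d
        set ev : Fq[X][X] →+* K := (aeval θ : Fq[X] →ₐ[Fq] K).toRingHom.comp (twEval Fq d 1)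
          with hev
        have evd : ∀ p, aeval θ (twEval Fq d 1 p) = ev p := fun p => rfl
        have evC : ∀ a : Fq[X], ev (a.map C) = aeval θ a := fun a => by
          rw [← evd, twEval_map_C, pow_one, comp_X]
        have hterm : ∀ i ≤ d, aeval θ (Γ * Δ) * (weight Fq θ d i *
            (if Fintype.card Fq ^ i ≤ n then powSum Fq θ d (n + 1 - Fintype.card Fq ^ i) else 0) *
              ell Fq θ d ^ (n + 1)) = ev (term i) := by
          intro i hid
          simp only [term]
          split_ifs with hi
          · have hpos : 1 ≤ Fintype.card Fq ^ i := Nat.one_le_pow _ _ (by omega)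
            rw [map_mul ev, map_mul ev, evC, ← evd (thakurG Fq i), ← evd (H _),
              ← weight_mul_ell_pow hθ hid,
              ← hH2 _ (by omega) (by omega), ← hΔi i hi, map_mul, map_mul,
              show ell Fq θ d ^ (n + 1) = ell Fq θ d ^ Fintype.card Fq ^ i *
                ell Fq θ d ^ (n + 1 - Fintype.card Fq ^ i) by
                rw [← pow_add]; congr 1; omega]
            ring
          · simp
        have hterm0 : ∀ i, d < i → ev (term i) = 0 := by
          intro i hid
          simp only [term]
          split_ifs with hi
          · rw [map_mul, map_mul, ← evd (thakurG Fq i), aeval_twEval_thakurG_of_lt θ hid]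
            ring
          · simp
        have hsum : ∑ i ∈ Finset.range (n + 1), ev (term i) =
            ∑ i ∈ Finset.range (d + 1), ev (term i) := by
          rw [Finset.sum_subset (Finset.range_mono (show n + 1 ≤ n + d + 1 by omega)),
            Finset.sum_subset (Finset.range_mono (show d + 1 ≤ n + d + 1 by omega))]
          · intro i _ hi
            exact hterm0 i (by rw [Finset.mem_range] at hi; omega)
          · intro i _ hi
            have : ¬ Fintype.card Fq ^ i ≤ n := fun h => hi (hlt i h)
            simp [term, this]
        rw [powSum_eq_add_sum hθ, evd, map_add, map_sum, hsum, add_mul, mul_add]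
        congr 1
        · split_ifs with hn
          · subst hn
            rw [zero_add, pow_one, weight_zero_mul_ell hθ, mul_one, evC]
          · simp
        · rw [Finset.sum_mul, Finset.mul_sum]
          exact Finset.sum_congr rfl fun i hi =>
            hterm i (by rw [Finset.mem_range] at hi; omega)

end AndersonThakur

section Series

open scoped PowerSeries

variable {K : Type*} [NormedField K]

variable (K) in
/-- The inclusion of polynomials into power series. -/
noncomputable def toSeries : K[X] →+* K⟦X⟧ := Polynomial.coeToPowerSeries.ringHom

@[simp]
theorem coeff_toSeries (p : K[X]) (m : ℕ) : PowerSeries.coeff m (toSeries K p) = p.coeff m :=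
  Polynomial.coeff_coe p m

theorem toSeries_injective : Function.Injective (toSeries K) :=
  Polynomial.coe_injective K

theorem toSeries_X : toSeries K X = PowerSeries.X := by
  simp [toSeries]

theorem toSeries_C (a : K) : toSeries K (C a) = PowerSeries.C a := by
  simp [toSeries]

/-- The power series `f` converges at `α` with value `v`. -/
def HasEv (α : K) (f : K⟦X⟧) (v : K) : Prop :=
  HasSum (fun m => PowerSeries.coeff m f * α ^ m) v

theorem HasEv.unique {α v w : K} {f : K⟦X⟧} (h : HasEv α f v) (h' : HasEv α f w) : v = w :=
  HasSum.unique h h'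

theorem HasEv.add {α v w : K} {f g : K⟦X⟧} (hf : HasEv α f v) (hg : HasEv α g w) :
    HasEv α (f + g) (v + w) := by
  simpa [HasEv, add_mul] using HasSum.add hf hg

theorem HasEv.neg {α v : K} {f : K⟦X⟧} (hf : HasEv α f v) : HasEv α (-f) (-v) := by
  simpa [HasEv, neg_mul] using HasSum.neg hf

theorem HasEv.sub {α v w : K} {f g : K⟦X⟧} (hf : HasEv α f v) (hg : HasEv α g w) :
    HasEv α (f - g) (v - w) := by
  simpa [HasEv, sub_mul] using HasSum.sub hf hg

theorem HasEv.sum {ι : Type*} {s : Finset ι} {α : K} {f : ι → K⟦X⟧} {v : ι → K}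
    (h : ∀ i ∈ s, HasEv α (f i) (v i)) : HasEv α (∑ i ∈ s, f i) (∑ i ∈ s, v i) := by
  simpa [HasEv, Finset.sum_mul] using hasSum_sum h

theorem HasEv.C_mul {α v : K} {f : K⟦X⟧} (hf : HasEv α f v) (a : K) :
    HasEv α (PowerSeries.C a * f) (a * v) := by
  simpa [HasEv, mul_assoc] using HasSum.mul_left a hf

theorem HasEv.X_mul {α v : K} {f : K⟦X⟧} (hf : HasEv α f v) :
    HasEv α (PowerSeries.X * f) (α * v) := by
  rw [HasEv, ← hasSum_nat_add_iff' 1]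
  simp only [PowerSeries.coeff_succ_X_mul, Finset.range_one, Finset.sum_singleton,
    PowerSeries.coeff_zero_X_mul, zero_mul, sub_zero]
  refine (HasSum.mul_left α hf).congr_fun ?_
  intro m
  ring

theorem HasEv.poly_mul {α v : K} {f : K⟦X⟧} (hf : HasEv α f v) (p : K[X]) :
    HasEv α (toSeries K p * f) (p.eval α * v) := by
  induction p using Polynomial.induction_on' with
  | add p r hp hr =>
    rw [map_add, add_mul, eval_add, add_mul]
    exact hp.add hr
  | monomial k a =>
    rw [← C_mul_X_pow_eq_monomial]
    induction k with
    | zero => simpa [toSeries_C] using hf.C_mul a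
    | succ k ih =>
      have := ih.X_mul
      rw [pow_succ', ← mul_assoc, mul_comm (C a), mul_assoc, map_mul, mul_assoc, toSeries_X,
        eval_mul, eval_X, mul_assoc]
      exact this

theorem hasEv_toSeries (α : K) (p : K[X]) : HasEv α (toSeries K p) (p.eval α) := by
  have h1 : HasEv α 1 1 := by
    have := hasSum_single (f := fun m => PowerSeries.coeff m (1 : K⟦X⟧) * α ^ m) 0
      (fun m hm => by simp [PowerSeries.coeff_one, hm])
    simpa [HasEv] using this
  simpa using h1.poly_mul p

/-- The coefficients of `f` are bounded by `C * ρ ^ (-m)`. -/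
def Bdd (ρ C : ℝ) (f : K⟦X⟧) : Prop := ∀ m, ‖PowerSeries.coeff m f‖ * ρ ^ m ≤ C

theorem Bdd.nonneg {ρ C : ℝ} {f : K⟦X⟧} (h : Bdd ρ C f) : 0 ≤ C :=
  (norm_nonneg _).trans (by simpa using h 0)

theorem Bdd.mono {ρ C C' : ℝ} {f : K⟦X⟧} (h : Bdd ρ C f) (hC : C ≤ C') : Bdd ρ C' f :=
  fun m => (h m).trans hC

theorem Bdd.anti {ρ ρ' C : ℝ} {f : K⟦X⟧} (h : Bdd ρ C f) (h0 : 0 ≤ ρ') (hρ : ρ' ≤ ρ) :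
    Bdd ρ' C f :=
  fun m => (mul_le_mul_of_nonneg_left (pow_le_pow_left₀ h0 hρ m) (norm_nonneg _)).trans (h m)

theorem bdd_zero {ρ C : ℝ} (hC : 0 ≤ C) : Bdd ρ C (0 : K⟦X⟧) := fun m => by simpa using hC

theorem exists_bdd_toSeries {ρ : ℝ} (hρ : 0 ≤ ρ) (p : K[X]) : ∃ C, Bdd ρ C (toSeries K p) := by
  refine ⟨∑ m ∈ p.support, ‖p.coeff m‖ * ρ ^ m, fun m => ?_⟩
  rw [coeff_toSeries]
  by_cases hm : m ∈ p.support
  · exact Finset.single_le_sum (f := fun m => ‖p.coeff m‖ * ρ ^ m)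
      (fun i _ => by positivity) hm
  · rw [notMem_support_iff.1 hm, norm_zero, zero_mul]
    exact Finset.sum_nonneg fun i _ => by positivity

theorem Bdd.summable [CompleteSpace K] {ρ C : ℝ} {f : K⟦X⟧} (h : Bdd ρ C f) {α : K}
    (hα : ‖α‖ < ρ) : Summable fun m => PowerSeries.coeff m f * α ^ m := by
  have hρ : 0 < ρ := (norm_nonneg α).trans_lt hα
  refine Summable.of_norm_bounded (g := fun m => C * (‖α‖ / ρ) ^ m)
    ((summable_geometric_of_lt_one (by positivity) ((div_lt_one hρ).2 hα)).mul_left C) fun m => ?_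
  rw [norm_mul, norm_pow, div_pow, mul_div_assoc', le_div_iff₀ (by positivity)]
  calc _ = ‖PowerSeries.coeff m f‖ * ρ ^ m * ‖α‖ ^ m := by ring
    _ ≤ C * ‖α‖ ^ m := by gcongr; exact h m

theorem Bdd.exists_hasEv [CompleteSpace K] {ρ C : ℝ} {f : K⟦X⟧} (h : Bdd ρ C f) {α : K}
    (hα : ‖α‖ < ρ) : ∃ v, HasEv α f v := h.summable hα

theorem Bdd.neg {ρ C : ℝ} {f : K⟦X⟧} (hf : Bdd ρ C f) : Bdd ρ C (-f) := fun m => by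
  simpa using hf m

theorem bdd_one {ρ : ℝ} : Bdd ρ 1 (1 : K⟦X⟧) := fun m => by
  rw [PowerSeries.coeff_one]
  split_ifs with h <;> simp [h]

/-- The inverse of `T - β`. -/
noncomputable def invLin (β : K) : K⟦X⟧ := PowerSeries.mk fun m => -(β ^ (m + 1))⁻¹

theorem X_sub_C_mul_invLin {β : K} (hβ : β ≠ 0) : toSeries K (X - C β) * invLin β = 1 := by
  ext m
  rw [map_sub, toSeries_X, toSeries_C, sub_mul, map_sub, PowerSeries.coeff_C_mul,
    PowerSeries.coeff_one]
  cases m with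
  | zero => simp [invLin, hβ]
  | succ m =>
    simp only [PowerSeries.coeff_succ_X_mul, invLin, PowerSeries.coeff_mk]
    simp only [Nat.add_eq_zero_iff, one_ne_zero, and_false, if_false]
    field_simp
    ring

theorem bdd_invLin {β : K} (hβ : β ≠ 0) : Bdd ‖β‖ ‖β‖⁻¹ (invLin β) := fun m => by
  have : 0 < ‖β‖ := norm_pos_iff.2 hβ
  simp only [invLin, PowerSeries.coeff_mk, norm_neg, norm_inv, norm_pow]
  rw [pow_succ]
  field_simp
  exact le_rfl

variable [IsUltrametricDist K]

theorem norm_le_of_hasSum {ι : Type*} {f : ι → K} {v : K} (h : HasSum f v) {C : ℝ} (hC : 0 ≤ C)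
    (hf : ∀ i, ‖f i‖ ≤ C) : ‖v‖ ≤ C :=
  le_of_tendsto h.norm (Filter.Eventually.of_forall fun _ =>
    IsUltrametricDist.norm_sum_le_of_forall_le_of_nonneg hC fun i _ => hf i)

theorem Bdd.sum {ι : Type*} {s : Finset ι} {ρ C : ℝ} {f : ι → K⟦X⟧} (hρ : 0 < ρ) (hC : 0 ≤ C)
    (h : ∀ i ∈ s, Bdd ρ C (f i)) : Bdd ρ C (∑ i ∈ s, f i) := fun m => by
  rw [map_sum, ← le_div_iff₀ (by positivity)]
  refine IsUltrametricDist.norm_sum_le_of_forall_le_of_nonneg (by positivity) fun i hi => ?_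
  rw [le_div_iff₀ (by positivity)]
  exact h i hi m

theorem Bdd.add {ρ C : ℝ} {f g : K⟦X⟧} (hρ : 0 < ρ) (hf : Bdd ρ C f) (hg : Bdd ρ C g) :
    Bdd ρ C (f + g) := by
  have := Bdd.sum (s := Finset.univ) (f := ![f, g]) hρ hf.nonneg (by
    intro i _
    fin_cases i
    exacts [hf, hg])
  simpa using this

theorem Bdd.sub {ρ C : ℝ} {f g : K⟦X⟧} (hρ : 0 < ρ) (hf : Bdd ρ C f) (hg : Bdd ρ C g) :
    Bdd ρ C (f - g) := by
  rw [sub_eq_add_neg]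
  exact hf.add hρ hg.neg

theorem Bdd.mul {ρ C D : ℝ} {f g : K⟦X⟧} (hρ : 0 < ρ) (hf : Bdd ρ C f) (hg : Bdd ρ D g) :
    Bdd ρ (C * D) (f * g) := fun m => by
  have hC := hf.nonneg
  have hD := hg.nonneg
  rw [PowerSeries.coeff_mul, ← le_div_iff₀ (by positivity)]
  refine IsUltrametricDist.norm_sum_le_of_forall_le_of_nonneg (by positivity) fun i hi => ?_
  rw [Finset.HasAntidiagonal.mem_antidiagonal] at hi
  rw [le_div_iff₀ (by positivity), norm_mul, ← hi, pow_add]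
  calc _ = (‖PowerSeries.coeff i.1 f‖ * ρ ^ i.1) * (‖PowerSeries.coeff i.2 g‖ * ρ ^ i.2) := by ring
    _ ≤ C * D := mul_le_mul (hf _) (hg _) (by positivity) hC

theorem Bdd.pow {ρ C : ℝ} {f : K⟦X⟧} (hρ : 0 < ρ) (hf : Bdd ρ C f) (n : ℕ) :
    Bdd ρ (C ^ n) (f ^ n) := by
  induction n with
  | zero => simpa using bdd_one
  | succ n ih => simpa [pow_succ] using ih.mul hρ hf

/-- Dividing out a zero. -/
theorem Bdd.exists_div_of_hasEv_zero [CompleteSpace K] {ρ B : ℝ} {f : K⟦X⟧} (hf : Bdd ρ B f)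
    {α : K} (hα : α ≠ 0) (hαρ : ‖α‖ < ρ) (h0 : HasEv α f 0) :
    Bdd ρ (B / ρ) (invLin α * f) := by
  have hα' : 0 < ‖α‖ := norm_pos_iff.2 hα
  have hρ : 0 < ρ := hα'.trans hαρ
  have hB := hf.nonneg
  intro m
  have hc : PowerSeries.coeff m (invLin α * f) =
      -(α ^ (m + 1))⁻¹ * ∑ k ∈ Finset.range (m + 1), PowerSeries.coeff k f * α ^ k := by
    rw [mul_comm, PowerSeries.coeff_mul, Finset.mul_sum,
      Finset.Nat.sum_antidiagonal_eq_sum_range_succ_mk]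
    refine Finset.sum_congr rfl fun k hk => ?_
    rw [Finset.mem_range] at hk
    have : α ^ (m + 1) = α ^ k * α ^ (m - k + 1) := by rw [← pow_add]; congr 1; omega
    simp only [invLin, PowerSeries.coeff_mk, this]
    field_simp
  have ht := (hasSum_nat_add_iff' (m + 1)).2 h0
  rw [zero_sub] at ht
  have hn := norm_le_of_hasSum ht (C := B * (‖α‖ / ρ) ^ (m + 1)) (by positivity) fun k => by
    rw [norm_mul, norm_pow, div_pow, mul_div_assoc', le_div_iff₀ (by positivity)]
    calc ‖PowerSeries.coeff (k + (m + 1)) f‖ * ‖α‖ ^ (k + (m + 1)) * ρ ^ (m + 1)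
        = ‖PowerSeries.coeff (k + (m + 1)) f‖ * ρ ^ (m + 1) * ‖α‖ ^ k * ‖α‖ ^ (m + 1) := by
          rw [pow_add ‖α‖]; ring
      _ ≤ ‖PowerSeries.coeff (k + (m + 1)) f‖ * ρ ^ (m + 1) * ρ ^ k * ‖α‖ ^ (m + 1) := by gcongr
      _ = ‖PowerSeries.coeff (k + (m + 1)) f‖ * ρ ^ (k + (m + 1)) * ‖α‖ ^ (m + 1) := by
          rw [pow_add ρ]; ring
      _ ≤ B * ‖α‖ ^ (m + 1) := by gcongr; exact hf _
  rw [norm_neg] at hn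
  rw [hc, norm_mul, norm_neg, norm_inv, norm_pow]
  calc _ ≤ (‖α‖ ^ (m + 1))⁻¹ * (B * (‖α‖ / ρ) ^ (m + 1)) * ρ ^ m := by gcongr
    _ = B / ρ := by rw [div_pow, pow_succ ρ]; field_simp

/-- Schwarz lemma: a power series with many zeros has a small leading coefficient. -/
theorem Bdd.norm_coeff_le_of_zeros [CompleteSpace K] {ρ : ℝ} {α : ℕ → K}
    (hα : Function.Injective α) (hα0 : ∀ μ, α μ ≠ 0) (N : ℕ) (hαρ : ∀ μ < N, ‖α μ‖ < ρ)
    (hρ : 0 < ρ) {B : ℝ} {f : K⟦X⟧}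
    (hf : Bdd ρ B f) (h0 : ∀ μ < N, HasEv (α μ) f 0) {m : ℕ}
    (hm : ∀ k < m, PowerSeries.coeff k f = 0) :
    ‖PowerSeries.coeff m f‖ * ρ ^ (m + N) ≤ B * ∏ μ ∈ Finset.range N, ‖α μ‖ := by
  induction N generalizing f B with
  | zero => simpa using hf m
  | succ N ih =>
    have h := hf.exists_div_of_hasEv_zero (hα0 N) (hαρ N N.lt_succ_self) (h0 N N.lt_succ_self)
    have hz : ∀ μ < N, HasEv (α μ) (invLin (α N) * f) 0 := fun μ hμ => by
      obtain ⟨v, hv⟩ := h.exists_hasEv (hαρ μ (by omega))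
      have h1 := hv.poly_mul (X - C (α N))
      rw [← mul_assoc, X_sub_C_mul_invLin (hα0 N), one_mul] at h1
      have h2 := h1.unique (h0 μ (by omega))
      rw [eval_sub, eval_X, eval_C, mul_eq_zero, sub_eq_zero] at h2
      rcases h2 with h2 | rfl
      · exact absurd (hα h2) (by omega)
      · exact hv
    have hlow : ∀ k ≤ m, PowerSeries.coeff k (invLin (α N) * f) =
        -(α N)⁻¹ * PowerSeries.coeff k f := fun k hk => by
      rw [PowerSeries.coeff_mul, Finset.sum_eq_single (0, k)]
      · simp [invLin]
      · rintro ⟨i, j⟩ hij hne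
        rw [Finset.HasAntidiagonal.mem_antidiagonal] at hij
        dsimp only at hij ⊢
        rw [hm j, mul_zero]
        have : i ≠ 0 := by rintro rfl; exact hne (by simp at hij; simp [hij])
        omega
      · intro h
        simp at h
    have h3 := ih (fun μ hμ => hαρ μ (by omega)) h hz fun k hk => by
      rw [hlow k hk.le, hm k hk, mul_zero]
    rw [hlow m le_rfl, norm_mul, norm_neg, norm_inv] at h3
    have hN : 0 < ‖α N‖ := norm_pos_iff.2 (hα0 N)
    rw [Finset.prod_range_succ]
    calc _ = ‖α N‖ * ρ * (‖α N‖⁻¹ * ‖PowerSeries.coeff m f‖ * ρ ^ (m + N)) := by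
          rw [← add_assoc, pow_succ]; field_simp
      _ ≤ ‖α N‖ * ρ * (B / ρ * ∏ μ ∈ Finset.range N, ‖α μ‖) := by gcongr
      _ = _ := by field_simp

end Series

section Twist

open scoped PowerSeries

variable (Fq : Type*) [Field Fq] [Fintype Fq]
variable (K : Type*) [NormedField K] [Algebra Fq K]

/-- The `d`-fold Frobenius twist of power series. -/
noncomputable def tw (d : ℕ) : K⟦X⟧ →+* K⟦X⟧ := PowerSeries.map (frob Fq K d)

/-- The `d`-fold Frobenius twist of polynomials. -/
noncomputable def ptw (d : ℕ) : K[X] →+* K[X] := Polynomial.mapRingHom (frob Fq K d)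

variable {Fq K}

@[simp]
theorem coeff_tw (d m : ℕ) (f : K⟦X⟧) :
    PowerSeries.coeff m (tw Fq K d f) = PowerSeries.coeff m f ^ Fintype.card Fq ^ d := by
  simp [tw]

@[simp]
theorem coeff_ptw (d m : ℕ) (f : K[X]) :
    (ptw Fq K d f).coeff m = f.coeff m ^ Fintype.card Fq ^ d := by
  simp [ptw]

theorem tw_toSeries (d : ℕ) (p : K[X]) : tw Fq K d (toSeries K p) = toSeries K (ptw Fq K d p) := by
  ext m
  simp

theorem tw_tw (d e : ℕ) (f : K⟦X⟧) : tw Fq K d (tw Fq K e f) = tw Fq K (d + e) f := by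
  ext m
  simp [← pow_mul, ← pow_add, add_comm]

theorem ptw_ptw (d e : ℕ) (f : K[X]) : ptw Fq K d (ptw Fq K e f) = ptw Fq K (d + e) f := by
  ext m
  simp [← pow_mul, ← pow_add, add_comm]

@[simp]
theorem tw_zero (f : K⟦X⟧) : tw Fq K 0 f = f := by
  ext m
  simp

@[simp]
theorem ptw_zero (f : K[X]) : ptw Fq K 0 f = f := by
  ext m
  simp

theorem ptw_X_sub_C (d : ℕ) (β : K) :
    ptw Fq K d (X - C β) = X - C (β ^ Fintype.card Fq ^ d) := by
  simp [ptw]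

theorem ptw_injective (d : ℕ) : Function.Injective (ptw Fq K d) :=
  Polynomial.map_injective _ (frob Fq K d).injective

theorem natDegree_ptw (d : ℕ) (p : K[X]) : (ptw Fq K d p).natDegree = p.natDegree :=
  Polynomial.natDegree_map _

theorem continuous_frob (d : ℕ) : Continuous (frob Fq K d) := by
  have : (frob Fq K d : K → K) = fun x => x ^ Fintype.card Fq ^ d := funext fun x => frob_apply d x
  rw [this]
  exact continuous_pow _

theorem HasEv.tw {α v : K} {f : K⟦X⟧} (h : HasEv α f v) (d : ℕ) :
    HasEv (α ^ Fintype.card Fq ^ d) (tw Fq K d f) (v ^ Fintype.card Fq ^ d) := by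
  have := HasSum.map h (frob Fq K d) (continuous_frob d)
  rw [frob_apply] at this
  refine this.congr_fun fun m => ?_
  simp [mul_pow, ← pow_mul, mul_comm]

theorem HasEv.of_mul {α v w : K} {p : K[X]} {f : K⟦X⟧} (h : HasEv α (toSeries K p * f) w)
    (hf : HasEv α f v) : w = p.eval α * v :=
  h.unique (hf.poly_mul p)

/-- The values at `θ` of the twists of a solution of `φ(U) = (T - θ ^ q) ^ n (U - a)`. -/
theorem hasEv_tw_of_frobenius_eq {θ : K} {n : ℕ} {U a : K⟦X⟧} (hθ : 1 < ‖θ‖)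
    (hU : tw Fq K 1 U = toSeries K ((X - C (θ ^ Fintype.card Fq)) ^ n) * (U - a))
    {u : K} {v : ℕ → K} (hu : HasEv θ U u) (hv : ∀ d, HasEv θ (tw Fq K d a) (v d)) (d : ℕ) :
    HasEv θ (tw Fq K d U)
      (ell Fq θ d ^ n * (u - ∑ i ∈ Finset.range d, v i / ell Fq θ i ^ n)) := by
  induction d with
  | zero => simpa [ell] using hu
  | succ d ih =>
    have h1 := congrArg (tw Fq K d) hU
    rw [tw_tw, map_mul, map_sub, tw_toSeries, map_pow, ptw_X_sub_C, ← pow_mul, ← pow_succ'] at h1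
    rw [h1]
    convert (ih.sub (hv d)).poly_mul _ using 1
    have hd := ell_ne_zero (Fq := Fq) hθ d
    rw [Finset.sum_range_succ, eval_pow, eval_sub, eval_X, eval_C]
    rw [show ell Fq θ (d + 1) = ell Fq θ d * (θ - θ ^ Fintype.card Fq ^ (d + 1)) from
      Finset.prod_range_succ _ _, mul_pow]
    field_simp
    ring

variable [IsUltrametricDist K] [CompleteSpace K]

/-- The series `∑ φ^d(a) / (∏ (T - θ ^ q ^ i)) ^ n`, a solution of
`φ(U) = (T - θ ^ q) ^ n (U - a)`. -/
theorem exists_frobenius_solution {θ : K} (hθ : 1 < ‖θ‖) {τ : ℝ} (hτ : 1 < τ)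
    (hτθ : τ ^ (Fintype.card Fq - 1) = ‖θ‖ ^ Fintype.card Fq) (n : ℕ) {a : K⟦X⟧} {B : ℝ}
    (ha : Bdd 1 (τ ^ n / τ) a) (haB : Bdd (‖θ‖ ^ Fintype.card Fq) B a) :
    ∃ U : K⟦X⟧, Bdd 1 (τ ^ n / τ) U ∧ Bdd (‖θ‖ ^ Fintype.card Fq) B U ∧
      tw Fq K 1 U = toSeries K ((X - C (θ ^ Fintype.card Fq)) ^ n) * (U - a) ∧
      ∀ v : ℕ → K, (∀ d, HasEv θ (tw Fq K d a) (v d)) →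
        ∃ u, HasEv θ U u ∧ HasSum (fun d => v d / ell Fq θ d ^ n) u := by
  have hq := two_le_card Fq
  set q := Fintype.card Fq with hqdef
  set ρ := ‖θ‖ ^ q with hρdef
  have hτ0 : 0 < τ := by linarith
  have hρ1 : 1 < ρ := one_lt_pow₀ hθ (by omega)
  have hρ0 : 0 < ρ := by linarith
  have hθ0 : θ ≠ 0 := by rintro rfl; simp at hθ; linarith
  have hβ : θ ^ q ≠ 0 := pow_ne_zero _ hθ0
  have hB := haB.nonneg
  set W : K⟦X⟧ := invLin (θ ^ q) ^ n with hW
  have hWρ : Bdd ρ (ρ⁻¹ ^ n) W := by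
    have := bdd_invLin hβ
    rw [norm_pow] at this
    exact this.pow hρ0 n
  have hW1 : Bdd 1 (ρ⁻¹ ^ n) W := hWρ.anti zero_le_one hρ1.le
  have hWinv : toSeries K ((X - C (θ ^ q)) ^ n) * W = 1 := by
    rw [map_pow, ← mul_pow, X_sub_C_mul_invLin hβ, one_pow]
  let t : ℕ → K⟦X⟧ := fun d => Nat.rec a (fun _ f => W * tw Fq K 1 f) d
  have t0 : t 0 = a := rfl
  have ts : ∀ d, t (d + 1) = W * tw Fq K 1 (t d) := fun d => rfl
  have hqq : ∀ d, q ^ (d + 1) = q ^ d + (q - 1) * q ^ d := fun d => by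
    obtain ⟨r, hr⟩ := Nat.exists_eq_add_of_le hq
    rw [hr, pow_succ, show 2 + r - 1 = 1 + r by omega]
    ring
  have hpq : ∀ x : ℝ, x ^ q = x ^ (q - 1) * x := fun x => by
    rw [← pow_succ, Nat.sub_add_cancel (by omega)]
  have hbound : ∀ d, Bdd 1 (τ ^ n / τ ^ q ^ d) (t d) ∧ Bdd ρ (B * (τ / τ ^ q ^ d)) (t d) := by
    intro d
    induction d with
    | zero => exact ⟨by simpa [t0] using ha, by simpa [t0, hτ0.ne'] using haB⟩
    | succ d ih =>
      obtain ⟨h1, h2⟩ := ih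
      have hc : ∀ m, ‖PowerSeries.coeff m (t d)‖ ≤ τ ^ n / τ ^ q ^ d := fun m => by
        simpa using h1 m
      have e1 : Bdd 1 ((τ ^ n / τ ^ q ^ d) ^ q) (tw Fq K 1 (t d)) := fun m => by
        rw [coeff_tw, norm_pow, one_pow, mul_one, pow_one]
        exact pow_le_pow_left₀ (norm_nonneg _) (hc m) _
      have e2 : Bdd ρ ((τ ^ n / τ ^ q ^ d) ^ (q - 1) * (B * (τ / τ ^ q ^ d)))
          (tw Fq K 1 (t d)) := fun m => by
        rw [coeff_tw, norm_pow, pow_one, ← hqdef, hpq, mul_assoc]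
        exact mul_le_mul (pow_le_pow_left₀ (norm_nonneg _) (hc m) _) (h2 m) (by positivity)
          (by positivity)
      have hρn : ρ⁻¹ ^ n = (τ ^ (q - 1))⁻¹ ^ n := by rw [hτθ]
      constructor
      · rw [ts]
        refine (hW1.mul one_pos e1).mono (le_of_eq ?_)
        rw [hρn, hpq, hqq, pow_add τ, div_pow, inv_pow, ← pow_mul, ← pow_mul, ← pow_mul,
          mul_comm (q - 1) n, mul_comm (q - 1) (q ^ d)]
        field_simp
      · rw [ts]
        refine (hWρ.mul hρ0 e2).mono (le_of_eq ?_)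
        rw [hρn, hqq, pow_add τ, div_pow, inv_pow, ← pow_mul, ← pow_mul, ← pow_mul,
          mul_comm (q - 1) n, mul_comm (q - 1) (q ^ d)]
        field_simp
  have hle : ∀ d, τ ≤ τ ^ q ^ d := fun d => by
    simpa using pow_le_pow_right₀ hτ.le (Nat.one_le_pow d q (by omega))
  have hgeo : ∀ d, τ / τ ^ q ^ d ≤ τ * τ⁻¹ ^ d := fun d => by
    rw [div_eq_mul_inv, inv_pow]
    gcongr
    · exact hτ.le
    · exact (Nat.lt_pow_self (by omega)).le
  have hsumd : Summable fun d => B * (τ * τ⁻¹ ^ d) :=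
    ((summable_geometric_of_lt_one (by positivity) (inv_lt_one_of_one_lt₀ hτ)).mul_left τ).mul_left B
  have hs : ∀ m, Summable fun d => PowerSeries.coeff m (t d) := fun m => by
    refine Summable.of_norm_bounded hsumd fun d => ?_
    refine le_trans ?_ (mul_le_mul_of_nonneg_left (hgeo d) hB)
    refine le_trans ?_ ((hbound d).2 m)
    exact le_mul_of_one_le_right (norm_nonneg _) (one_le_pow₀ hρ1.le)
  set U : K⟦X⟧ := PowerSeries.mk fun m => ∑' d, PowerSeries.coeff m (t d) with hU
  have hUs : ∀ m, HasSum (fun d => PowerSeries.coeff m (t d)) (PowerSeries.coeff m U) := fun m => by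
    rw [hU, PowerSeries.coeff_mk]
    exact (hs m).hasSum
  have hWU : W * tw Fq K 1 U = U - a := by
    ext m
    have h1 : HasSum (fun d => PowerSeries.coeff m (t (d + 1)))
        (PowerSeries.coeff m (W * tw Fq K 1 U)) := by
      simp only [ts, PowerSeries.coeff_mul]
      refine hasSum_sum fun i _ => HasSum.mul_left _ ?_
      have := (hUs i.2).map (frob Fq K 1) (continuous_frob 1)
      rw [frob_apply] at this
      rw [coeff_tw]
      refine this.congr_fun fun d => ?_
      simp
    have h2 := (hasSum_nat_add_iff' 1).2 (hUs m)
    simp only [Finset.range_one, Finset.sum_singleton, t0] at h2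
    rw [map_sub]
    exact h1.unique h2
  refine ⟨U, fun m => ?_, fun m => ?_, ?_, fun v hv => ?_⟩
  · rw [one_pow, mul_one]
    refine norm_le_of_hasSum (hUs m) (by positivity) fun d => ?_
    have h1 := (hbound d).1 m
    rw [one_pow, mul_one] at h1
    exact h1.trans (by gcongr; exact hle d)
  · rw [← le_div_iff₀ (by positivity)]
    refine norm_le_of_hasSum (hUs m) (by positivity) fun d => ?_
    rw [le_div_iff₀ (by positivity)]
    refine ((hbound d).2 m).trans (mul_le_of_le_one_right hB ?_)
    rw [div_le_one (by positivity)]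
    exact hle d
  · rw [← hWU, ← mul_assoc, hWinv, one_mul]
  · have hθρ : ‖θ‖ < ρ := by
      simpa using pow_lt_pow_right₀ hθ (show 1 < q by omega)
    have htw : ∀ d, toSeries K ((∏ i ∈ Finset.range d, (X - C (θ ^ q ^ (i + 1)))) ^ n) * t d =
        tw Fq K d a := by
      intro d
      induction d with
      | zero => simp [t0]
      | succ d ih =>
        have h1 := congrArg (tw Fq K 1) ih
        rw [tw_tw, map_mul, tw_toSeries, map_pow, map_prod] at h1
        simp only [ptw_X_sub_C, ← pow_mul, pow_one] at h1
        rw [add_comm 1 d] at h1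
        rw [← h1, Finset.prod_range_succ', ts, mul_pow, map_mul]
        simp only [zero_add, pow_one]
        calc _ = toSeries K ((∏ x ∈ Finset.range d, (X - C (θ ^ q ^ (x + 1 + 1)))) ^ n) *
            tw Fq K 1 (t d) * (toSeries K ((X - C (θ ^ q)) ^ n) * W) := by ring
          _ = _ := by rw [hWinv, mul_one]; simp only [pow_succ, hqdef]
    have hev : ∀ d, HasEv θ (t d) (v d / ell Fq θ d ^ n) := fun d => by
      obtain ⟨w, hw⟩ := (hbound d).2.exists_hasEv hθρ
      have h1 := hv d
      rw [← htw] at h1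
      have h2 := h1.of_mul hw
      rw [eval_pow, eval_prod] at h2
      simp only [eval_sub, eval_X, eval_C] at h2
      convert hw using 1
      rw [div_eq_iff (pow_ne_zero _ (ell_ne_zero hθ d)), h2, mul_comm]
      rfl
    have hsum2 : Summable fun x : ℕ × ℕ => PowerSeries.coeff x.2 (t x.1) * θ ^ x.2 := by
      have hg : Summable fun m => (‖θ‖ / ρ) ^ m :=
        summable_geometric_of_lt_one (by positivity) ((div_lt_one hρ0).2 hθρ)
      refine Summable.of_norm_bounded (hsumd.mul_of_nonneg hg (fun d => by positivity)
        fun m => by positivity) ?_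
      rintro ⟨d, m⟩
      dsimp only
      rw [norm_mul, norm_pow, div_pow, mul_div_assoc', le_div_iff₀ (by positivity)]
      calc _ = ‖PowerSeries.coeff m (t d)‖ * ρ ^ m * ‖θ‖ ^ m := by ring
        _ ≤ B * (τ / τ ^ q ^ d) * ‖θ‖ ^ m :=
          mul_le_mul_of_nonneg_right ((hbound d).2 m) (by positivity)
        _ ≤ _ := by gcongr; exact hgeo d
    obtain ⟨u, hu⟩ := hsum2
    refine ⟨u, ?_, hu.prod_fiberwise hev⟩
    have hu' : HasSum (fun x : ℕ × ℕ => PowerSeries.coeff x.1 (t x.2) * θ ^ x.1) u :=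
      (Equiv.prodComm ℕ ℕ).hasSum_iff.1 hu
    exact hu'.prod_fiberwise fun m => (hUs m).mul_right _

end Twist

section Siegel

variable {Fq : Type*} [Field Fq]

/-- The polynomial in `𝔽_q[θ][T]` with prescribed coefficients. -/
noncomputable def ofCoeffs (x y : ℕ) : (Fin x × Fin y → Fq) →ₗ[Fq] Fq[X][X] where
  toFun v := ∑ i : Fin x, ∑ j : Fin y, monomial (i : ℕ) (monomial (j : ℕ) (v (i, j)))
  map_add' v w := by simp [Finset.sum_add_distrib]
  map_smul' c v := by simp [Finset.smul_sum, smul_monomial]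

theorem coeff_coeff_ofCoeffs {x y : ℕ} (v : Fin x × Fin y → Fq) (i : Fin x) (j : Fin y) :
    ((ofCoeffs x y v).coeff i).coeff j = v (i, j) := by
  simp [ofCoeffs, finsetSum_coeff, coeff_monomial, Fin.val_inj, Finset.sum_ite_eq']

theorem ofCoeffs_apply {x y : ℕ} (v : Fin x × Fin y → Fq) : ofCoeffs x y v =
    ∑ i : Fin x, ∑ j : Fin y, monomial (i : ℕ) (monomial (j : ℕ) (v (i, j))) := rfl

theorem natDegree_ofCoeffs_le {x y : ℕ} (v : Fin (x + 1) × Fin y → Fq) :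
    (ofCoeffs (x + 1) y v).natDegree ≤ x := by
  rw [ofCoeffs_apply]
  refine natDegree_sum_le_of_forall_le _ _ fun i _ =>
    natDegree_sum_le_of_forall_le _ _ fun j _ => ?_
  exact (natDegree_monomial_le _).trans (Nat.lt_succ_iff.1 i.2)

theorem coeffDegLE_ofCoeffs {x y : ℕ} (v : Fin x × Fin (y + 1) → Fq) :
    CoeffDegLE (ofCoeffs x (y + 1) v) y := by
  rw [ofCoeffs_apply]
  refine CoeffDegLE.sum fun i _ => CoeffDegLE.sum fun j _ k => ?_
  rw [coeff_monomial]
  split_ifs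
  · exact (natDegree_monomial_le _).trans (Nat.lt_succ_iff.1 j.2)
  · simp

/-- Siegel's lemma over `𝔽_q[θ]`. -/
theorem exists_ne_zero_of_card_lt {ι E : Type*} [Fintype ι] [Fintype E] {x y z : ℕ}
    (Λ : (ι → Fq[X][X]) →ₗ[Fq] (E → Fq[X]))
    (hΛ : ∀ P : ι → Fq[X][X], (∀ i, (P i).natDegree ≤ x) → (∀ i, CoeffDegLE (P i) y) →
      ∀ e, (Λ P e).natDegree ≤ z)
    (hcard : Fintype.card E * (z + 1) < Fintype.card ι * ((x + 1) * (y + 1))) :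
    ∃ P : ι → Fq[X][X], P ≠ 0 ∧ (∀ i, (P i).natDegree ≤ x) ∧ (∀ i, CoeffDegLE (P i) y) ∧
      Λ P = 0 := by
  let S : (ι → Fin (x + 1) × Fin (y + 1) → Fq) →ₗ[Fq] (ι → Fq[X][X]) :=
    LinearMap.pi fun i => (ofCoeffs (x + 1) (y + 1)).comp (LinearMap.proj i)
  let R : (E → Fq[X]) →ₗ[Fq] (E → Fin (z + 1) → Fq) :=
    LinearMap.pi fun e => (LinearMap.pi fun k : Fin (z + 1) => lcoeff Fq (k : ℕ)).comp
      (LinearMap.proj e)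
  have hker : LinearMap.ker (R ∘ₗ Λ ∘ₗ S) ≠ ⊥ := by
    apply LinearMap.ker_ne_bot_of_finrank_lt
    simpa [Module.finrank_pi_fintype] using hcard
  obtain ⟨v, hv, hv0⟩ := Submodule.exists_mem_ne_zero_of_ne_bot hker
  have h1 : ∀ i, (S v i).natDegree ≤ x := fun i => natDegree_ofCoeffs_le _
  have h2 : ∀ i, CoeffDegLE (S v i) y := fun i => coeffDegLE_ofCoeffs _
  refine ⟨S v, fun h => hv0 ?_, h1, h2, ?_⟩
  · funext i
    ext ⟨k, l⟩
    have := coeff_coeff_ofCoeffs (v i) k l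
    rw [← this]
    have h3 : ofCoeffs (x + 1) (y + 1) (v i) = 0 := congrFun h i
    simp [h3]
  · funext e
    ext k
    rcases Nat.lt_or_ge z k with hk | hk
    · simpa using coeff_eq_zero_of_natDegree_lt ((hΛ _ h1 h2 e).trans_lt hk)
    · exact congrFun (congrFun hv e) ⟨k, by omega⟩

end Siegel

section Liouville

open scoped PowerSeries

variable {Fq : Type*} [Field Fq] {K : Type*} [NormedField K] [Algebra Fq K]

variable (Fq) in
/-- Specialization `𝔽_q[θ][T] → K[T]` of the indeterminate `θ`. -/
noncomputable def spec (θ : K) : Fq[X][X] →+* K[X] :=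
  Polynomial.mapRingHom (aeval θ : Fq[X] →ₐ[Fq] K).toRingHom

@[simp]
theorem coeff_spec (θ : K) (p : Fq[X][X]) (m : ℕ) :
    (spec Fq θ p).coeff m = aeval θ (p.coeff m) := by
  simp [spec]

variable [Fintype Fq]

theorem ptw_spec (θ : K) (d : ℕ) (p : Fq[X][X]) :
    ptw Fq K d (spec Fq θ p) = spec Fq θ (p.map (frob Fq Fq[X] d)) := by
  ext m
  simp

theorem eval_ptw_spec (θ : K) (d r : ℕ) (p : Fq[X][X]) :
    (ptw Fq K d (spec Fq θ p)).eval (θ ^ r) = aeval θ (twEval Fq d r p) := by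
  rw [twEval, coe_eval₂RingHom, eval₂_eq_sum_range, map_sum, ptw_spec, spec, coe_mapRingHom,
    Polynomial.map_map, eval_map, eval₂_eq_sum_range]
  refine Finset.sum_congr rfl fun i _ => ?_
  simp

theorem coeff_mul_of_low {p f : K⟦X⟧} {k m : ℕ} (hp : ∀ i < k, PowerSeries.coeff i p = 0)
    (hf : ∀ i < m, PowerSeries.coeff i f = 0) :
    PowerSeries.coeff (k + m) (p * f) = PowerSeries.coeff k p * PowerSeries.coeff m f := by
  rw [PowerSeries.coeff_mul, Finset.sum_eq_single (k, m)]
  · rintro ⟨i, j⟩ hij hne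
    rw [Finset.HasAntidiagonal.mem_antidiagonal] at hij
    dsimp only at hij ⊢
    rcases lt_trichotomy i k with h | h | h
    · rw [hp i h, zero_mul]
    · exact absurd (by rw [Prod.mk.injEq]; omega) hne
    · rw [hf j (by omega), mul_zero]
  · simp

variable [IsUltrametricDist K]

theorem one_le_of_additive_relation {θ : K} (hθ : 1 < ‖θ‖) {ℓ y : ℕ} {a : ℕ → Fq[X]}
    (ha : ∀ r < ℓ, (a r).natDegree ≤ y) (hne : ∃ r < ℓ, a r ≠ 0) {lam : K} (hl : lam ≠ 0)
    (h : ∑ r ∈ Finset.range ℓ, aeval θ (a r) * lam ^ Fintype.card Fq ^ r = 0) :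
    1 ≤ ‖θ‖ ^ y * ‖lam‖ := by
  classical
  have hq := two_le_card Fq
  have hθy : 1 ≤ ‖θ‖ ^ y := one_le_pow₀ hθ.le
  have hlam : 0 < ‖lam‖ := norm_pos_iff.2 hl
  rcases le_or_gt 1 ‖lam‖ with h1 | h1
  · exact one_le_mul_of_one_le_of_one_le hθy h1
  set r₀ := Nat.find hne with hr₀
  obtain ⟨hr, har⟩ := Nat.find_spec hne
  rw [← hr₀] at hr har
  have hlow : ∀ r < r₀, a r = 0 := fun r hrr => by
    by_contra hc
    exact Nat.find_min hne hrr ⟨hrr.trans hr, hc⟩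
  rw [← Finset.add_sum_erase _ _ (Finset.mem_range.2 hr), add_eq_zero_iff_eq_neg] at h
  have h2 : ‖aeval θ (a r₀) * lam ^ Fintype.card Fq ^ r₀‖ ≤
      ‖θ‖ ^ y * ‖lam‖ ^ (Fintype.card Fq ^ r₀ + 1) := by
    rw [h, norm_neg]
    refine IsUltrametricDist.norm_sum_le_of_forall_le_of_nonneg (by positivity) fun r hr' => ?_
    rw [Finset.mem_erase, Finset.mem_range] at hr'
    rcases lt_or_gt_of_ne hr'.1 with hlt | hgt
    · rw [hlow r hlt, map_zero, zero_mul, norm_zero]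
      positivity
    · rw [norm_mul, norm_pow]
      refine mul_le_mul (norm_aeval_le hθ (ha r hr'.2))
        (pow_le_pow_of_le_one hlam.le h1.le ?_) (by positivity) (by positivity)
      exact Nat.pow_lt_pow_right (by omega) hgt
  rw [norm_mul, norm_pow, pow_succ] at h2
  have h3 := one_le_norm_aeval hθ har
  have h4 : 0 < ‖lam‖ ^ Fintype.card Fq ^ r₀ := by positivity
  have h5 : ‖lam‖ ^ Fintype.card Fq ^ r₀ ≤
      ‖θ‖ ^ y * (‖lam‖ ^ Fintype.card Fq ^ r₀ * ‖lam‖) :=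
    (le_mul_of_one_le_left h4.le h3).trans h2
  refine le_of_mul_le_mul_left ?_ h4
  linarith

/-- Liouville's inequality for the leading coefficient of a combination of Frobenius twists. -/
theorem exists_one_le_norm_leading {θ : K} (hθ : 1 < ‖θ‖) {ι : Type*} [Fintype ι]
    {f : ι → K⟦X⟧} {Φ : ι → ι → Fq[X][X]}
    (hf : ∀ i, tw Fq K 1 (f i) = ∑ j, toSeries K (spec Fq θ (Φ i j)) * f j) (D : ℕ) :
    ∃ Y : ℕ, ∀ (M : ℕ) (P : ι → Fq[X][X]),
      (∀ i, CoeffDegLE (P i) (Fintype.card Fq ^ M * D)) → ∀ m : ℕ,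
      (∀ k < m, PowerSeries.coeff k (∑ i, toSeries K (spec Fq θ (P i)) * tw Fq K M (f i)) = 0) →
      PowerSeries.coeff m (∑ i, toSeries K (spec Fq θ (P i)) * tw Fq K M (f i)) ≠ 0 →
      1 ≤ ‖θ‖ ^ (Fintype.card Fq ^ M * Y) *
        ‖PowerSeries.coeff m (∑ i, toSeries K (spec Fq θ (P i)) * tw Fq K M (f i))‖ := by
  classical
  have hq := two_le_card Fq
  set q := Fintype.card Fq with hqdef
  obtain ⟨b, hb⟩ : ∃ b, ∀ i j, CoeffDegLE (Φ i j) b := by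
    choose b hb using fun i j => exists_coeffDegLE (Φ i j)
    refine ⟨∑ i, ∑ j, b i j, fun i j => (hb i j).mono ?_⟩
    exact (Finset.single_le_sum (f := fun j => b i j) (fun _ _ => Nat.zero_le _)
      (Finset.mem_univ j)).trans (Finset.single_le_sum (f := fun i => ∑ j, b i j)
      (fun _ _ => Nat.zero_le _) (Finset.mem_univ i))
  let Dr : ℕ → ℕ := fun r => Nat.rec D (fun _ d => q * d + b) r
  have Drs : ∀ r, Dr (r + 1) = q * Dr r + b := fun r => rfl
  have Dmono : Monotone Dr := monotone_nat_of_le_succ fun r => by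
    rw [Drs]
    nlinarith
  set ℓ := Fintype.card ι with hℓ
  refine ⟨3 * ℓ * (Dr ℓ + 1), fun M P hP m hm hm0 => ?_⟩
  set E : K⟦X⟧ := ∑ i, toSeries K (spec Fq θ (P i)) * tw Fq K M (f i) with hE
  have hQ : 1 ≤ q ^ M := Nat.one_le_pow _ _ (by omega)
  set Q := q ^ M with hQdef
  let Mr : ℕ → ι → Fq[X][X] := fun r => Nat.rec P (fun _ N j =>
    ∑ i, (N i).map (frob Fq Fq[X] 1) * (Φ i j).map (frob Fq Fq[X] M)) r
  have Mrs : ∀ r j, Mr (r + 1) j =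
    ∑ i, (Mr r i).map (frob Fq Fq[X] 1) * (Φ i j).map (frob Fq Fq[X] M) := fun r j => rfl
  have Mdeg : ∀ r i, CoeffDegLE (Mr r i) (Q * Dr r) := by
    intro r
    induction r with
    | zero => exact hP
    | succ r ih =>
      intro j
      rw [Mrs, Drs]
      refine CoeffDegLE.sum fun i _ => (((ih i).map_frob 1).mul ((hb i j).map_frob M)).mono ?_
      rw [pow_one, ← hqdef, ← hQdef]
      exact le_of_eq (by ring)
  have ME : ∀ r, tw Fq K r E = ∑ i, toSeries K (spec Fq θ (Mr r i)) * tw Fq K M (f i) := by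
    intro r
    induction r with
    | zero => exact tw_zero E
    | succ r ih =>
      have hfM : ∀ i, tw Fq K 1 (tw Fq K M (f i)) =
          ∑ j, toSeries K (spec Fq θ ((Φ i j).map (frob Fq Fq[X] M))) * tw Fq K M (f j) :=
        fun i => by
          rw [tw_tw, add_comm, ← tw_tw, hf, map_sum]
          simp only [map_mul, tw_toSeries, ptw_spec]
      rw [add_comm r 1, ← tw_tw, ih, map_sum, add_comm 1 r]
      simp only [map_mul, hfM, Mrs, map_sum, tw_toSeries, ptw_spec, Finset.sum_mul,
        Finset.mul_sum]
      rw [Finset.sum_comm]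
      simp only [mul_assoc]
  obtain ⟨w, hw⟩ : ∃ w, ∀ r < ℓ + 1, ∀ i, (Mr r i).natDegree ≤ w := by
    refine ⟨∑ r ∈ Finset.range (ℓ + 1), ∑ i, (Mr r i).natDegree, fun r hr i => ?_⟩
    exact (Finset.single_le_sum (f := fun i => (Mr r i).natDegree) (fun _ _ => Nat.zero_le _)
      (Finset.mem_univ i)).trans (Finset.single_le_sum
      (f := fun r => ∑ i, (Mr r i).natDegree) (fun _ _ => Nat.zero_le _) (Finset.mem_range.2 hr))
  let Λ : (Fin (ℓ + 1) → Fq[X][X]) →ₗ[Fq] (ι × Fin ((3 * ℓ + 1) * (w + 1)) → Fq[X]) :=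
    { toFun := fun a e => (∑ r : Fin (ℓ + 1), a r * Mr r e.1).coeff e.2
      map_add' := fun a a' => by
        funext e
        simp [add_mul, Finset.sum_add_distrib]
      map_smul' := fun c a => by
        funext e
        simp [Finset.smul_sum, finsetSum_coeff] }
  obtain ⟨a, ha0, hax, hay, haΛ⟩ := exists_ne_zero_of_card_lt (x := 3 * ℓ * (w + 1))
    (y := 3 * ℓ * (Q * Dr ℓ + 1)) (z := 3 * ℓ * (Q * Dr ℓ + 1) + Q * Dr ℓ) Λ (by
      intro a _ ha e
      have : CoeffDegLE (∑ r : Fin (ℓ + 1), a r * Mr r e.1)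
          (3 * ℓ * (Q * Dr ℓ + 1) + Q * Dr ℓ) :=
        CoeffDegLE.sum fun r _ => (ha r).mul ((Mdeg r e.1).mono
          (Nat.mul_le_mul_left _ (Dmono (Nat.lt_succ_iff.1 r.2))))
      exact this _) (by
      rw [Fintype.card_prod, Fintype.card_fin, Fintype.card_fin, ← hℓ]
      generalize Q * Dr ℓ = u
      have h1 : ℓ ≤ 3 * (ℓ * ℓ) := by nlinarith [Nat.le_mul_self ℓ]
      have h2 : ℓ * (3 * ℓ + 1) * (3 * ℓ + 1) ≤ (ℓ + 1) * (9 * (ℓ * ℓ)) := by nlinarith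
      calc ℓ * ((3 * ℓ + 1) * (w + 1)) * (3 * ℓ * (u + 1) + u + 1)
          = ℓ * (3 * ℓ + 1) * (3 * ℓ + 1) * ((w + 1) * (u + 1)) := by ring
        _ ≤ (ℓ + 1) * (9 * (ℓ * ℓ)) * ((w + 1) * (u + 1)) := Nat.mul_le_mul_right _ h2
        _ = (ℓ + 1) * ((3 * ℓ * (w + 1)) * (3 * ℓ * (u + 1))) := by ring
        _ < (ℓ + 1) * ((3 * ℓ * (w + 1) + 1) * (3 * ℓ * (u + 1) + 1)) := by
          apply Nat.mul_lt_mul_of_pos_left _ (by omega)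
          nlinarith)
  have hrel : ∀ i, ∑ r : Fin (ℓ + 1), a r * Mr r i = 0 := by
    intro i
    ext1 k
    rcases Nat.lt_or_ge k ((3 * ℓ + 1) * (w + 1)) with hk | hk
    · rw [coeff_zero]
      exact congrFun haΛ (i, ⟨k, hk⟩)
    · rw [coeff_zero]
      refine coeff_eq_zero_of_natDegree_lt (lt_of_le_of_lt (b := 3 * ℓ * (w + 1) + w) ?_ ?_)
      · refine natDegree_sum_le_of_forall_le _ _ fun r _ => ?_
        exact natDegree_mul_le_of_le (hax r) (hw r r.2 i)
      · have : (3 * ℓ + 1) * (w + 1) = 3 * ℓ * (w + 1) + w + 1 := by ring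
        omega
  have hE0 : ∑ r : Fin (ℓ + 1), toSeries K (spec Fq θ (a r)) * tw Fq K r E = 0 := by
    simp only [ME, Finset.mul_sum]
    rw [Finset.sum_comm]
    refine Finset.sum_eq_zero fun i _ => ?_
    simp only [← mul_assoc]
    rw [← Finset.sum_mul]
    simp only [← map_mul]
    rw [← map_sum, ← map_sum, hrel, map_zero, map_zero, zero_mul]
  have hex : ∃ k, ∃ r, (a r).coeff k ≠ 0 := by
    by_contra! hcon
    exact ha0 (funext fun r => by ext1 k; simp [hcon k r])
  set k := Nat.find hex with hk
  obtain ⟨r₁, hr₁⟩ := Nat.find_spec hex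
  have hlow : ∀ i < k, ∀ r, (a r).coeff i = 0 := fun i hi r => by
    by_contra hcon
    exact Nat.find_min hex hi ⟨r, hcon⟩
  have hcoeff := congrArg (PowerSeries.coeff (k + m)) hE0
  rw [map_sum, map_zero] at hcoeff
  have hterm : ∀ r : Fin (ℓ + 1), PowerSeries.coeff (k + m)
      (toSeries K (spec Fq θ (a r)) * tw Fq K r E) =
      aeval θ ((a r).coeff k) * PowerSeries.coeff m E ^ q ^ (r : ℕ) := fun r => by
    rw [coeff_mul_of_low]
    · simp [hqdef]
    · intro i hi
      simp [hlow i hi r]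
    · intro i hi
      rw [coeff_tw, hm i hi, zero_pow]
      exact (Nat.pow_pos (by omega)).ne'
  simp only [hterm] at hcoeff
  let a' : ℕ → Fq[X] := fun r => if h : r < ℓ + 1 then (a ⟨r, h⟩).coeff k else 0
  have ha' : ∀ r : Fin (ℓ + 1), a' r = (a r).coeff k := fun r => dif_pos r.2
  have hsum : ∑ r ∈ Finset.range (ℓ + 1), aeval θ (a' r) *
      PowerSeries.coeff m E ^ q ^ r = 0 := by
    rw [Finset.sum_range, ← hcoeff]
    refine Finset.sum_congr rfl fun r _ => ?_
    rw [ha']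
  have hfin := one_le_of_additive_relation hθ (y := 3 * ℓ * (Q * Dr ℓ + 1)) (a := a')
    (ℓ := ℓ + 1) (fun r hr => (congrArg natDegree (ha' ⟨r, hr⟩)).trans_le (hay ⟨r, hr⟩ k))
    ⟨r₁, r₁.2, by rw [ha']; exact hr₁⟩ hm0 hsum
  refine hfin.trans (mul_le_mul_of_nonneg_right (pow_le_pow_right₀ hθ.le ?_) (norm_nonneg _))
  calc 3 * ℓ * (Q * Dr ℓ + 1) ≤ 3 * ℓ * (Q * Dr ℓ + Q) := by gcongr
    _ = Q * (3 * ℓ * (Dr ℓ + 1)) := by ring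

end Liouville

section LinearIndependenceCriterion

open scoped PowerSeries

variable {Fq : Type*} [Field Fq] [Fintype Fq]

theorem twEval_smul (d r : ℕ) (c : Fq) (p : Fq[X][X]) :
    twEval Fq d r (c • p) = c • twEval Fq d r p := by
  have h : c • p = C (C c) * p := by
    ext i j
    simp
  rw [h, map_mul, twEval_C, ← C_pow, FiniteField.pow_card_pow, smul_eq_C_mul]

variable {K : Type*} [NormedField K]

theorem prod_norm_pow_le {θ : K} (hθ : 1 < ‖θ‖) {q : ℕ} (hq : 2 ≤ q) (N : ℕ) :
    ∏ μ ∈ Finset.range N, ‖θ ^ q ^ μ‖ ≤ ‖θ‖ ^ q ^ N := by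
  simp only [norm_pow]
  rw [Finset.prod_pow_eq_pow_sum]
  refine pow_le_pow_right₀ hθ.le ?_
  induction N with
  | zero => simp
  | succ N ih =>
    rw [Finset.sum_range_succ, pow_succ]
    have := Nat.mul_le_mul_left (q ^ N) hq
    omega

variable [Algebra Fq K]

theorem Bdd.tw {ρ C : ℝ} {f : K⟦X⟧} (h : Bdd ρ C f) (hρ : 0 ≤ ρ) (d : ℕ) :
    Bdd (ρ ^ Fintype.card Fq ^ d) (C ^ Fintype.card Fq ^ d) (tw Fq K d f) := fun m => by
  rw [coeff_tw, norm_pow, ← pow_mul, mul_comm _ m, pow_mul, ← mul_pow]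
  exact pow_le_pow_left₀ (by positivity) (h m) _

variable [IsUltrametricDist K]

theorem spec_injective {θ : K} (hθ : 1 < ‖θ‖) : Function.Injective (spec Fq θ) := by
  rw [injective_iff_map_eq_zero]
  intro p hp
  ext1 m
  by_contra hm
  refine aeval_ne_zero hθ hm ?_
  rw [← coeff_spec, hp, coeff_zero]

theorem CoeffDegLE.bdd_spec {θ : K} (hθ : 1 < ‖θ‖) {p : Fq[X][X]} {y x : ℕ}
    (h : CoeffDegLE p y) (hx : p.natDegree ≤ x) {R : ℝ} (hR : 1 ≤ R) :
    Bdd R (‖θ‖ ^ y * R ^ x) (toSeries K (spec Fq θ p)) := fun m => by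
  rw [coeff_toSeries, coeff_spec]
  rcases le_or_gt m x with hm | hm
  · exact mul_le_mul (norm_aeval_le hθ (h m)) (pow_le_pow_right₀ hR hm) (by positivity)
      (by positivity)
  · rw [coeff_eq_zero_of_natDegree_lt (hx.trans_lt hm), map_zero, norm_zero, zero_mul]
    positivity

variable [CompleteSpace K]

/-- If the values at `θ` of all twists of a Frobenius module of entire series satisfy linear
relations with slowly growing coefficients, then some twists of the series are linearly
dependent over the polynomials. -/
theorem exists_relation_of_values {θ : K} (hθ : 1 < ‖θ‖) {J : Type*} [Fintype J]
    {f : Option J → K⟦X⟧} {Φ : Option J → Option J → Fq[X][X]}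
    (hf : ∀ i, tw Fq K 1 (f i) = ∑ j, toSeries K (spec Fq θ (Φ i j)) * f j)
    {B : ℝ} (hB : ∀ i, Bdd ‖θ‖ B (f i)) {w : ℕ → Option J → K}
    (hw : ∀ ν i, HasEv θ (tw Fq K ν (f i)) (w ν i)) {x : ℕ → J → Fq[X]} {C : ℕ}
    (hx : ∀ ν j, (x ν j).natDegree ≤ C * Fintype.card Fq ^ ν)
    (hxw : ∀ ν, w ν none = ∑ j, aeval θ (x ν j) * w ν (some j)) :
    ∃ (M : ℕ) (P : Option J → K[X]), P ≠ 0 ∧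
      ∑ i, toSeries K (P i) * tw Fq K M (f i) = 0 := by
  classical
  have hq := two_le_card Fq
  set q := Fintype.card Fq with hqdef
  set ℓ := Fintype.card J + 1 with hℓ
  set D := 2 * ℓ * (C + 1) with hD
  obtain ⟨Y, hY⟩ := exists_one_le_norm_leading hθ hf D
  obtain ⟨c, hc⟩ := pow_unbounded_of_one_lt B hθ
  set κ := Y + c + D + 1 with hκ
  set N := 2 * ℓ * κ with hN
  set M := 2 * N with hM
  set Q := q ^ M with hQ
  obtain ⟨xP, hxP⟩ : ∃ xP, xP + 1 = (2 * ℓ - 1) * κ :=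
    ⟨(2 * ℓ - 1) * κ - 1, Nat.sub_add_cancel (Nat.mul_pos (by omega) (by omega))⟩
  have hxN : xP + 1 + κ = N := by
    rw [hxP, hN, show 2 * ℓ = (2 * ℓ - 1) + 1 by omega]
    simp only [Nat.add_sub_cancel]
    ring
  have hQ1 : 1 ≤ Q := Nat.one_le_pow _ _ (by omega)
  have hNq : N < q ^ N := Nat.lt_pow_self (by omega)
  have hQN : Q = q ^ N * q ^ N := by rw [hQ, hM, two_mul, pow_add]
  have hMμ : ∀ μ, μ < N → q ^ (M - μ) * q ^ μ = Q := fun μ hμ => by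
    rw [← pow_add, Nat.sub_add_cancel (by omega)]
  let Λ : (Option J → Fq[X][X]) →ₗ[Fq] (J × Fin N → Fq[X]) :=
    { toFun := fun P e => twEval Fq 0 (q ^ (e.2 : ℕ)) (P (some e.1)) +
        twEval Fq 0 (q ^ (e.2 : ℕ)) (P none) * x (M - e.2) e.1 ^ q ^ (e.2 : ℕ)
      map_add' := fun P P' => by
        funext e
        simp only [Pi.add_apply, map_add]
        ring
      map_smul' := fun a P => by
        funext e
        simp only [Pi.smul_apply, twEval_smul, RingHom.id_apply, smul_add, smul_mul_assoc] }
  obtain ⟨P, hP0, hPx, hPy, hPΛ⟩ := exists_ne_zero_of_card_lt (x := xP) (y := Q * D)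
    (z := Q * (D + 1 + C)) Λ (by
      intro P hPx hPy e
      have h1 : ∀ i, (twEval Fq 0 (q ^ (e.2 : ℕ)) (P i)).natDegree ≤ Q * (D + 1) := fun i => by
        refine ((hPy i).natDegree_twEval_le 0 _).trans ?_
        rw [pow_zero, one_mul, mul_add, mul_one, hQN]
        have h2 : q ^ (e.2 : ℕ) ≤ q ^ N := Nat.pow_le_pow_right (by omega) e.2.2.le
        have h3 : (P i).natDegree ≤ q ^ N := (hPx i).trans (by omega)
        exact Nat.add_le_add_left (Nat.mul_le_mul h3 h2) _
      refine natDegree_add_le_of_degree_le ((h1 _).trans (Nat.mul_le_mul_left _ (by omega))) ?_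
      rw [mul_add]
      refine natDegree_mul_le_of_le (h1 _) ((natDegree_pow_le_of_le _ (hx _ _)).trans ?_)
      rw [mul_comm C, ← mul_assoc, mul_comm (q ^ (e.2 : ℕ)), hMμ _ e.2.2]) (by
      rw [Fintype.card_prod, Fintype.card_fin, Fintype.card_option, hxP, hN, hD, ← hℓ]
      obtain ⟨l, hl⟩ : ∃ l, Fintype.card J = l := ⟨_, rfl⟩
      rw [hl] at hℓ ⊢
      rw [hℓ, show 2 * (l + 1) - 1 = 2 * l + 1 by omega]
      have hκ0 : 0 < (l + 1) * κ := Nat.mul_pos (by omega) (by omega)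
      generalize hu : Q * (C + 1) = u
      calc l * (2 * (l + 1) * κ) * (Q * (2 * (l + 1) * (C + 1) + 1 + C) + 1)
          = (l + 1) * κ * (2 * l * ((2 * (l + 1) + 1) * (Q * (C + 1)) + 1)) := by ring
        _ < (l + 1) * κ * ((2 * l + 1) * (2 * (l + 1) * (Q * (C + 1)) + 1)) := by
          apply Nat.mul_lt_mul_of_pos_left _ hκ0
          nlinarith
        _ = (l + 1) * ((2 * l + 1) * κ * (Q * (2 * (l + 1) * (C + 1)) + 1)) := by ring)
  refine ⟨M, fun i => spec Fq θ (P i), fun h => hP0 (funext fun i => spec_injective hθ ?_), ?_⟩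
  · rw [Pi.zero_apply, map_zero]
    exact congrFun h i
  set E : K⟦X⟧ := ∑ i, toSeries K (spec Fq θ (P i)) * tw Fq K M (f i) with hE
  by_contra hE0
  have hex : ∃ m, PowerSeries.coeff m E ≠ 0 := by
    by_contra! hcon
    exact hE0 (PowerSeries.ext fun m => by simp [hcon m])
  obtain ⟨m, hm, hmlow⟩ : ∃ m, PowerSeries.coeff m E ≠ 0 ∧
      ∀ k < m, PowerSeries.coeff k E = 0 :=
    ⟨Nat.find hex, Nat.find_spec hex, fun k hk => not_not.1 (Nat.find_min hex hk)⟩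
  have hθ0 : 0 < ‖θ‖ := by linarith
  have hvan : ∀ μ < N, HasEv (θ ^ q ^ μ) E 0 := by
    intro μ hμ
    have hev : ∀ i, HasEv (θ ^ q ^ μ) (toSeries K (spec Fq θ (P i)) * tw Fq K M (f i))
        (aeval θ (twEval Fq 0 (q ^ μ) (P i)) * w (M - μ) i ^ q ^ μ) := fun i => by
      have h1 := (HasEv.tw (Fq := Fq) (hw (M - μ) i) μ).poly_mul (spec Fq θ (P i))
      rwa [tw_tw, Nat.add_sub_cancel' (by omega), ← hqdef, ← ptw_zero (Fq := Fq) (spec Fq θ (P i)),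
        eval_ptw_spec, ptw_zero] at h1
    have h2 := HasEv.sum (s := Finset.univ) fun i _ => hev i
    convert h2 using 1
    rw [Fintype.sum_option, hxw, sum_pow_card_pow, Finset.mul_sum, ← Finset.sum_add_distrib]
    symm
    refine Finset.sum_eq_zero fun j _ => ?_
    have h3 : twEval Fq 0 (q ^ μ) (P (some j)) +
        twEval Fq 0 (q ^ μ) (P none) * x (M - μ) j ^ q ^ μ = 0 := congrFun hPΛ (j, ⟨μ, hμ⟩)
    have h4 := congrArg (aeval θ) h3
    rw [map_add, map_mul, map_pow, map_zero] at h4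
    rw [mul_pow, ← mul_assoc, ← add_mul, add_comm, h4, zero_mul]
  have hR : 1 ≤ ‖θ‖ ^ Q := one_le_pow₀ hθ.le
  have hbdd : Bdd (‖θ‖ ^ Q) (‖θ‖ ^ (Q * D) * (‖θ‖ ^ Q) ^ xP * (‖θ‖ ^ c) ^ Q) E := by
    refine Bdd.sum (by positivity) (by positivity) fun i _ => ?_
    exact ((hPy i).bdd_spec hθ (hPx i) hR).mul (by positivity)
      ((((hB i).mono hc.le).tw hθ0.le M))
  have hS := hbdd.norm_coeff_le_of_zeros (α := fun μ => θ ^ q ^ μ) (fun μ ν h =>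
    Nat.pow_right_injective hq (pow_injective_of_one_lt_norm hθ h))
    (fun μ => pow_ne_zero _ (norm_pos_iff.1 hθ0)) N (fun μ hμ => by
      rw [norm_pow]
      exact pow_lt_pow_right₀ hθ (Nat.pow_lt_pow_right (by omega) (by omega)))
    (by positivity) hvan hmlow
  have hL := hY M P hPy m hmlow hm
  rw [← hE, ← hqdef, ← hQ] at hL
  have hprod := prod_norm_pow_le hθ hq N
  have hNQ : q ^ N ≤ Q := Nat.pow_le_pow_right (by omega) (by omega)
  have h1 : ‖PowerSeries.coeff m E‖ * ‖θ‖ ^ (Q * N) ≤ ‖θ‖ ^ (Q * (D + xP + c + 1)) := by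
    calc ‖PowerSeries.coeff m E‖ * ‖θ‖ ^ (Q * N)
        ≤ ‖PowerSeries.coeff m E‖ * (‖θ‖ ^ Q) ^ (m + N) := by
          rw [← pow_mul]
          exact mul_le_mul_of_nonneg_left (pow_le_pow_right₀ hθ.le
            (Nat.mul_le_mul_left _ (by omega))) (norm_nonneg _)
      _ ≤ _ := hS
      _ ≤ ‖θ‖ ^ (Q * D) * (‖θ‖ ^ Q) ^ xP * (‖θ‖ ^ c) ^ Q * ‖θ‖ ^ Q :=
          mul_le_mul_of_nonneg_left (hprod.trans (pow_le_pow_right₀ hθ.le hNQ)) (by positivity)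
      _ = ‖θ‖ ^ (Q * (D + xP + c + 1)) := by ring
  have h2 : ‖θ‖ ^ (Q * N) ≤ ‖θ‖ ^ (Q * (Y + (D + xP + c + 1))) := by
    calc ‖θ‖ ^ (Q * N) ≤ ‖θ‖ ^ (Q * Y) * ‖PowerSeries.coeff m E‖ * ‖θ‖ ^ (Q * N) :=
          le_mul_of_one_le_left (by positivity) hL
      _ = ‖θ‖ ^ (Q * Y) * (‖PowerSeries.coeff m E‖ * ‖θ‖ ^ (Q * N)) := by ring
      _ ≤ ‖θ‖ ^ (Q * Y) * ‖θ‖ ^ (Q * (D + xP + c + 1)) :=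
          mul_le_mul_of_nonneg_left h1 (by positivity)
      _ = _ := by ring
  have h3 := Nat.le_of_mul_le_mul_left ((pow_le_pow_iff_right₀ hθ).1 h2) (by omega)
  omega

end LinearIndependenceCriterion

section FunctionalEquations

open scoped PowerSeries

variable {Fq : Type*} [Field Fq] [Fintype Fq] {K : Type*} [NormedField K] [Algebra Fq K]

/-- A rational solution of a twisted equation with fixed inhomogeneity has a fixed denominator. -/
theorem exists_fixed_denominator {x y c h l : K[X]} (hy : y ≠ 0)
    (hxy : ptw Fq K 1 x * y = l * ptw Fq K 1 y * (x + c * h * y)) :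
    ∃ x' y' : K[X], y' ≠ 0 ∧ ptw Fq K 1 y' = y' ∧ x' * y = x * y' ∧
      ptw Fq K 1 x' = l * (x' + c * y' * h) := by
  classical
  obtain ⟨a, b, g, hg, hb, hxa, hyb, hcop⟩ : ∃ a b g : K[X], g ≠ 0 ∧ b.Monic ∧ x = g * a ∧
      y = g * b ∧ IsCoprime a b := by
    obtain ⟨a, ha⟩ := EuclideanDomain.gcd_dvd_left x y
    obtain ⟨b, hb⟩ := EuclideanDomain.gcd_dvd_right x y
    set g := EuclideanDomain.gcd x y
    have hg : g ≠ 0 := by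
      rintro h0
      rw [h0, zero_mul] at hb
      exact hy hb
    have hb0 : b ≠ 0 := by
      rintro rfl
      rw [mul_zero] at hb
      exact hy hb
    have hlc : b.leadingCoeff ≠ 0 := leadingCoeff_ne_zero.2 hb0
    have hu : IsUnit (C b.leadingCoeff⁻¹) := isUnit_C.2 (inv_ne_zero hlc).isUnit
    have hCC : C b.leadingCoeff * C b.leadingCoeff⁻¹ = 1 := by
      rw [← C_mul, mul_inv_cancel₀ hlc, C_1]
    refine ⟨C b.leadingCoeff⁻¹ * a, C b.leadingCoeff⁻¹ * b, g * C b.leadingCoeff,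
      mul_ne_zero hg (C_ne_zero.2 hlc), ?_, ?_, ?_, ?_⟩
    · rw [mul_comm]
      exact monic_mul_leadingCoeff_inv hb0
    · rw [mul_assoc, ← mul_assoc (C b.leadingCoeff), hCC, one_mul, ← ha]
    · rw [mul_assoc, ← mul_assoc (C b.leadingCoeff), hCC, one_mul, ← hb]
    · rw [isCoprime_mul_unit_left hu]
      refine ⟨EuclideanDomain.gcdA x y, EuclideanDomain.gcdB x y, mul_left_cancel₀ hg ?_⟩
      have h1 := EuclideanDomain.gcd_eq_gcd_ab x y
      calc g * (EuclideanDomain.gcdA x y * a + EuclideanDomain.gcdB x y * b)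
          = g * a * EuclideanDomain.gcdA x y + g * b * EuclideanDomain.gcdB x y := by ring
        _ = g * 1 := by rw [← ha, ← hb, ← h1, mul_one]
  have hφg : ptw Fq K 1 g ≠ 0 := (map_ne_zero_iff _ (ptw_injective 1)).2 hg
  have hφb : (ptw Fq K 1 b).Monic := hb.map _
  have h1 : ptw Fq K 1 a * b = l * ptw Fq K 1 b * (a + c * h * b) := by
    apply mul_left_cancel₀ (mul_ne_zero hφg hg)
    rw [hxa, hyb, map_mul, map_mul] at hxy
    linear_combination hxy
  have hdvd : ptw Fq K 1 b ∣ b := by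
    refine (hcop.map (ptw Fq K 1)).symm.dvd_of_dvd_mul_left ?_
    rw [h1, mul_comm l, mul_assoc]
    exact dvd_mul_right _ _
  have hfix : ptw Fq K 1 b = b :=
    (eq_of_monic_of_dvd_of_natDegree_le hφb hb hdvd (natDegree_ptw 1 b).ge).symm
  refine ⟨a, b, hb.ne_zero, hfix, by rw [hxa, hyb]; ring, mul_right_cancel₀ hb.ne_zero ?_⟩
  rw [h1, hfix]
  ring

theorem eval_eq_zero_of_frobenius_eq {θ : K} {s : ℕ} (hs : s ≠ 0) {x z : K[X]}
    (h : ptw Fq K 1 x = (X - C (θ ^ Fintype.card Fq)) ^ s * z) : x.eval θ = 0 := by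
  have h1 := congrArg (eval (θ ^ Fintype.card Fq)) h
  have h2 := (HasEv.tw (Fq := Fq) (hasEv_toSeries θ x) 1)
  rw [tw_toSeries, pow_one] at h2
  rw [(hasEv_toSeries _ _).unique h2, eval_mul, eval_pow, eval_sub, eval_X, eval_C, sub_self,
    zero_pow hs, zero_mul] at h1
  exact pow_eq_zero_iff (Fintype.card_ne_zero) |>.1 h1

theorem ptw_eq_self {p : K[X]} (hp : ptw Fq K 1 p = p) (d : ℕ) : ptw Fq K d p = p := by
  induction d with
  | zero => exact ptw_zero p
  | succ d ih => rw [← ptw_ptw, hp, ih]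

/-- Independence of `1` and of solutions of Frobenius equations of different weights. -/
theorem coeff_eq_zero_of_relation {L : K[X]} (hL : L.natDegree = 1) {g : ℕ → K⟦X⟧} {h : ℕ → K[X]}
    (hg : ∀ s, tw Fq K 1 (g s) = toSeries K (L ^ s) * (g s - toSeries K (h s)))
    (S : Finset ℕ) (hS : ∀ s ∈ S, ∀ x y : K[X], y ≠ 0 → ptw Fq K 1 y = y →
      ptw Fq K 1 x = L ^ s * (x + y * h s) → toSeries K y * g s ≠ - toSeries K x)
    {b : ℕ → K[X]} {e : K[X]}
    (hrel : ∑ s ∈ S, toSeries K (b s) * g s + toSeries K e = 0) : ∀ s ∈ S, b s = 0 := by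
  classical
  induction S using Finset.strongInduction generalizing b e with
  | H S ih =>
  by_contra! hcon
  obtain ⟨s₀, hs₀, hb₀⟩ := hcon
  have hφb₀ : ptw Fq K 1 (b s₀) ≠ 0 := (map_ne_zero_iff _ (ptw_injective 1)).2 hb₀
  have hL0 : L ≠ 0 := by
    rintro rfl
    simp at hL
  have hφ := congrArg (tw Fq K 1) hrel
  simp only [map_add, map_sum, map_mul, hg, tw_toSeries, map_zero] at hφ
  have hother : ∀ s ∈ S.erase s₀, b s = 0 := by
    have h1 := ih (S.erase s₀) (Finset.erase_ssubset hs₀)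
      (fun s hs => hS s (Finset.mem_of_mem_erase hs))
      (b := fun s => b s₀ * ptw Fq K 1 (b s) * L ^ s - ptw Fq K 1 (b s₀) * L ^ s₀ * b s)
      (e := b s₀ * ptw Fq K 1 e - ptw Fq K 1 (b s₀) * L ^ s₀ * e -
        ∑ s ∈ S, b s₀ * ptw Fq K 1 (b s) * L ^ s * h s) (by
      have h2 : ∑ s ∈ S.erase s₀, toSeries K (b s₀ * ptw Fq K 1 (b s) * L ^ s -
          ptw Fq K 1 (b s₀) * L ^ s₀ * b s) * g s = ∑ s ∈ S, toSeries K (b s₀ *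
          ptw Fq K 1 (b s) * L ^ s - ptw Fq K 1 (b s₀) * L ^ s₀ * b s) * g s := by
        rw [← Finset.add_sum_erase _ _ hs₀]
        rw [show b s₀ * ptw Fq K 1 (b s₀) * L ^ s₀ - ptw Fq K 1 (b s₀) * L ^ s₀ * b s₀ = 0 by ring]
        simp
      rw [h2]
      have h3 := congrArg (toSeries K (b s₀) * ·) hφ
      have h4 := congrArg (toSeries K (ptw Fq K 1 (b s₀) * L ^ s₀) * ·) hrel
      simp only [mul_add, Finset.mul_sum, mul_zero] at h3 h4
      have h5 : ∀ s, toSeries K (b s₀ * ptw Fq K 1 (b s) * L ^ s -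
          ptw Fq K 1 (b s₀) * L ^ s₀ * b s) * g s =
          toSeries K (b s₀) * (toSeries K (ptw Fq K 1 (b s)) *
            (toSeries K (L ^ s) * (g s - toSeries K (h s)))) +
          toSeries K (b s₀ * ptw Fq K 1 (b s) * L ^ s * h s) -
          toSeries K (ptw Fq K 1 (b s₀) * L ^ s₀) * (toSeries K (b s) * g s) := fun s => by
        simp only [map_mul, map_sub]
        ring
      rw [Finset.sum_congr rfl fun s _ => h5 s, Finset.sum_sub_distrib, Finset.sum_add_distrib,
        map_sub, map_sub, map_sum]
      simp only [map_mul] at h3 h4 ⊢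
      linear_combination h3 - h4)
    intro s hs
    by_contra hbs
    have h2 := congrArg natDegree (sub_eq_zero.1 (h1 s hs))
    have hφbs : ptw Fq K 1 (b s) ≠ 0 := (map_ne_zero_iff _ (ptw_injective 1)).2 hbs
    rw [natDegree_mul (mul_ne_zero hb₀ hφbs) (pow_ne_zero _ hL0), natDegree_mul hb₀ hφbs,
      natDegree_mul (mul_ne_zero hφb₀ (pow_ne_zero _ hL0)) hbs,
      natDegree_mul hφb₀ (pow_ne_zero _ hL0), natDegree_ptw, natDegree_ptw, natDegree_pow,
      natDegree_pow, hL] at h2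
    exact Finset.ne_of_mem_erase hs (by omega)
  rw [← Finset.add_sum_erase _ _ hs₀, Finset.sum_eq_zero (s := S.erase s₀) (fun s hs => by
    rw [hother s hs, map_zero, zero_mul]), add_zero] at hrel
  rw [← Finset.add_sum_erase _ _ hs₀, Finset.sum_eq_zero (s := S.erase s₀) (fun s hs => by
    rw [hother s hs, map_zero, map_zero, zero_mul]), add_zero] at hφ
  obtain ⟨x, y, hy, hyfix, hxy, hx⟩ := exists_fixed_denominator (Fq := Fq) (x := e) (y := b s₀)
    (c := 1) (h := h s₀) (l := L ^ s₀) hb₀ (toSeries_injective (by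
      simp only [map_mul, map_add, map_one]
      linear_combination toSeries K (b s₀) * hφ -
        toSeries K (ptw Fq K 1 (b s₀)) * toSeries K (L ^ s₀) * hrel))
  rw [one_mul] at hx
  refine hS s₀ hs₀ x y hy hyfix hx ?_
  have hb₀' : toSeries K (b s₀) ≠ 0 := (map_ne_zero_iff _ toSeries_injective).2 hb₀
  have hxy' := congrArg (toSeries K) hxy
  rw [map_mul, map_mul] at hxy'
  apply mul_left_cancel₀ hb₀'
  linear_combination toSeries K y * hrel + hxy'

/-- In a relation involving a solution of the second-order equation, the coefficients solve
first-order twisted equations. -/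
theorem frobenius_eq_of_relation {L : K[X]} (hL : L.natDegree = 1) {n : ℕ} {S : Finset ℕ}
    (hSn : ∀ j ∈ S, j ≤ n) {g : ℕ → K⟦X⟧} {h : ℕ → K[X]}
    (hg : ∀ s, tw Fq K 1 (g s) = toSeries K (L ^ s) * (g s - toSeries K (h s)))
    (hind : ∀ (b : ℕ → K[X]) (e : K[X]),
      ∑ j ∈ S, toSeries K (b j) * g (n - j) + toSeries K e = 0 → ∀ j ∈ S, b j = 0)
    {F : K⟦X⟧} {a₀ : K[X]} {c : ℕ → K[X]}
    (hF : tw Fq K 1 F = toSeries K (L ^ n) * (F - (toSeries K a₀ +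
      ∑ j ∈ S, toSeries K (c j * h j) * (g (n - j) - toSeries K (h (n - j))))))
    {p e : K[X]} {b : ℕ → K[X]}
    (hrel : toSeries K p * F + ∑ j ∈ S, toSeries K (b j) * g (n - j) + toSeries K e = 0) :
    ∀ j ∈ S, ptw Fq K 1 (b j) * p = L ^ j * ptw Fq K 1 p * (b j + c j * h j * p) := by
  have hL0 : L ≠ 0 := by
    rintro rfl
    simp at hL
  have hφ := congrArg (tw Fq K 1) hrel
  simp only [map_add, map_sum, hF, hg, tw_toSeries, map_zero, map_mul (tw Fq K 1)] at hφ
  have h1 := hind (fun j => p * ptw Fq K 1 (b j) * L ^ (n - j) -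
    ptw Fq K 1 p * L ^ n * (b j + p * (c j * h j)))
    (p * ptw Fq K 1 e - ptw Fq K 1 p * L ^ n * (e + p * a₀) +
      ∑ j ∈ S, (ptw Fq K 1 p * L ^ n * p * (c j * h j) * h (n - j) -
        p * ptw Fq K 1 (b j) * L ^ (n - j) * h (n - j))) (by
    have h2 : ∀ j, toSeries K (p * ptw Fq K 1 (b j) * L ^ (n - j) -
        ptw Fq K 1 p * L ^ n * (b j + p * (c j * h j))) * g (n - j) =
        toSeries K p * (toSeries K (ptw Fq K 1 (b j)) * (toSeries K (L ^ (n - j)) *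
          (g (n - j) - toSeries K (h (n - j))))) -
        toSeries K (ptw Fq K 1 p * L ^ n) * (toSeries K (b j) * g (n - j)) -
        toSeries K (ptw Fq K 1 p * L ^ n * p) * (toSeries K (c j * h j) *
          (g (n - j) - toSeries K (h (n - j)))) -
        toSeries K (ptw Fq K 1 p * L ^ n * p * (c j * h j) * h (n - j) -
          p * ptw Fq K 1 (b j) * L ^ (n - j) * h (n - j)) := fun j => by
      simp only [map_mul, map_sub, map_add]
      ring
    rw [Finset.sum_congr rfl fun j _ => h2 j, Finset.sum_sub_distrib, Finset.sum_sub_distrib,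
      Finset.sum_sub_distrib, ← Finset.mul_sum, ← Finset.mul_sum, ← Finset.mul_sum, map_add,
      map_sum]
    simp only [map_mul (toSeries K) (ptw Fq K 1 p * L ^ n), map_mul (toSeries K) (ptw Fq K 1 p),
      map_mul (toSeries K) p, map_add, map_sub (toSeries K) (p * ptw Fq K 1 e)]
    linear_combination toSeries K p * hφ -
      toSeries K (ptw Fq K 1 p) * toSeries K (L ^ n) * hrel)
  intro j hj
  have h2 := h1 j hj
  apply mul_left_cancel₀ (pow_ne_zero (n - j) hL0)
  have h3 : L ^ n = L ^ (n - j) * L ^ j := by rw [← pow_add, Nat.sub_add_cancel (hSn j hj)]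
  rw [h3] at h2
  linear_combination h2

/-- Relations between Frobenius twists descend to relations between the series themselves. -/
theorem exists_relation_of_tw_relation {L : K[X]} (hL : L ≠ 0) {n : ℕ} {S : Finset ℕ}
    {g : ℕ → K⟦X⟧} {h : ℕ → K[X]}
    (hg : ∀ s, tw Fq K 1 (g s) = toSeries K (L ^ s) * (g s - toSeries K (h s)))
    {F : K⟦X⟧} {a₀ : K[X]} {c : ℕ → K[X]}
    (hF : tw Fq K 1 F = toSeries K (L ^ n) * (F - (toSeries K a₀ +
      ∑ j ∈ S, toSeries K (c j * h j) * (g (n - j) - toSeries K (h (n - j)))))) (M : ℕ)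
    {p e : K[X]} {b : ℕ → K[X]} (hne : p ≠ 0 ∨ (∃ j ∈ S, b j ≠ 0) ∨ e ≠ 0)
    (hrel : toSeries K p * tw Fq K M F + ∑ j ∈ S, toSeries K (b j) * tw Fq K M (g (n - j)) +
      toSeries K e = 0) :
    ∃ (p e : K[X]) (b : ℕ → K[X]), (p ≠ 0 ∨ (∃ j ∈ S, b j ≠ 0) ∨ e ≠ 0) ∧
      toSeries K p * F + ∑ j ∈ S, toSeries K (b j) * g (n - j) + toSeries K e = 0 := by
  induction M generalizing p e b with
  | zero => exact ⟨p, e, b, hne, by simpa only [tw_zero] using hrel⟩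
  | succ M ih =>
    have hLM : ∀ s, ptw Fq K M (L ^ s) ≠ 0 := fun s =>
      (map_ne_zero_iff _ (ptw_injective M)).2 (pow_ne_zero _ hL)
    refine ih (p := p * ptw Fq K M (L ^ n))
      (b := fun j => b j * ptw Fq K M (L ^ (n - j)) -
        p * ptw Fq K M (L ^ n) * ptw Fq K M (c j * h j))
      (e := e - p * ptw Fq K M (L ^ n) * ptw Fq K M a₀ +
        ∑ j ∈ S, (p * ptw Fq K M (L ^ n) * ptw Fq K M (c j * h j) * ptw Fq K M (h (n - j)) -
          b j * ptw Fq K M (L ^ (n - j)) * ptw Fq K M (h (n - j)))) ?_ ?_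
    · by_contra! hcon
      obtain ⟨h1, h2, h3⟩ := hcon
      have hp : p = 0 := (mul_eq_zero.1 h1).resolve_right (hLM n)
      have hb : ∀ j ∈ S, b j = 0 := fun j hj => by
        have := h2 j hj
        rw [h1, zero_mul, sub_zero] at this
        exact (mul_eq_zero.1 this).resolve_right (hLM _)
      have he : e = 0 := by
        rw [h1, zero_mul, sub_zero, Finset.sum_eq_zero (fun j hj => by rw [hb j hj]; ring),
          add_zero] at h3
        exact h3
      rcases hne with h4 | ⟨j, hj, h4⟩ | h4
      · exact h4 hp
      · exact h4 (hb j hj)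
      · exact h4 he
    · have hgM : ∀ s, tw Fq K (M + 1) (g s) = toSeries K (ptw Fq K M (L ^ s)) *
          (tw Fq K M (g s) - toSeries K (ptw Fq K M (h s))) := fun s => by
        rw [← tw_tw, hg, map_mul, map_sub, tw_toSeries, tw_toSeries]
      have hFM : tw Fq K (M + 1) F = toSeries K (ptw Fq K M (L ^ n)) * (tw Fq K M F -
          (toSeries K (ptw Fq K M a₀) + ∑ j ∈ S, toSeries K (ptw Fq K M (c j * h j)) *
            (tw Fq K M (g (n - j)) - toSeries K (ptw Fq K M (h (n - j)))))) := by
        rw [← tw_tw, hF, map_mul, map_sub, map_add, map_sum, tw_toSeries, tw_toSeries]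
        simp only [map_mul (tw Fq K M), map_sub, tw_toSeries]
      rw [hFM] at hrel
      simp only [hgM] at hrel
      have h2 : ∀ j, toSeries K (b j * ptw Fq K M (L ^ (n - j)) -
          p * ptw Fq K M (L ^ n) * ptw Fq K M (c j * h j)) * tw Fq K M (g (n - j)) =
          toSeries K (b j) * (toSeries K (ptw Fq K M (L ^ (n - j))) *
            (tw Fq K M (g (n - j)) - toSeries K (ptw Fq K M (h (n - j))))) -
          toSeries K (p * ptw Fq K M (L ^ n)) * (toSeries K (ptw Fq K M (c j * h j)) *
            (tw Fq K M (g (n - j)) - toSeries K (ptw Fq K M (h (n - j))))) -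
          toSeries K (p * ptw Fq K M (L ^ n) * ptw Fq K M (c j * h j) * ptw Fq K M (h (n - j)) -
            b j * ptw Fq K M (L ^ (n - j)) * ptw Fq K M (h (n - j))) := fun j => by
        simp only [map_mul (toSeries K), map_sub]
        ring
      rw [Finset.sum_congr rfl fun j _ => h2 j, Finset.sum_sub_distrib, Finset.sum_sub_distrib,
        ← Finset.mul_sum, map_add, map_sum]
      simp only [map_mul (toSeries K) p, map_mul (toSeries K) (p * ptw Fq K M (L ^ n)),
        map_sub (toSeries K) e]
      linear_combination hrel

end FunctionalEquations

section Growth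

open scoped PowerSeries

open Filter Topology

variable {Fq : Type*} [Field Fq] [Fintype Fq] {K : Type*} [NormedField K]

theorem powSum_zero [Algebra Fq K] (θ : K) (s : ℕ) : powSum Fq θ 0 s = 1 := by
  have : monics Fq 0 = {1} := by
    ext a
    simp only [mem_monics, Finset.mem_singleton]
    exact ⟨fun h => (Monic.natDegree_eq_zero h.1).1 h.2, fun h => by simp [h]⟩
  simp [powSum, this]

variable [IsUltrametricDist K]

theorem norm_ell {θ : K} (hθ : 1 < ‖θ‖) (d : ℕ) :
    ‖ell Fq θ d‖ = ‖θ‖ ^ ∑ i ∈ Finset.range d, Fintype.card Fq ^ (i + 1) := by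
  rw [ell, norm_prod, ← Finset.prod_pow_eq_pow_sum]
  refine Finset.prod_congr rfl fun i _ => ?_
  have h1 : ‖θ‖ < ‖θ ^ Fintype.card Fq ^ (i + 1)‖ := by
    rw [norm_pow]
    exact lt_self_pow₀ hθ (Nat.one_lt_pow (by omega) (two_le_card Fq))
  rw [sub_eq_add_neg, IsUltrametricDist.norm_add_eq_max_of_norm_ne_norm
    (by rw [norm_neg]; exact h1.ne), norm_neg, max_eq_right h1.le, norm_pow]

variable [Algebra Fq K]

theorem norm_powSum_le {θ : K} (hθ : 1 < ‖θ‖) (d s : ℕ) :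
    ‖powSum Fq θ d s‖ ≤ (‖θ‖⁻¹ ^ s) ^ d := by
  refine IsUltrametricDist.norm_sum_le_of_forall_le_of_nonneg (by positivity) fun a ha => ?_
  rw [mem_monics] at ha
  rw [norm_inv, norm_pow, norm_aeval hθ ha.1.ne_zero, ha.2, inv_pow, inv_pow, ← pow_mul, ← pow_mul,
    mul_comm]

theorem norm_powSum_lt_one {θ : K} (hθ : 1 < ‖θ‖) {d s : ℕ} (hd : d ≠ 0) (hs : s ≠ 0) :
    ‖powSum Fq θ d s‖ < 1 :=
  (norm_powSum_le hθ d s).trans_lt (pow_lt_one₀ (by positivity)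
    (pow_lt_one₀ (by positivity) (inv_lt_one_of_one_lt₀ hθ) hs) hd)

theorem norm_sum_powSum {θ : K} (hθ : 1 < ‖θ‖) {s : ℕ} (hs : s ≠ 0) (d : ℕ) :
    ‖∑ i ∈ Finset.range (d + 1), powSum Fq θ i s‖ = 1 := by
  induction d with
  | zero => simp [powSum_zero]
  | succ d ih =>
    have h := norm_powSum_lt_one (Fq := Fq) hθ d.succ_ne_zero hs
    rw [Finset.sum_range_succ, IsUltrametricDist.norm_add_eq_max_of_norm_ne_norm
      (by rw [ih]; exact h.ne'), ih, max_eq_left h.le]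

theorem zeta_ne_zero {θ : K} (hθ : 1 < ‖θ‖) {s : ℕ} (hs : s ≠ 0) {u : K}
    (hu : HasSum (fun d => powSum Fq θ d s) u) : u ≠ 0 := by
  have h1 := ((tendsto_add_atTop_iff_nat 1).2 hu.tendsto_sum_nat).norm
  simp only [norm_sum_powSum hθ hs] at h1
  rintro rfl
  rw [norm_zero] at h1
  exact zero_ne_one (tendsto_nhds_unique h1 tendsto_const_nhds)

/-- The values at `θ` of the twists of a polynomial grow according to its largest coefficient. -/
theorem exists_norm_eval_ptw {θ : K} (hθ : 1 < ‖θ‖) {x : K[X]} (hx : x ≠ 0) :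
    ∃ i₀, x.coeff i₀ ≠ 0 ∧ ∀ᶠ d : ℕ in atTop,
      ‖(ptw Fq K d x).eval θ‖ = ‖x.coeff i₀‖ ^ Fintype.card Fq ^ d * ‖θ‖ ^ i₀ := by
  classical
  have hθ0 : 0 < ‖θ‖ := by linarith
  obtain ⟨k₀, hk₀, hmax⟩ := Finset.exists_max_image x.support (fun i => ‖x.coeff i‖)
    (support_nonempty.2 hx)
  have hne : (x.support.filter fun i => ‖x.coeff i‖ = ‖x.coeff k₀‖).Nonempty :=
    ⟨k₀, Finset.mem_filter.2 ⟨hk₀, rfl⟩⟩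
  set i₀ := Finset.max' _ hne with hi₀
  have hmem := Finset.max'_mem _ hne
  rw [← hi₀, Finset.mem_filter] at hmem
  have hi₀0 : x.coeff i₀ ≠ 0 := mem_support_iff.1 hmem.1
  set ξ := ‖x.coeff i₀‖ with hξ
  have hξ0 : 0 < ξ := norm_pos_iff.2 hi₀0
  have hle : ∀ i ∈ x.support, ‖x.coeff i‖ ≤ ξ := fun i hi => (hmax i hi).trans_eq hmem.2.symm
  have hlt : ∀ i ∈ x.support, i₀ < i → ‖x.coeff i‖ < ξ := fun i hi hlt => by
    refine lt_of_le_of_ne (hle i hi) fun h => ?_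
    exact hlt.not_ge (Finset.le_max' _ _ (Finset.mem_filter.2 ⟨hi, h.trans hmem.2⟩))
  have hqd : Tendsto (fun d : ℕ => Fintype.card Fq ^ d) atTop atTop :=
    tendsto_pow_atTop_atTop_of_one_lt (two_le_card Fq)
  have hterm : ∀ i ∈ x.support, i ≠ i₀ → ∀ᶠ d : ℕ in atTop,
      ‖x.coeff i‖ ^ Fintype.card Fq ^ d * ‖θ‖ ^ i < ξ ^ Fintype.card Fq ^ d * ‖θ‖ ^ i₀ := by
    intro i hi hii
    rcases lt_or_gt_of_ne hii with h | h
    · refine Eventually.of_forall fun d => ?_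
      exact mul_lt_mul' (pow_le_pow_left₀ (norm_nonneg _) (hle i hi) _)
        (pow_lt_pow_right₀ hθ h) (by positivity) (by positivity)
    · have h1 : ‖x.coeff i‖ / ξ < 1 := (div_lt_one hξ0).2 (hlt i hi h)
      have h2 := ((tendsto_pow_atTop_nhds_zero_of_lt_one (by positivity) h1).comp hqd).mul_const
        (‖θ‖ ^ i)
      rw [zero_mul] at h2
      filter_upwards [h2.eventually_lt_const (show 0 < ‖θ‖ ^ i₀ by positivity)] with d hd
      simp only [Function.comp_apply, div_pow] at hd
      rw [div_mul_eq_mul_div, div_lt_iff₀ (by positivity)] at hd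
      linarith
  have hall : ∀ᶠ d : ℕ in atTop, ∀ i ∈ x.support.erase i₀,
      ‖x.coeff i‖ ^ Fintype.card Fq ^ d * ‖θ‖ ^ i < ξ ^ Fintype.card Fq ^ d * ‖θ‖ ^ i₀ :=
    (Filter.eventually_all_finset _).2 fun i hi =>
      hterm i (Finset.mem_of_mem_erase hi) (Finset.ne_of_mem_erase hi)
  refine ⟨i₀, hi₀0, hall.mono fun d hd => ?_⟩
  have hev : (ptw Fq K d x).eval θ =
      ∑ i ∈ x.support, x.coeff i ^ Fintype.card Fq ^ d * θ ^ i := by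
    rw [ptw, coe_mapRingHom, eval_map, eval₂_eq_sum, sum_def]
    simp only [frob_apply]
  rw [hev, ← Finset.add_sum_erase _ _ hmem.1]
  have hmain : ‖x.coeff i₀ ^ Fintype.card Fq ^ d * θ ^ i₀‖ =
      ξ ^ Fintype.card Fq ^ d * ‖θ‖ ^ i₀ := by rw [norm_mul, norm_pow, norm_pow]
  have hrest : ‖∑ i ∈ x.support.erase i₀, x.coeff i ^ Fintype.card Fq ^ d * θ ^ i‖ <
      ξ ^ Fintype.card Fq ^ d * ‖θ‖ ^ i₀ := by
    rcases (x.support.erase i₀).eq_empty_or_nonempty with he | he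
    · rw [he, Finset.sum_empty, norm_zero]
      positivity
    · obtain ⟨i, hi, hle'⟩ := IsUltrametricDist.exists_norm_finsetSum_le_of_nonempty he
        fun i => x.coeff i ^ Fintype.card Fq ^ d * θ ^ i
      refine hle'.trans_lt ?_
      rw [norm_mul, norm_pow, norm_pow]
      exact hd i hi
  rw [IsUltrametricDist.norm_add_eq_max_of_norm_ne_norm (by rw [hmain]; exact hrest.ne'), hmain,
    max_eq_left hrest.le]

theorem eval_ne_zero_of_fixed {θ : K} (hθ : 1 < ‖θ‖) {p : K[X]} (hp : ptw Fq K 1 p = p)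
    (h0 : p ≠ 0) : p.eval θ ≠ 0 := by
  have h1 := norm_eval_of_norm_coeff hθ (p := p) (fun i hi =>
    norm_eq_one_of_pow_card (Fq := Fq) hi (by
      have := coeff_ptw (Fq := Fq) 1 i p
      rw [hp, pow_one] at this
      exact this.symm)) h0
  rw [← norm_pos_iff, h1]
  have : 0 < ‖θ‖ := by linarith
  positivity

/-- A polynomial solution of the inhomogeneous Frobenius equation of weight `s` exists only if
`q - 1` divides `s`. -/
theorem card_sub_one_dvd_of_frobenius_eq {θ : K} (hθ : 1 < ‖θ‖)
    (hval : ∀ z : K, z ≠ 0 → ∃ m : ℤ, ‖z‖ = ‖θ‖ ^ m) {s : ℕ} (hs : s ≠ 0) {x c h : K[X]}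
    (hc : ptw Fq K 1 c = c) (hc0 : c ≠ 0) {γ : K} (hγ : γ ≠ 0)
    (hh : ∀ d, (ptw Fq K d h).eval θ = γ * (powSum Fq θ d s * ell Fq θ d ^ s))
    (hx : ptw Fq K 1 x = (X - C (θ ^ Fintype.card Fq)) ^ s * (x + c * h)) :
    Fintype.card Fq - 1 ∣ s := by
  have hq := two_le_card Fq
  have hθ0 : 0 < ‖θ‖ := by linarith
  have hx0 := eval_eq_zero_of_frobenius_eq hs hx
  set A := ‖c.eval θ * γ‖ with hA
  have hA0 : 0 < A := norm_pos_iff.2 (mul_ne_zero (eval_ne_zero_of_fixed hθ hc hc0) hγ)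
  have hev : ∀ d, ‖(ptw Fq K (d + 1) x).eval θ‖ = ‖ell Fq θ (d + 1)‖ ^ s * A := by
    intro d
    have h1 := hasEv_tw_of_frobenius_eq (Fq := Fq) (n := s) (U := toSeries K (-x))
      (a := toSeries K (c * h)) hθ (by
        rw [tw_toSeries, map_neg, hx, ← map_sub, ← map_mul]
        congr 1
        ring) (hasEv_toSeries θ _) (v := fun d => c.eval θ * (ptw Fq K d h).eval θ) (fun d => by
        rw [tw_toSeries, map_mul, ptw_eq_self hc]
        simpa using hasEv_toSeries θ (c * ptw Fq K d h)) (d + 1)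
    rw [tw_toSeries] at h1
    have h2 := (hasEv_toSeries _ _).unique h1
    rw [map_neg, eval_neg, eval_neg, hx0, neg_zero, zero_sub, mul_neg, neg_inj] at h2
    have h3 : ∀ i ∈ Finset.range (d + 1),
        c.eval θ * (ptw Fq K i h).eval θ / ell Fq θ i ^ s =
        c.eval θ * γ * powSum Fq θ i s := fun i _ => by
      have := ell_ne_zero (Fq := Fq) hθ i
      rw [hh]
      field_simp
    rw [h2, Finset.sum_congr rfl h3, ← Finset.mul_sum, norm_mul, norm_mul _ (Finset.sum _ _),
      norm_sum_powSum hθ hs, mul_one, norm_pow]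
  have hxne : x ≠ 0 := by
    rintro rfl
    have h1 := hev 0
    rw [map_zero, eval_zero, norm_zero] at h1
    have h2 : 0 < ‖ell Fq θ (0 + 1)‖ := norm_pos_iff.2 (ell_ne_zero hθ _)
    have h3 : 0 < ‖ell Fq θ (0 + 1)‖ ^ s * A := by positivity
    linarith
  obtain ⟨i₀, hi₀, hgrow⟩ := exists_norm_eval_ptw (Fq := Fq) hθ hxne
  obtain ⟨d, hd⟩ := eventually_atTop.1 hgrow
  have h1 := hd (d + 1) (by omega)
  have h2 := hd (d + 1 + 1) (by omega)
  rw [hev, norm_ell hθ] at h1 h2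
  obtain ⟨m, hm⟩ := hval _ hi₀
  rw [Finset.sum_range_succ, pow_add, mul_pow] at h2
  set T := (‖θ‖ ^ ∑ i ∈ Finset.range (d + 1), Fintype.card Fq ^ (i + 1)) ^ s with hT
  have hT0 : 0 < T := by positivity
  set q := Fintype.card Fq with hqdef
  set ξ := ‖x.coeff i₀‖ with hξ
  have hξ0 : 0 < ξ := norm_pos_iff.2 hi₀
  have h3 : (ξ ^ (q - 1)) ^ q ^ (d + 1) = (‖θ‖ ^ (q * s)) ^ q ^ (d + 1) := by
    have h4 : ξ ^ q ^ (d + 1 + 1) = (ξ ^ (q - 1)) ^ q ^ (d + 1) * ξ ^ q ^ (d + 1) := by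
      rw [← pow_mul, ← pow_add]
      congr 1
      obtain ⟨r, hr⟩ : ∃ r, q = r + 1 := ⟨q - 1, by omega⟩
      rw [hr, Nat.add_sub_cancel]
      ring
    rw [h4, mul_assoc, mul_assoc _ _ (‖θ‖ ^ i₀), ← h1] at h2
    apply mul_right_cancel₀ (mul_pos hT0 hA0).ne'
    rw [← h2, ← pow_mul, ← pow_mul]
    ring
  have h4 : ξ ^ (q - 1) = ‖θ‖ ^ (q * s) :=
    (pow_left_inj₀ (by positivity) (by positivity) (Nat.pow_pos (by omega)).ne').1 h3
  rw [hm, ← zpow_natCast, ← zpow_natCast, ← zpow_mul] at h4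
  have h5 := zpow_right_injective₀ hθ0 hθ.ne' h4
  have h6 : q - 1 ∣ q * s := by
    rw [← Int.natCast_dvd_natCast]
    exact ⟨m, by rw [← h5, mul_comm]⟩
  refine (Nat.Coprime.dvd_of_dvd_mul_left ?_ h6)
  rw [Nat.coprime_self_sub_left (by omega)]
  exact Nat.coprime_one_left _

end Growth

section SlowRelations

variable {Fq : Type*} [Field Fq] [Fintype Fq]

theorem exists_natDegree_twEval_le (p : Fq[X][X]) :
    ∃ A, ∀ d, (twEval Fq d 1 p).natDegree ≤ A * Fintype.card Fq ^ d := by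
  obtain ⟨e, he⟩ := exists_coeffDegLE p
  refine ⟨e + p.natDegree, fun d => (he.natDegree_twEval_le d 1).trans ?_⟩
  have : 1 ≤ Fintype.card Fq ^ d := Nat.one_le_pow _ _ Fintype.card_pos
  nlinarith

theorem natDegree_sub_pow_le (d s : ℕ) :
    ((X - X ^ Fintype.card Fq ^ (d + 1) : Fq[X]) ^ s).natDegree ≤
      s * Fintype.card Fq ^ (d + 1) := by
  refine natDegree_pow_le_of_le _ ((natDegree_sub_le _ _).trans (max_le ?_ (natDegree_X_pow_le _)))
  exact natDegree_X_le.trans (Nat.one_le_pow _ _ Fintype.card_pos)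

variable {K : Type*} [Field K] [Algebra Fq K]

/-- The twisted values of a solution of the second-order equation that vanishes at `θ` are
combinations of the values of the first-order solutions with slowly growing coefficients. -/
theorem exists_slow_relations (θ : K) {n : ℕ} {S : Finset ℕ} (hSn : ∀ j ∈ S, j ≤ n)
    (a : Fq[X][X]) (p h : ℕ → Fq[X][X]) {W : ℕ → K} {V : ℕ → ℕ → K} (hW0 : W 0 = 0)
    (hW : ∀ ν, W (ν + 1) = (θ - θ ^ Fintype.card Fq ^ (ν + 1)) ^ n *
      (W ν - (aeval θ (twEval Fq ν 1 a) + ∑ j ∈ S, aeval θ (twEval Fq ν 1 (p j)) *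
        (V ν (n - j) - aeval θ (twEval Fq ν 1 (h (n - j)))))))
    (hV : ∀ ν s, V (ν + 1) s = (θ - θ ^ Fintype.card Fq ^ (ν + 1)) ^ s *
      (V ν s - aeval θ (twEval Fq ν 1 (h s)))) :
    ∃ C : ℕ, ∀ ν, ∃ (x : ℕ → Fq[X]) (y : Fq[X]),
      (∀ j ∈ S, (x j).natDegree ≤ C * Fintype.card Fq ^ ν) ∧
      y.natDegree ≤ C * Fintype.card Fq ^ ν ∧
      W ν = ∑ j ∈ S, aeval θ (x j) * V ν (n - j) + aeval θ y := by
  have hq := two_le_card Fq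
  set q := Fintype.card Fq with hqdef
  choose A hA using fun p : Fq[X][X] => exists_natDegree_twEval_le p
  set B := A a + ∑ j ∈ S, (A (p j) + A (h (n - j))) with hBdef
  have hB : ∀ j ∈ S, A (p j) + A (h (n - j)) ≤ B := fun j hj =>
    (Finset.single_le_sum (f := fun j => A (p j) + A (h (n - j)))
      (fun _ _ => Nat.zero_le _) hj).trans (Nat.le_add_left _ _)
  have key : ∀ ν, ∃ (x : ℕ → Fq[X]) (y : Fq[X]),
      (∀ j ∈ S, (x j).natDegree ≤ (B + 2 * n) * q ^ ν) ∧
      y.natDegree ≤ (2 * B + 4 * n) * q ^ ν ∧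
      W ν = ∑ j ∈ S, aeval θ (x j) * V ν (n - j) + aeval θ y := by
    intro ν
    induction ν with
    | zero => exact ⟨0, 0, by simp, by simp, by simp [hW0]⟩
    | succ ν ih =>
      obtain ⟨x, y, hx, hy, hxy⟩ := ih
      have hqν : q ^ (ν + 1) = q * q ^ ν := pow_succ' _ _
      have hpos : 1 ≤ q ^ ν := Nat.one_le_pow _ _ (by omega)
      refine ⟨fun j => (X - X ^ q ^ (ν + 1)) ^ j * (x j - twEval Fq ν 1 (p j)),
        (X - X ^ q ^ (ν + 1)) ^ n * (y - twEval Fq ν 1 a +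
          ∑ j ∈ S, x j * twEval Fq ν 1 (h (n - j))), fun j hj => ?_, ?_, ?_⟩
      · have h1 : (x j - twEval Fq ν 1 (p j)).natDegree ≤ (B + 2 * n) * q ^ ν := by
          refine (natDegree_sub_le _ _).trans (max_le (hx j hj) ((hA _ _).trans ?_))
          exact Nat.mul_le_mul_right _ (by have := hB j hj; omega)
        refine (natDegree_mul_le_of_le (natDegree_sub_pow_le ν j) h1).trans ?_
        rw [← hqdef, hqν]
        have h2 := hSn j hj
        calc j * (q * q ^ ν) + (B + 2 * n) * q ^ ν = (j * q + (B + 2 * n)) * q ^ ν := by ring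
          _ ≤ ((B + 2 * n) * q) * q ^ ν := Nat.mul_le_mul_right _ (by nlinarith)
          _ = _ := by ring
      · have h1 : (y - twEval Fq ν 1 a + ∑ j ∈ S, x j * twEval Fq ν 1 (h (n - j))).natDegree ≤
            (2 * B + 4 * n) * q ^ ν := by
          refine natDegree_add_le_of_degree_le
            ((natDegree_sub_le _ _).trans (max_le hy ((hA _ _).trans ?_)))
            (natDegree_sum_le_of_forall_le _ _ fun j hj =>
              (natDegree_mul_le_of_le (hx j hj) (hA _ _)).trans ?_)
          · exact Nat.mul_le_mul_right _ (by omega)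
          · rw [← hqdef, ← add_mul]
            exact Nat.mul_le_mul_right _ (by have := hB j hj; omega)
        refine (natDegree_mul_le_of_le (natDegree_sub_pow_le ν n) h1).trans ?_
        rw [← hqdef, hqν]
        calc n * (q * q ^ ν) + (2 * B + 4 * n) * q ^ ν
            = (n * q + (2 * B + 4 * n)) * q ^ ν := by ring
          _ ≤ ((2 * B + 4 * n) * q) * q ^ ν := Nat.mul_le_mul_right _ (by nlinarith)
          _ = _ := by ring
      · have h1 : ∀ j ∈ S, aeval θ ((X - X ^ q ^ (ν + 1)) ^ j * (x j - twEval Fq ν 1 (p j))) *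
            V (ν + 1) (n - j) = (θ - θ ^ q ^ (ν + 1)) ^ n * (aeval θ (x j) * V ν (n - j)) -
            (θ - θ ^ q ^ (ν + 1)) ^ n * (aeval θ (x j * twEval Fq ν 1 (h (n - j)))) -
            (θ - θ ^ q ^ (ν + 1)) ^ n * (aeval θ (twEval Fq ν 1 (p j)) *
              (V ν (n - j) - aeval θ (twEval Fq ν 1 (h (n - j))))) := fun j hj => by
          rw [hV, ← pow_sub_mul_pow _ (hSn j hj)]
          simp only [map_mul, map_sub, map_pow, aeval_X]
          ring
        rw [Finset.sum_congr rfl h1, Finset.sum_sub_distrib, Finset.sum_sub_distrib,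
          ← Finset.mul_sum, ← Finset.mul_sum, ← Finset.mul_sum, hW, hxy, map_mul, map_add,
          map_sum, map_pow, map_sub, map_sub, map_pow, aeval_X]
        ring
  refine ⟨2 * B + 4 * n, fun ν => ?_⟩
  obtain ⟨x, y, hx, hy, hxy⟩ := key ν
  exact ⟨x, y, fun j hj => (hx j hj).trans (Nat.mul_le_mul_right _ (by omega)), hy, hxy⟩

end SlowRelations

section Relation

open scoped PowerSeries

variable {Fq : Type*} [Field Fq] {K : Type*} [NormedField K] [Algebra Fq K]

theorem spec_X_sub_C_pow (θ : K) (q s : ℕ) :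
    spec Fq θ ((X - C (X ^ q)) ^ s) = (X - C (θ ^ q)) ^ s := by
  simp [spec]

variable [Fintype Fq]

theorem hasEv_tw_succ {θ : K} {s ν : ℕ} {U a : K⟦X⟧}
    (hU : tw Fq K 1 U = toSeries K ((X - C (θ ^ Fintype.card Fq)) ^ s) * (U - a))
    {u v : K} (hu : HasEv θ (tw Fq K ν U) u) (hv : HasEv θ (tw Fq K ν a) v) :
    HasEv θ (tw Fq K (ν + 1) U) ((θ - θ ^ Fintype.card Fq ^ (ν + 1)) ^ s * (u - v)) := by
  have h1 := congrArg (tw Fq K ν) hU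
  rw [tw_tw, map_mul, map_sub, tw_toSeries, map_pow, ptw_X_sub_C, ← pow_mul, ← pow_succ'] at h1
  rw [h1]
  convert (hu.sub hv).poly_mul _ using 2
  rw [eval_pow, eval_sub, eval_X, eval_C]

theorem hasEv_tw_spec (θ : K) (ν : ℕ) (p : Fq[X][X]) :
    HasEv θ (tw Fq K ν (toSeries K (spec Fq θ p))) (aeval θ (twEval Fq ν 1 p)) := by
  rw [tw_toSeries, ← eval_ptw_spec, pow_one]
  exact hasEv_toSeries _ _

variable [IsUltrametricDist K] [CompleteSpace K]

/-- If a solution of the second-order Frobenius equation vanishes at `θ`, then a twist of it is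
dependent, over the polynomials, on `1` and the twists of the first-order solutions. -/
theorem exists_tw_relation_of_hasEv_zero {θ : K} (hθ : 1 < ‖θ‖) {n : ℕ} {S : Finset ℕ}
    (hSn : ∀ j ∈ S, j ≤ n) {h p : ℕ → Fq[X][X]} {a : Fq[X][X]} {g : ℕ → K⟦X⟧} {F : K⟦X⟧}
    (hg : ∀ s, tw Fq K 1 (g s) = toSeries K ((X - C (θ ^ Fintype.card Fq)) ^ s) *
      (g s - toSeries K (spec Fq θ (h s))))
    (hF : tw Fq K 1 F = toSeries K ((X - C (θ ^ Fintype.card Fq)) ^ n) *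
      (F - (toSeries K (spec Fq θ a) + ∑ j ∈ S, toSeries K (spec Fq θ (p j)) *
        (g (n - j) - toSeries K (spec Fq θ (h (n - j)))))))
    (hgB : ∀ s, ∃ B, Bdd (‖θ‖ ^ Fintype.card Fq) B (g s))
    (hFB : ∃ B, Bdd (‖θ‖ ^ Fintype.card Fq) B F) (hF0 : HasEv θ F 0) :
    ∃ (M : ℕ) (p e : K[X]) (b : ℕ → K[X]), (p ≠ 0 ∨ (∃ j ∈ S, b j ≠ 0) ∨ e ≠ 0) ∧
      toSeries K p * tw Fq K M F + ∑ j ∈ S, toSeries K (b j) * tw Fq K M (g (n - j)) +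
        toSeries K e = 0 := by
  classical
  have hq := two_le_card Fq
  set q := Fintype.card Fq with hqdef
  have hev : ∀ {f : K⟦X⟧}, (∃ B, Bdd (‖θ‖ ^ q) B f) → ∀ ν, ∃ v, HasEv θ (tw Fq K ν f) v := by
    rintro f ⟨B, hB⟩ ν
    refine (hB.tw (Fq := Fq) (by positivity) ν).exists_hasEv ?_
    rw [← pow_mul]
    refine lt_self_pow₀ hθ ?_
    calc 1 < q * 1 := by omega
      _ ≤ _ := Nat.mul_le_mul_left _ (Nat.one_le_pow _ _ (by omega))
  choose V' hV' using fun s => hev (hgB s)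
  choose W hW using hev hFB
  set V : ℕ → ℕ → K := fun ν s => V' s ν with hVdef
  have hV : ∀ ν s, HasEv θ (tw Fq K ν (g s)) (V ν s) := fun ν s => hV' s ν
  have hW0 : W 0 = 0 := (hW 0).unique (by simpa using hF0)
  obtain ⟨C₀, hC₀⟩ := exists_slow_relations (Fq := Fq) θ hSn a p h hW0
    (fun ν => (hW (ν + 1)).unique (hasEv_tw_succ hF (hW ν) (by
      rw [map_add, map_sum]
      refine (hasEv_tw_spec θ ν a).add (HasEv.sum fun j _ => ?_)
      rw [map_mul, map_sub, tw_toSeries, ← eval_ptw_spec θ ν 1 (p j), pow_one]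
      exact ((hV ν _).sub (hasEv_tw_spec θ ν _)).poly_mul _)))
    (fun ν s => (hV (ν + 1) s).unique (hasEv_tw_succ (hg s) (hV ν s) (hasEv_tw_spec θ ν _)))
  choose x y hx hy hxy using hC₀
  choose Bg hBg using hgB
  obtain ⟨BF, hBF⟩ := hFB
  have hθq : ‖θ‖ ≤ ‖θ‖ ^ q := le_self_pow₀ hθ.le (by omega)
  set L : Fq[X][X] := X - C (X ^ q) with hL
  set f : Option (Option S) → K⟦X⟧ := fun i => i.elim F fun i => i.elim 1 fun j => g (n - j)
    with hf
  set Φ : Option (Option S) → Option (Option S) → Fq[X][X] := fun i => i.elim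
    (fun i' => i'.elim (L ^ n) fun i' => i'.elim
      (-(L ^ n * (a - ∑ j ∈ S, p j * h (n - j)))) fun j => -(L ^ n * p j))
    fun i => i.elim
      (fun i' => i'.elim 0 fun i' => i'.elim 1 fun _ => 0)
      fun j i' => i'.elim 0 fun i' => i'.elim (-(L ^ (n - j) * h (n - j)))
        fun j' => if j = j' then L ^ (n - j) else 0 with hΦ
  obtain ⟨M, P, hP, hrel⟩ := exists_relation_of_values (Fq := Fq) hθ (f := f) (Φ := Φ)
    (B := max BF (max 1 (∑ j ∈ S, Bg (n - j))))
    (w := fun ν i => i.elim (W ν) fun i => i.elim 1 fun j => V ν (n - j))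
    (x := fun ν i => i.elim (y ν) fun j => x ν j) (C := C₀)
    (by
      rintro (_ | _ | j)
      · simp only [hf, hΦ, Fintype.sum_option, Option.elim, hF, Finset.sum_coe_sort S
          (fun j => toSeries K (spec Fq θ (-(L ^ n * p j))) * g (n - j))]
        simp only [map_neg, map_mul, map_sub, map_sum, hL, spec_X_sub_C_pow]
        simp only [mul_sub, mul_add, Finset.mul_sum, Finset.sum_sub_distrib, neg_mul,
          Finset.sum_neg_distrib, mul_one, map_pow, ← mul_assoc]
        ring
      · simp [hf, hΦ]
      · simp only [hf, hΦ, Fintype.sum_option, Option.elim, hg]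
        simp only [apply_ite (spec Fq θ), apply_ite (toSeries K), map_zero, ite_mul, zero_mul,
          Finset.sum_ite_eq, Finset.mem_univ, if_true, map_neg, map_mul]
        rw [hL, spec_X_sub_C_pow]
        ring)
    (by
      rintro (_ | _ | j)
      · exact (hBF.anti (norm_nonneg _) hθq).mono (le_max_left _ _)
      · exact bdd_one.mono ((le_max_left _ _).trans (le_max_right _ _))
      · refine ((hBg _).anti (norm_nonneg _) hθq).mono
          (le_trans ?_ ((le_max_right _ _).trans (le_max_right _ _)))
        exact Finset.single_le_sum (f := fun j => Bg (n - j)) (fun j _ => (hBg _).nonneg) j.2)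
    (by
      rintro ν (_ | _ | j)
      · exact hW ν
      · simpa [hf] using hasEv_toSeries θ (1 : K[X])
      · exact hV ν _)
    (by
      rintro ν (_ | j)
      · exact hy ν
      · exact hx ν j j.2)
    (fun ν => by
      simp only [Fintype.sum_option, Option.elim, mul_one, Finset.sum_coe_sort S
          (fun j => aeval θ (x ν j) * V ν (n - j))]
      rw [hxy, add_comm])
  refine ⟨M, P none, P (some none),
    fun j => if hj : j ∈ S then P (some (some ⟨j, hj⟩)) else 0, ?_, ?_⟩
  · by_contra! h0
    refine hP (funext ?_)
    rintro (_ | _ | j)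
    · exact h0.1
    · exact h0.2.2
    · simpa using h0.2.1 j j.2
  · rw [← hrel, Fintype.sum_option, Fintype.sum_option, ← Finset.sum_coe_sort S]
    simp only [hf, Option.elim, map_one, mul_one, Subtype.coe_eta, Finset.coe_mem, dif_pos]
    ring

end Relation

section Abstract

open scoped PowerSeries

variable {Fq : Type*} [Field Fq] [Fintype Fq] {K : Type*} [NormedField K] [Algebra Fq K]
  [IsUltrametricDist K]

theorem CoeffDegLE.bdd_spec_one {θ : K} (hθ : 1 < ‖θ‖) {τ : ℝ} (hτ : 1 < τ)
    (hτθ : τ ^ (Fintype.card Fq - 1) = ‖θ‖ ^ Fintype.card Fq) {s e : ℕ} (hs : 1 ≤ s)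
    {p : Fq[X][X]} (hp : CoeffDegLE p e)
    (he : (Fintype.card Fq - 1) * e ≤ Fintype.card Fq * (s - 1)) :
    Bdd 1 (τ ^ s / τ) (toSeries K (spec Fq θ p)) := by
  have hq := two_le_card Fq
  refine (hp.bdd_spec hθ le_rfl le_rfl).mono ?_
  obtain ⟨s, rfl⟩ : ∃ t, s = t + 1 := ⟨s - 1, by omega⟩
  rw [one_pow, mul_one, pow_succ, mul_div_cancel_right₀ _ (by positivity)]
  refine (pow_le_pow_iff_left₀ (by positivity) (by positivity)
    (show Fintype.card Fq - 1 ≠ 0 by omega)).1 ?_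
  rw [← pow_mul, ← pow_mul, mul_comm s, pow_mul τ, hτθ, ← pow_mul]
  exact pow_le_pow_right₀ hθ.le (by rw [mul_comm e]; exact he)

variable [CompleteSpace K]

/-- The deformation series of the Carlitz zeta values of weight at most `n`. -/
theorem exists_zeta_series {θ : K} (hθ : 1 < ‖θ‖) {τ : ℝ} (hτ : 1 < τ)
    (hτθ : τ ^ (Fintype.card Fq - 1) = ‖θ‖ ^ Fintype.card Fq) (n : ℕ) {Z : ℕ → K}
    (hZ : ∀ s, 1 ≤ s → HasSum (fun d => powSum Fq θ d s) (Z s)) :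
    ∃ (Γ : Fq[X]) (h : ℕ → Fq[X][X]) (g : ℕ → K⟦X⟧), Γ ≠ 0 ∧
      (∀ s, ∃ e, CoeffDegLE (h s) e ∧ (Fintype.card Fq - 1) * e ≤ Fintype.card Fq * (s - 1)) ∧
      (∀ s, 1 ≤ s → s ≤ n → ∀ d, aeval θ (twEval Fq d 1 (h s)) =
        aeval θ Γ * (powSum Fq θ d s * ell Fq θ d ^ s)) ∧
      (∀ s, tw Fq K 1 (g s) = toSeries K ((X - C (θ ^ Fintype.card Fq)) ^ s) *
        (g s - toSeries K (spec Fq θ (h s)))) ∧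
      (∀ s, Bdd 1 (τ ^ s / τ) (g s)) ∧ (∀ s, ∃ B, Bdd (‖θ‖ ^ Fintype.card Fq) B (g s)) ∧
      ∀ s, 1 ≤ s → s ≤ n → ∀ d, HasEv θ (tw Fq K d (g s))
        (aeval θ Γ * (ell Fq θ d ^ s * (Z s - ∑ i ∈ Finset.range d, powSum Fq θ i s))) := by
  classical
  obtain ⟨Γ, hΓ, hΓh⟩ := exists_andersonThakur (Fq := Fq) hθ n
  choose! h₁ he hh using hΓh
  set h : ℕ → Fq[X][X] := fun s => if 1 ≤ s ∧ s ≤ n then h₁ s else 0 with hdef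
  have hin : ∀ s, 1 ≤ s → s ≤ n → h s = h₁ s := fun s h1 h2 => if_pos ⟨h1, h2⟩
  have hdeg : ∀ s, ∃ e, CoeffDegLE (h s) e ∧
      (Fintype.card Fq - 1) * e ≤ Fintype.card Fq * (s - 1) := fun s => by
    by_cases hs : 1 ≤ s ∧ s ≤ n
    · rw [hin s hs.1 hs.2]
      exact he s hs.1 hs.2
    · exact ⟨0, by simpa [hdef, hs] using coeffDegLE_zero 0, by simp⟩
  have hB : ∀ s, Bdd 1 (τ ^ s / τ) (toSeries K (spec Fq θ (h s))) := fun s => by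
    rcases Nat.eq_zero_or_pos s with rfl | hs
    · simpa [hdef] using bdd_zero (by positivity)
    · obtain ⟨e, h1, h2⟩ := hdeg s
      exact h1.bdd_spec_one hθ hτ hτθ hs h2
  choose B' hB' using fun s => exists_bdd_toSeries (ρ := ‖θ‖ ^ Fintype.card Fq) (by positivity)
    (spec Fq θ (h s))
  choose g hg1 hg2 hg3 hg4 using fun s => exists_frobenius_solution (Fq := Fq) hθ hτ hτθ s
    (hB s) (hB' s)
  have hval : ∀ s, 1 ≤ s → s ≤ n → ∀ d, aeval θ (twEval Fq d 1 (h s)) =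
        aeval θ Γ * (powSum Fq θ d s * ell Fq θ d ^ s) := fun s h1 h2 d => by
    rw [hin s h1 h2, hh s h1 h2]
  refine ⟨Γ, h, g, hΓ, hdeg, hval, hg3, hg1, fun s => ⟨_, hg2 s⟩, fun s h1 h2 d => ?_⟩
  have hdiv : ∀ d, aeval θ (twEval Fq d 1 (h s)) / ell Fq θ d ^ s =
      aeval θ Γ * powSum Fq θ d s := fun d => by
    have := ell_ne_zero (Fq := Fq) hθ d
    rw [hval s h1 h2]
    field_simp
  obtain ⟨u, hu, hsum⟩ := hg4 s _ fun d => hasEv_tw_spec θ d (h s)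
  simp only [hdiv] at hsum
  obtain rfl := hsum.unique ((hZ s h1).mul_left _)
  have := hasEv_tw_of_frobenius_eq hθ (hg3 s) hu (fun d => hasEv_tw_spec θ d (h s)) d
  simp only [hdiv, ← Finset.mul_sum] at this
  convert this using 1
  ring

/-- Vanishing of an `A`-linear combination of `ζ(n)` and of the double zeta values `ζ(n - j, j)`,
written as a series over the degree of the second argument. -/
theorem eq_zero_of_hasSum_zero {θ : K} (hθ : 1 < ‖θ‖)
    (hv : ∀ z : K, z ≠ 0 → ∃ m : ℤ, ‖z‖ = ‖θ‖ ^ m) {n : ℕ} (hn : 1 ≤ n) {S : Finset ℕ}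
    (hS : ∀ j ∈ S, 0 < j ∧ j < n ∧ ¬ (Fintype.card Fq - 1) ∣ j) {Z : ℕ → K}
    (hZ : ∀ s, 1 ≤ s → HasSum (fun d => powSum Fq θ d s) (Z s)) (c₀ : Fq[X]) (c : ℕ → Fq[X])
    (hrel : HasSum (fun d => aeval θ c₀ * powSum Fq θ d n + ∑ j ∈ S, aeval θ (c j) *
      (powSum Fq θ d j * (Z (n - j) - ∑ i ∈ Finset.range (d + 1), powSum Fq θ i (n - j)))) 0) :
    c₀ = 0 ∧ ∀ j ∈ S, c j = 0 := by
  classical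
  have hq := two_le_card Fq
  set q := Fintype.card Fq with hqdef
  have hθ0 : 0 < ‖θ‖ := by linarith
  obtain ⟨τ, hτ, hτθ⟩ : ∃ τ : ℝ, 1 < τ ∧ τ ^ (q - 1) = ‖θ‖ ^ q :=
    ⟨(‖θ‖ ^ q) ^ (((q - 1 : ℕ) : ℝ)⁻¹),
      Real.one_lt_rpow (one_lt_pow₀ hθ (by omega)) (inv_pos.2 (by exact_mod_cast (by omega))),
      Real.rpow_inv_natCast_pow (by positivity) (by omega)⟩
  obtain ⟨Γ, h, g, hΓ, hdeg, hh, hg, hgB, hgB', hgev⟩ := exists_zeta_series hθ hτ hτθ n hZ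
  set γ := aeval θ Γ with hγdef
  have hγ : γ ≠ 0 := aeval_ne_zero hθ hΓ
  set L : K[X] := X - C (θ ^ q) with hL
  have hL1 : L.natDegree = 1 := natDegree_X_sub_C _
  have hL0 : L ≠ 0 := X_sub_C_ne_zero _
  have hSn : ∀ j ∈ S, j ≤ n := fun j hj => (hS j hj).2.1.le
  have hind : ∀ (b : ℕ → K[X]) (e : K[X]),
      ∑ j ∈ S, toSeries K (b j) * g (n - j) + toSeries K e = 0 → ∀ j ∈ S, b j = 0 := by
    intro b e hbe j hj
    have hinj : Set.InjOn (fun j => n - j) S := fun i hi j hj hij => by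
      have := hSn i hi
      have := hSn j hj
      simp only at hij
      omega
    have := coeff_eq_zero_of_relation (Fq := Fq) hL1 hg (S.image fun j => n - j)
      (by
        intro s hs x y hy hy1 hx hxy
        obtain ⟨j, hj, rfl⟩ := Finset.mem_image.1 hs
        obtain ⟨h1, h2, -⟩ := hS j hj
        have h3 := (hgev (n - j) (by omega) (by omega) 0)
        rw [tw_zero] at h3
        have h4 := h3.poly_mul y
        rw [hxy] at h4
        have h5 := h4.unique (hasEv_toSeries θ x).neg
        rw [eval_eq_zero_of_frobenius_eq (Fq := Fq) (by omega) hx, neg_zero] at h5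
        have h6 := zeta_ne_zero hθ (by omega) (hZ (n - j) (by omega))
        simp [eval_ne_zero_of_fixed hθ hy1 hy, hγ, h6, ell] at h5)
      (b := fun s => b (n - s)) (e := e)
      (by
        rw [Finset.sum_image hinj, ← hbe]
        congr 1
        refine Finset.sum_congr rfl fun j hj => ?_
        rw [Nat.sub_sub_self (hSn j hj)])
      (n - j) (Finset.mem_image_of_mem _ hj)
    simpa only [Nat.sub_sub_self (hSn j hj)] using this
  -- the solution of the second-order equation
  set A₀ : Fq[X][X] := c₀.map C * Γ.map C * h n with hA₀
  set P : ℕ → Fq[X][X] := fun j => (c j).map C * h j with hP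
  set a : K⟦X⟧ := toSeries K (spec Fq θ A₀) + ∑ j ∈ S, toSeries K (spec Fq θ (P j)) *
    (g (n - j) - toSeries K (spec Fq θ (h (n - j)))) with ha
  have hτ0 : 0 < τ := by linarith
  have ha1 : Bdd 1 (τ ^ n / τ) a := by
    refine Bdd.add one_pos ?_ (Bdd.sum one_pos (by positivity) fun j hj => ?_)
    · obtain ⟨e, he1, he2⟩ := hdeg n
      refine CoeffDegLE.bdd_spec_one hθ hτ hτθ hn ?_ he2
      simpa using ((coeffDegLE_map_C c₀).mul (coeffDegLE_map_C Γ)).mul he1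
    · obtain ⟨h1, h2, -⟩ := hS j hj
      obtain ⟨e, he1, he2⟩ := hdeg j
      obtain ⟨e', he1', he2'⟩ := hdeg (n - j)
      have h3 : Bdd 1 (τ ^ j / τ) (toSeries K (spec Fq θ (P j))) := by
        refine CoeffDegLE.bdd_spec_one hθ hτ hτθ h1 ?_ he2
        simpa using (coeffDegLE_map_C (c j)).mul he1
      have h4 := (hgB (n - j)).sub one_pos (he1'.bdd_spec_one hθ hτ hτθ (by omega) he2')
      refine (h3.mul one_pos h4).mono ?_
      rw [div_mul_div_comm, ← pow_add, Nat.add_sub_cancel' h2.le]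
      refine div_le_div_of_nonneg_left (by positivity) hτ0 (le_mul_of_one_le_right hτ0.le hτ.le)
  have hρ : 0 < ‖θ‖ ^ q := by positivity
  obtain ⟨B, hB⟩ : ∃ B, Bdd (‖θ‖ ^ q) B a := by
    have hj : ∀ j, ∃ B, Bdd (‖θ‖ ^ q) B (toSeries K (spec Fq θ (P j)) *
        (g (n - j) - toSeries K (spec Fq θ (h (n - j))))) := fun j => by
      obtain ⟨B₁, h₁⟩ := exists_bdd_toSeries hρ.le (spec Fq θ (P j))
      obtain ⟨B₂, h₂⟩ := exists_bdd_toSeries hρ.le (spec Fq θ (h (n - j)))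
      obtain ⟨B₃, h₃⟩ := hgB' (n - j)
      exact ⟨_, h₁.mul hρ ((h₃.mono (le_max_left B₃ B₂)).sub hρ (h₂.mono (le_max_right _ _)))⟩
    choose B hB using hj
    obtain ⟨B₀, h₀⟩ := exists_bdd_toSeries hρ.le (spec Fq θ A₀)
    have h0 : 0 ≤ ∑ j ∈ S, B j := Finset.sum_nonneg fun j _ => (hB j).nonneg
    refine ⟨_, (h₀.mono (le_max_left B₀ (∑ j ∈ S, B j))).add hρ
      (Bdd.sum hρ (h0.trans (le_max_right _ _)) fun j hj => (hB j).mono ?_)⟩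
    exact (Finset.single_le_sum (f := B) (fun j _ => (hB j).nonneg) hj).trans (le_max_right _ _)
  obtain ⟨F, -, hFB, hF, hFev⟩ := exists_frobenius_solution (Fq := Fq) hθ hτ hτθ n ha1 hB
  have hF0 : HasEv θ F 0 := by
    obtain ⟨u, hu, hsum⟩ := hFev (fun d => aeval θ (twEval Fq d 1 A₀) +
        ∑ j ∈ S, aeval θ (twEval Fq d 1 (P j)) * (γ * (ell Fq θ d ^ (n - j) *
          (Z (n - j) - ∑ i ∈ Finset.range (d + 1), powSum Fq θ i (n - j))))) (fun d => by
      rw [ha, map_add, map_sum]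
      refine (hasEv_tw_spec θ d A₀).add (HasEv.sum fun j hj => ?_)
      obtain ⟨h1, h2, -⟩ := hS j hj
      rw [map_mul, map_sub, tw_toSeries, ← eval_ptw_spec θ d 1 (P j), pow_one]
      convert ((hgev (n - j) (by omega) (by omega) d).sub
        (hasEv_tw_spec θ d _)).poly_mul _ using 2
      rw [hh (n - j) (by omega) (by omega), Finset.sum_range_succ]
      ring)
    have h2 : HasSum _ (γ ^ 2 * 0) := hrel.mul_left (γ ^ 2)
    rw [mul_zero] at h2
    convert hu using 1
    refine h2.unique (hsum.congr_fun fun d => ?_)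
    have hd := ell_ne_zero (Fq := Fq) hθ d
    rw [add_div, Finset.sum_div, mul_add, Finset.mul_sum]
    congr 1
    · simp only [hA₀, map_mul, twEval_map_C, hh n hn le_rfl, pow_one, comp_X, ← hγdef]
      field_simp
    · refine Finset.sum_congr rfl fun j hj => ?_
      obtain ⟨h1, h2, -⟩ := hS j hj
      simp only [hP, map_mul, twEval_map_C, hh j h1 h2.le, pow_one, comp_X]
      rw [← pow_sub_mul_pow _ h2.le]
      field_simp
  obtain ⟨M, p₁, e₁, b₁, hne₁, hrel₁⟩ :=
    exists_tw_relation_of_hasEv_zero hθ hSn hg hF hgB' ⟨B, hFB⟩ hF0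
  have hF' : tw Fq K 1 F = toSeries K (L ^ n) * (F - (toSeries K (spec Fq θ A₀) +
      ∑ j ∈ S, toSeries K (spec Fq θ ((c j).map C) * spec Fq θ (h j)) *
        (g (n - j) - toSeries K (spec Fq θ (h (n - j)))))) := by
    simpa only [ha, hP, map_mul] using hF
  obtain ⟨p, e, b, hne, hpe⟩ := exists_relation_of_tw_relation (h := fun s => spec Fq θ (h s))
    hL0 hg hF' M hne₁ hrel₁
  have hp : p ≠ 0 := by
    rintro rfl
    rw [map_zero, zero_mul, zero_add] at hpe
    have hb := hind b e hpe
    rw [Finset.sum_eq_zero fun j hj => by rw [hb j hj, map_zero, zero_mul], zero_add] at hpe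
    have he : e = 0 := toSeries_injective (by rw [hpe, map_zero])
    rcases hne with h | ⟨j, hj, h⟩ | h
    exacts [h rfl, h (hb j hj), h he]
  have hfix : ∀ a : Fq[X], ptw Fq K 1 (spec Fq θ (a.map C)) = spec Fq θ (a.map C) := fun a => by
    ext m
    rw [coeff_ptw, coeff_spec, coeff_map, aeval_C, ← map_pow, pow_one, FiniteField.pow_card]
  have hc : ∀ j ∈ S, c j = 0 := by
    intro j hj
    obtain ⟨h1, h2, h3⟩ := hS j hj
    by_contra hcj
    obtain ⟨x', y', hy', hy1, -, hx'⟩ := exists_fixed_denominator hp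
      (frobenius_eq_of_relation (h := fun s => spec Fq θ (h s)) hL1 hSn hg hind hF' hpe j hj)
    refine h3 (card_sub_one_dvd_of_frobenius_eq hθ hv h1.ne'
      (c := spec Fq θ ((c j).map C) * y') (by rw [map_mul, hfix, hy1]) (mul_ne_zero ?_ hy') hγ
      (fun d => ?_) hx')
    · rw [map_ne_zero_iff _ (spec_injective hθ)]
      exact (Polynomial.map_ne_zero_iff C_injective).2 hcj
    · have := eval_ptw_spec (Fq := Fq) θ d 1 (h j)
      rw [pow_one] at this
      rw [this, hh j h1 h2.le]
  refine ⟨?_, hc⟩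
  by_contra hc0
  have h1 : HasSum (fun d => aeval θ c₀ * powSum Fq θ d n) 0 := hrel.congr_fun fun d => by
    rw [Finset.sum_eq_zero fun j hj => by rw [hc j hj, map_zero, zero_mul], add_zero]
  have h2 := h1.unique ((hZ n hn).mul_left _)
  exact mul_ne_zero (aeval_ne_zero hθ hc0) (zeta_ne_zero hθ (by omega) (hZ n hn)) h2.symm

end Abstract

section Sums

open Filter

variable {Fq : Type*} [Field Fq] [Fintype Fq] {K : Type*} [NormedField K]

variable (Fq) in
/-- Sorting the monic polynomials by degree. -/
noncomputable def sigmaMonics : (Σ d, ↥(monics Fq d)) ≃ {f : Fq[X] // f.Monic} where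
  toFun x := ⟨x.2, (mem_monics.1 x.2.2).1⟩
  invFun a := ⟨a.1.natDegree, a.1, mem_monics.2 ⟨a.2, rfl⟩⟩
  left_inv := by
    rintro ⟨d, a, ha⟩
    obtain rfl := (mem_monics.1 ha).2
    rfl
  right_inv _ := rfl

theorem hasSum_sum_monics {G : Fq[X] → K} {v : K}
    (hG : HasSum (fun a : {f : Fq[X] // f.Monic} => G a) v) :
    HasSum (fun d => ∑ a ∈ monics Fq d, G a) v := by
  refine HasSum.sigma ((sigmaMonics Fq).hasSum_iff.2 hG) fun d => ?_
  rw [← Finset.sum_coe_sort]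
  exact hasSum_fintype _

variable [Algebra Fq K] [IsUltrametricDist K] [CompleteSpace K]

theorem summable_inv_aeval_pow {θ : K} (hθ : 1 < ‖θ‖) {s : ℕ} (hs : 1 ≤ s) :
    Summable fun a : {f : Fq[X] // f.Monic} => ((aeval θ a.1) ^ s)⁻¹ := by
  refine NonarchimedeanAddGroup.summable_of_tendsto_cofinite_zero ?_
  rw [tendsto_zero_iff_norm_tendsto_zero]
  have h1 : Tendsto (fun d : ℕ => (‖θ‖⁻¹ ^ s) ^ d) atTop (nhds 0) :=
    tendsto_pow_atTop_nhds_zero_of_lt_one (by positivity)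
      (pow_lt_one₀ (by positivity) (inv_lt_one_of_one_lt₀ hθ) (by omega))
  have h2 : Tendsto (fun a : {f : Fq[X] // f.Monic} => a.1.natDegree) cofinite atTop := by
    rw [← Nat.cofinite_eq_atTop]
    refine Tendsto.cofinite_of_finite_preimage_singleton fun d => ?_
    refine Set.Finite.of_finite_image (f := Subtype.val) ((monics Fq d).finite_toSet.subset ?_)
      Subtype.val_injective.injOn
    rintro _ ⟨a, ha, rfl⟩
    exact mem_monics.2 ⟨a.2, ha⟩
  refine (h1.comp h2).congr fun a => ?_
  rw [Function.comp_apply, norm_inv, norm_pow, norm_aeval hθ a.2.ne_zero, inv_pow, inv_pow,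
    ← pow_mul, ← pow_mul, mul_comm]

theorem hasSum_powSum {θ : K} (hθ : 1 < ‖θ‖) {s : ℕ} (hs : 1 ≤ s) :
    HasSum (fun d => powSum Fq θ d s)
      (∑' a : {f : Fq[X] // f.Monic}, ((aeval θ a.1) ^ s)⁻¹) :=
  hasSum_sum_monics (summable_inv_aeval_pow hθ hs).hasSum

theorem hasSum_inv_aeval_pow_of_lt {θ : K} (hθ : 1 < ‖θ‖) {s : ℕ} (hs : 1 ≤ s) {Z : K}
    (hZ : HasSum (fun d => powSum Fq θ d s) Z) (d : ℕ) :
    HasSum (fun a : {f : Fq[X] // f.Monic} =>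
      if d < a.1.natDegree then ((aeval θ a.1) ^ s)⁻¹ else 0)
      (Z - ∑ i ∈ Finset.range (d + 1), powSum Fq θ i s) := by
  obtain ⟨v, hv⟩ : Summable fun a : {f : Fq[X] // f.Monic} =>
      if d < a.1.natDegree then ((aeval θ a.1) ^ s)⁻¹ else 0 := by
    refine ((summable_inv_aeval_pow (Fq := Fq) hθ hs).indicator
      {a | d < a.1.natDegree}).congr fun a => ?_
    simp [Set.indicator_apply]
  convert hv using 1
  have h1 := hasSum_sum_monics
    (G := fun a : Fq[X] => if d < a.natDegree then ((aeval θ a) ^ s)⁻¹ else 0) hv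
  have h2 : HasSum (fun i => if i ∈ Finset.range (d + 1) then powSum Fq θ i s else 0)
      (∑ i ∈ Finset.range (d + 1), powSum Fq θ i s) := by
    rw [Finset.sum_congr rfl fun i hi => (if_pos hi).symm]
    exact hasSum_sum_of_ne_finset_zero fun i hi => if_neg hi
  refine (hZ.sub h2).unique (h1.congr_fun fun i => ?_)
  by_cases hi : d < i
  · rw [if_neg (by simpa using hi), sub_zero, powSum]
    refine Finset.sum_congr rfl fun a ha => ?_
    rw [if_pos (by rwa [(mem_monics.1 ha).2])]
  · rw [if_pos (by simpa using hi), sub_self, Finset.sum_eq_zero fun a ha => ?_]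
    rw [if_neg (by rwa [(mem_monics.1 ha).2])]

/-- The double zeta value as a series over the degree of its second argument. -/
theorem hasSum_double {θ : K} (hθ : 1 < ‖θ‖) {s₁ s₂ : ℕ} (hs₁ : 1 ≤ s₁) (hs₂ : 1 ≤ s₂) {Z : K}
    (hZ : HasSum (fun d => powSum Fq θ d s₁) Z) :
    HasSum (fun d => powSum Fq θ d s₂ *
      (Z - ∑ i ∈ Finset.range (d + 1), powSum Fq θ i s₁))
      (∑' a : {g : Fq[X] × Fq[X] // g.1.Monic ∧ g.2.Monic ∧ g.2.degree < g.1.degree},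
        ((aeval θ a.1.1) ^ s₁)⁻¹ * ((aeval θ a.1.2) ^ s₂)⁻¹) := by
  classical
  set G : {f : Fq[X] // f.Monic} × {f : Fq[X] // f.Monic} → K := fun a =>
    if a.1.1.natDegree < a.2.1.natDegree then
      ((aeval θ a.1.1) ^ s₂)⁻¹ * ((aeval θ a.2.1) ^ s₁)⁻¹ else 0 with hG
  have : NonarchimedeanRing K := ⟨NonarchimedeanAddGroup.is_nonarchimedean⟩
  obtain ⟨v, hv⟩ : Summable G := by
    refine (((summable_inv_aeval_pow (Fq := Fq) hθ hs₂).mul_of_nonarchimedean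
      (summable_inv_aeval_pow (Fq := Fq) hθ hs₁)).indicator
        {a | a.1.1.natDegree < a.2.1.natDegree}).congr fun a => ?_
    simp [Set.indicator_apply, hG]
  have h1 : (∑' a : {g : Fq[X] × Fq[X] // g.1.Monic ∧ g.2.Monic ∧ g.2.degree < g.1.degree},
      ((aeval θ a.1.1) ^ s₁)⁻¹ * ((aeval θ a.1.2) ^ s₂)⁻¹) = v := by
    refine HasSum.tsum_eq ?_
    set ι : {g : Fq[X] × Fq[X] // g.1.Monic ∧ g.2.Monic ∧ g.2.degree < g.1.degree} →
      {f : Fq[X] // f.Monic} × {f : Fq[X] // f.Monic} :=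
        fun a => (⟨a.1.2, a.2.2.1⟩, ⟨a.1.1, a.2.1⟩) with hι
    have hinj : Function.Injective ι := by
      rintro ⟨⟨a, b⟩, h⟩ ⟨⟨a', b'⟩, h'⟩ hab
      simp only [hι, Prod.mk.injEq, Subtype.mk.injEq] at hab
      simp [hab.1, hab.2]
    refine ((hinj.hasSum_iff (f := G) fun a ha => ?_).2 hv).congr_fun fun a => ?_
    · refine if_neg fun hlt => ha ?_
      refine ⟨⟨(a.2.1, a.1.1), a.2.2, a.1.2, ?_⟩, rfl⟩
      exact degree_lt_degree hlt
    · have := natDegree_lt_natDegree a.2.2.1.ne_zero a.2.2.2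
      rw [Function.comp_apply, hG]
      simp only [hι, if_pos this]
      exact mul_comm _ _
  rw [h1]
  have h2 := hv.prod_fiberwise (g := fun a => ((aeval θ a.1) ^ s₂)⁻¹ *
      (Z - ∑ i ∈ Finset.range (a.1.natDegree + 1), powSum Fq θ i s₁)) fun a => by
    refine ((hasSum_inv_aeval_pow_of_lt hθ hs₁ hZ a.1.natDegree).mul_left _).congr_fun
      fun b => ?_
    simp only [hG, mul_ite, mul_zero]
  refine (hasSum_sum_monics (G := fun a => ((aeval θ a) ^ s₂)⁻¹ *
      (Z - ∑ i ∈ Finset.range (a.natDegree + 1), powSum Fq θ i s₁)) h2).congr_fun fun d => ?_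
  rw [powSum, Finset.sum_mul]
  refine Finset.sum_congr rfl fun a ha => ?_
  rw [(mem_monics.1 ha).2]

end Sums

section Rational

variable {Fq : Type*} [Field Fq] [Fintype Fq] {K : Type*} [NormedField K] [Algebra Fq K]
  [IsUltrametricDist K] [CompleteSpace K]

/-- The independence over `k` of `ζ(n)` and the double zeta values, for any complete
ultrametric field into which `k` embeds with the value group generated by `|θ| > 1`. -/
theorem eq_zero_of_zeta_relation {θ : K} (hθ : 1 < ‖θ‖)
    (hv : ∀ z : K, z ≠ 0 → ∃ m : ℤ, ‖z‖ = ‖θ‖ ^ m) (φ : RatFunc Fq →+* K)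
    (hφ : ∀ p : Fq[X], φ (algebraMap Fq[X] (RatFunc Fq) p) = aeval θ p) {n : ℕ} (hn : 1 ≤ n)
    {S : Finset ℕ} (hS : ∀ j ∈ S, 0 < j ∧ j < n ∧ ¬ (Fintype.card Fq - 1) ∣ j)
    (c₀ : RatFunc Fq) (c : ℕ → RatFunc Fq)
    (hrel : φ c₀ * ∑' a : {f : Fq[X] // f.Monic},
        φ ((algebraMap Fq[X] (RatFunc Fq) a.1) ^ n)⁻¹ +
      ∑ j ∈ S, φ (c j) *
        ∑' a : {g : Fq[X] × Fq[X] // g.1.Monic ∧ g.2.Monic ∧ g.2.degree < g.1.degree},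
          φ (((algebraMap Fq[X] (RatFunc Fq) a.1.1) ^ (n - j))⁻¹ *
            ((algebraMap Fq[X] (RatFunc Fq) a.1.2) ^ j)⁻¹) = 0) :
    c₀ = 0 ∧ ∀ j ∈ S, c j = 0 := by
  classical
  obtain ⟨b, hb⟩ := IsLocalization.exist_integer_multiples_of_finset (nonZeroDivisors Fq[X])
    (insert c₀ (S.image c))
  have hb0 : algebraMap Fq[X] (RatFunc Fq) b ≠ 0 :=
    IsFractionRing.to_map_ne_zero_of_mem_nonZeroDivisors b.2
  obtain ⟨C₀, hC₀⟩ := hb c₀ (Finset.mem_insert_self _ _)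
  have hC : ∀ j, ∃ C : Fq[X], j ∈ S →
      algebraMap Fq[X] (RatFunc Fq) C = (b : Fq[X]) • c j := fun j => by
    by_cases hj : j ∈ S
    · obtain ⟨C, hC⟩ := hb (c j) (Finset.mem_insert_of_mem (Finset.mem_image_of_mem _ hj))
      exact ⟨C, fun _ => hC⟩
    · exact ⟨0, fun h => (hj h).elim⟩
  choose C hC using hC
  rw [Algebra.smul_def] at hC₀
  simp only [Algebra.smul_def] at hC
  simp only [map_mul, map_inv₀, map_pow, hφ] at hrel
  set Z : ℕ → K := fun s => ∑' a : {f : Fq[X] // f.Monic}, ((aeval θ a.1) ^ s)⁻¹ with hZdef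
  have hZ : ∀ s, 1 ≤ s → HasSum (fun d => powSum Fq θ d s) (Z s) := fun s hs =>
    hasSum_powSum hθ hs
  have key := eq_zero_of_hasSum_zero hθ hv hn hS hZ C₀ C (by
    have h1 := ((hZ n hn).mul_left (aeval θ C₀)).add (hasSum_sum (s := S) fun j hj =>
      (hasSum_double (s₁ := n - j) (s₂ := j) hθ (by have := hS j hj; omega) (hS j hj).1
        (hZ (n - j) (by have := hS j hj; omega))).mul_left (aeval θ (C j)))
    have h2 : aeval θ C₀ * Z n + ∑ j ∈ S, aeval θ (C j) *
        ∑' a : {g : Fq[X] × Fq[X] // g.1.Monic ∧ g.2.Monic ∧ g.2.degree < g.1.degree},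
          ((aeval θ a.1.1) ^ (n - j))⁻¹ * ((aeval θ a.1.2) ^ j)⁻¹ = 0 := by
      rw [← hφ C₀, hC₀, map_mul, Finset.sum_congr rfl fun j hj => by
        rw [← hφ (C j), hC j hj, map_mul, mul_assoc], ← Finset.mul_sum, mul_assoc, ← mul_add, hrel,
        mul_zero]
    exact h2 ▸ h1)
  have hcancel : ∀ {x : RatFunc Fq} {P : Fq[X]}, algebraMap Fq[X] (RatFunc Fq) P =
      algebraMap Fq[X] (RatFunc Fq) b * x → P = 0 → x = 0 := by
    rintro x P hP rfl
    rw [map_zero] at hP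
    exact (mul_eq_zero.1 hP.symm).resolve_left hb0
  exact ⟨hcancel hC₀ key.1, fun j hj => hcancel (hC j hj) (key.2 j hj)⟩

end Rational

section Completion

variable (Fq : Type) [Field Fq] [DecidableEq (RatFunc Fq)]

open WithZero

theorem valued_toKinfty (x : RatFunc Fq) :
    Valued.v (toKinfty Fq x) = RatFunc.inftyValuation Fq x :=
  letI := RatFunc.inftyValued Fq
  Valued.valuedCompletion_apply x

theorem valued_toKinfty_X : Valued.v (toKinfty Fq RatFunc.X) = exp (1 : ℤ) := by
  rw [valued_toKinfty, RatFunc.inftyValuation.X]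

instance isNontrivial_valuation :
    (Valued.v : Valuation (RatFunc.CompletionAtInfty Fq)
      (WithZero (Multiplicative ℤ))).IsNontrivial :=
  ⟨toKinfty Fq RatFunc.X, by rw [valued_toKinfty_X]; simp, by rw [valued_toKinfty_X]; simp⟩

theorem nonempty_rankOne :
    Nonempty (Valued.v : Valuation (RatFunc.CompletionAtInfty Fq)
      (WithZero (Multiplicative ℤ))).RankOne := by
  rw [Valuation.nonempty_rankOne_iff_mulArchimedean]
  exact MulArchimedean.comap
    (MonoidWithZeroHom.ValueGroup₀.embedding (f := MonoidWithZeroHom.ofClass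
      (Valued.v : Valuation (RatFunc.CompletionAtInfty Fq)
        (WithZero (Multiplicative ℤ))))).toMonoidHom
    MonoidWithZeroHom.ValueGroup₀.embedding_strictMono

instance completeSpace : CompleteSpace (RatFunc.CompletionAtInfty Fq) :=
  letI := RatFunc.inftyValued Fq
  inferInstanceAs (CompleteSpace (UniformSpace.Completion (RatFunc Fq)))

end Completion

end CarlitzZeta

/-- For every integer `n ≥ 2`, the set
`{ζ_A(n)} ∪ {ζ_A(s₁, s₂) : s₁, s₂ ≥ 1, s₁ + s₂ = n, (q-1) ∤ s₂} ⊂ k_∞`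
is linearly independent over `k = 𝔽_q(θ)`.  (Here the double zeta values of weight
`n` are indexed by their second entry `s₂ = j ∈ (0, n)` with `(q-1) ∤ j`, the first
entry being `n - j`.) -/
theorem zeta_parity_linear_independence
    (Fq : Type) [Field Fq] [Fintype Fq] [DecidableEq (RatFunc Fq)]
    (n : ℕ) (hn : 2 ≤ n)
    (c₀ : RatFunc Fq) (c : ℕ → RatFunc Fq)
    (hrel : toKinfty Fq c₀ * carlitzZeta Fq n +
      ∑ j ∈ (Finset.Ioo 0 n).filter (fun j => ¬ (Fintype.card Fq - 1) ∣ j),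
        toKinfty Fq (c j) * doubleZeta Fq (n - j) j = 0) :
    c₀ = 0 ∧
      ∀ j ∈ (Finset.Ioo 0 n).filter (fun j => ¬ (Fintype.card Fq - 1) ∣ j),
        c j = 0 := by
  obtain ⟨hr⟩ := CarlitzZeta.nonempty_rankOne Fq
  let _ : NormedField (RatFunc.CompletionAtInfty Fq) :=
    Valued.toNormedField _ (WithZero (Multiplicative ℤ))
  let _ : Algebra Fq (RatFunc.CompletionAtInfty Fq) :=
    ((toKinfty Fq).comp (algebraMap Fq (RatFunc Fq))).toAlgebra
  have hv := CarlitzZeta.valued_toKinfty_X Fq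
  have hθ : 1 < ‖toKinfty Fq RatFunc.X‖ := by
    rw [Valued.toNormedField.one_lt_norm_iff, hv, ← WithZero.exp_zero, WithZero.exp_lt_exp]
    exact one_pos
  refine CarlitzZeta.eq_zero_of_zeta_relation hθ (fun z hz => ?_) (toKinfty Fq) (fun p => ?_)
    (by omega) (fun j hj => ?_) c₀ c hrel
  · have hz' : Valued.v z ≠ 0 := (Valuation.ne_zero_iff _).2 hz
    refine ⟨WithZero.log (Valued.v z), ?_⟩
    have h : Valued.v (toKinfty Fq RatFunc.X ^ WithZero.log (Valued.v z)) = Valued.v z := by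
      rw [map_zpow₀, hv, ← WithZero.exp_zsmul, smul_eq_mul, mul_one, WithZero.exp_log hz']
    rw [← norm_zpow]
    exact le_antisymm (Valued.toNormedField.norm_le_iff.2 h.ge)
      (Valued.toNormedField.norm_le_iff.2 h.le)
  · rw [← RatFunc.algebraMap_X]
    induction p using Polynomial.induction_on' with
    | add p r hp hr => rw [map_add, map_add, map_add, hp, hr]
    | monomial k a =>
      rw [aeval_monomial, ← C_mul_X_pow_eq_monomial, map_mul, map_mul, map_pow, map_pow]
      rfl
  · simpa [and_assoc] using hj
end

section
/- If n ≥ 1 is an integer not divisible by q−1, then π^n does not lie in the image of k_∞ in L; in particular π^n ∉ k_∞ when L = ℂ_∞ and π = π̃. -/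
open Polynomial FunctionField

/-- The image of `θ` in `k_∞`. -/
noncomputable def thetaInfty (Fq : Type) [Field Fq] [DecidableEq (RatFunc Fq)] :
    RatFunc.CompletionAtInfty Fq :=
  toKinfty Fq (algebraMap (Polynomial Fq) (RatFunc Fq) X)

/-- `ϖ = -θ^q ∏_{i=1}^∞ (1 - θ^{1-q^i})^{-(q-1)} ∈ k_∞`, which equals `π̃^{q-1}`
for a fundamental period `π̃` of the Carlitz module. -/
noncomputable def varpi (Fq : Type) [Field Fq] [Fintype Fq]
    [DecidableEq (RatFunc Fq)] : RatFunc.CompletionAtInfty Fq :=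
  -(thetaInfty Fq ^ Fintype.card Fq) *
    ∏' i : ℕ,
      ((1 - thetaInfty Fq ^ ((1 : ℤ) - (Fintype.card Fq : ℤ) ^ (i + 1)))⁻¹) ^
        (Fintype.card Fq - 1)

open WithZero

/-- The unit sphere of a valued ring is closed. -/
theorem Valued.isClosed_setOf_v_eq_one {R Γ₀ : Type*} [CommRing R]
    [LinearOrderedCommGroupWithZero Γ₀] [Valued R Γ₀] :
    IsClosed {x : R | Valued.v x = 1} := by
  simpa [Valuation.restrict_eq_one_iff] using Valued.isClosed_sphere R (Γ₀ := Γ₀) 1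

/-- An infinite product of elements of valuation one has valuation one. -/
theorem Valued.v_tprod_eq_one {R Γ₀ β : Type*} [CommRing R]
    [LinearOrderedCommGroupWithZero Γ₀] [Valued R Γ₀] {f : β → R}
    (hf : ∀ i, Valued.v (f i) = 1) : Valued.v (∏' i, f i) = 1 := by
  by_cases h : Multipliable f
  · refine Valued.isClosed_setOf_v_eq_one.mem_of_tendsto h.hasProd (.of_forall fun s ↦ ?_)
    simp [map_prod, hf]
  · simp [tprod_eq_one_of_not_multipliable h]

section Carlitz

variable (Fq : Type) [Field Fq] [DecidableEq (RatFunc Fq)]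

theorem v_toKinfty (x : RatFunc Fq) :
    Valued.v (toKinfty Fq x) = RatFunc.inftyValuation Fq x :=
  letI := RatFunc.inftyValued Fq
  Valued.valuedCompletion_apply x

theorem v_thetaInfty : Valued.v (thetaInfty Fq) = exp (1 : ℤ) := by
  rw [thetaInfty, v_toKinfty, RatFunc.algebraMap_X, RatFunc.inftyValuation.X]

theorem v_one_sub_thetaInfty_zpow {m : ℤ} (hm : m < 0) :
    Valued.v (1 - thetaInfty Fq ^ m) = 1 := by
  have h : Valued.v (thetaInfty Fq ^ m) < 1 := by
    rw [map_zpow₀, v_thetaInfty, ← exp_zsmul, ← exp_zero, exp_lt_exp]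
    simpa using hm
  exact Valuation.map_one_sub_of_lt _ h

theorem v_varpi [Fintype Fq] : Valued.v (varpi Fq) = exp (Fintype.card Fq : ℤ) := by
  rw [varpi, map_mul, Valuation.map_neg, map_pow, v_thetaInfty, Valued.v_tprod_eq_one,
    mul_one, ← exp_nsmul]
  · simp
  · intro i
    have hq : (1 : ℤ) < Fintype.card Fq := by exact_mod_cast Fintype.one_lt_card
    rw [map_pow, map_inv₀, v_one_sub_thetaInfty_zpow, inv_one, one_pow]
    exact sub_neg.mpr (one_lt_pow₀ hq i.succ_ne_zero)

end Carlitz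

/-- If `n ≥ 1` is an integer not divisible by `q - 1`, then `π^n`
does not lie in the image of `k_∞` in `L`; in particular `π̃^n ∉ k_∞` for the
Carlitz period `π̃` when `L = ℂ_∞`. -/
theorem pi_pow_not_mem_Kinfty_of_A_odd
    (Fq : Type) [Field Fq] [Fintype Fq] [DecidableEq (RatFunc Fq)]
    (L : Type) [Field L] (ι : RatFunc.CompletionAtInfty Fq →+* L) (hι : Function.Injective ι)
    (π : L) (hπ : π ^ (Fintype.card Fq - 1) = ι (varpi Fq))
    (n : ℕ) (hn : 1 ≤ n) (hdvd : ¬ (Fintype.card Fq - 1) ∣ n) :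
    π ^ n ∉ Set.range ι := by
  rintro ⟨a, ha⟩
  obtain ⟨d, hd⟩ : ∃ d, Fintype.card Fq = d + 1 :=
    Nat.exists_eq_add_one.mpr Fintype.card_pos
  have hpow : a ^ (Fintype.card Fq - 1) = varpi Fq ^ n := by
    apply hι
    rw [map_pow, map_pow, ha, ← hπ, pow_right_comm]
  have hv := congrArg (Valued.v (Γ₀ := ℤᵐ⁰)) hpow
  have hvarpi : varpi Fq ≠ 0 := by
    intro h
    exact exp_ne_zero (by rw [← v_varpi Fq, h, map_zero])
  have hd0 : d ≠ 0 := by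
    have := Fintype.one_lt_card (α := Fq)
    omega
  have ha0 : a ≠ 0 := by
    rintro rfl
    rw [hd, Nat.add_sub_cancel, zero_pow hd0] at hpow
    exact pow_ne_zero n hvarpi hpow.symm
  obtain ⟨m, hm⟩ : ∃ m : ℤ, Valued.v a = exp m :=
    ⟨log (Valued.v a), (exp_log ((Valuation.ne_zero_iff _).mpr ha0)).symm⟩
  rw [map_pow, map_pow, v_varpi, hm, ← exp_nsmul, ← exp_nsmul, exp_inj, hd,
    Nat.add_sub_cancel] at hv
  simp only [nsmul_eq_mul, Nat.cast_add, Nat.cast_one] at hv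
  refine hdvd ?_
  rw [hd, Nat.add_sub_cancel, ← Int.natCast_dvd_natCast]
  exact ⟨m - n, by linear_combination -hv⟩
end
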